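/- Let p : ℝ^n → [1,∞) be measurable with p_- > 1 and p_+ < ∞. Then the Hardy–Littlewood maximal operator M is bounded on L^{p(·)} (i.e., there exists C > 0 with ‖Mf‖_{p(·)} ≤ C‖f‖_{p(·)} for all f ∈ L^{p(·)}) if and only if both p(·) and the conjugate exponent p'(·) satisfy the A_∞ condition. -/

import Mathlib

open MeasureTheory ENNReal Set

noncomputable section

/-- An axis-parallel cube in `ℝⁿ`, given by its center and (positive) side length. -/
structure RCube (n : ℕ) where
  center : Fin n → ℝ
  side : ℝ
  side_pos : 0 < side

namespace RCube

/-- The (closed) cube as a subset of `ℝⁿ`. -/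
def toSet {n : ℕ} (Q : RCube n) : Set (Fin n → ℝ) :=
  {x | ∀ i, |x i - Q.center i| ≤ Q.side / 2}

/-- `rQ`: the cube concentric with `Q` whose side length is `r` times that of `Q`. -/
def scaledSet {n : ℕ} (Q : RCube n) (r : ℝ) : Set (Fin n → ℝ) :=
  {x | ∀ i, |x i - Q.center i| ≤ r * Q.side / 2}

end RCube

/-- A family of pairwise disjoint cubes. -/
def PairwiseDisjointCubes {n : ℕ} (F : Set (RCube n)) : Prop :=
  F.Pairwise fun Q₁ Q₂ => Disjoint Q₁.toSet Q₂.toSet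

/-- The variable Lebesgue norm `‖f‖_{p(·)}` for a real-valued (finite) exponent,
applied to an `ℝ≥0∞`-valued function: `inf {λ > 0 : ∫ (f/λ)^{p(x)} dx ≤ 1}`. -/
def vnorm {n : ℕ} (p : (Fin n → ℝ) → ℝ) (f : (Fin n → ℝ) → ℝ≥0∞) : ℝ≥0∞ :=
  sInf {lam : ℝ≥0∞ | 0 < lam ∧ (∫⁻ x, (f x / lam) ^ p x) ≤ 1}

/-- `t^e` for `t, e ∈ [0,∞]`, with the standard variable-exponent convention
`t^∞ = 0` for `t ≤ 1` and `t^∞ = ∞` for `t > 1`. -/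
def epow (t e : ℝ≥0∞) : ℝ≥0∞ :=
  if e = ∞ then (if t ≤ 1 then 0 else ∞) else t ^ e.toReal

/-- The variable Lebesgue norm for an exponent with values in `[1,∞]`. -/
def vnormE {n : ℕ} (p : (Fin n → ℝ) → ℝ≥0∞) (f : (Fin n → ℝ) → ℝ≥0∞) : ℝ≥0∞ :=
  sInf {lam : ℝ≥0∞ | 0 < lam ∧ (∫⁻ x, epow (f x / lam) (p x)) ≤ 1}

/-- `|f|` as an `ℝ≥0∞`-valued function. -/
def ofR {n : ℕ} (f : (Fin n → ℝ) → ℝ) : (Fin n → ℝ) → ℝ≥0∞ :=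
  fun x => ENNReal.ofReal |f x|

/-- The `ℝ≥0∞`-valued characteristic function of a set. -/
def chiE {n : ℕ} (S : Set (Fin n → ℝ)) : (Fin n → ℝ) → ℝ≥0∞ :=
  S.indicator fun _ => 1

/-- The Hardy--Littlewood maximal operator (over axis-parallel cubes containing `x`). -/
def hlMaximal {n : ℕ} (f : (Fin n → ℝ) → ℝ) (x : Fin n → ℝ) : ℝ≥0∞ :=
  ⨆ (Q : RCube n) (_ : x ∈ Q.toSet),
    (∫⁻ y in Q.toSet, ENNReal.ofReal |f y|) / volume Q.toSet

/-- `M` is bounded on `L^{p(·)}`: there is `C > 0` with `‖Mf‖_{p(·)} ≤ C ‖f‖_{p(·)}`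
for every `f ∈ L^{p(·)}`. -/
def MaximalBounded {n : ℕ} (p : (Fin n → ℝ) → ℝ) : Prop :=
  ∃ C > (0 : ℝ), ∀ f : (Fin n → ℝ) → ℝ, Measurable f → vnorm p (ofR f) < ∞ →
    vnorm p (hlMaximal f) ≤ ENNReal.ofReal C * vnorm p (ofR f)

/-- The function `∑_{Q ∈ F} t_Q χ_{E_Q}` (for a pairwise disjoint family,
written as a pointwise supremum). -/
def cubeSum {n : ℕ} (F : Set (RCube n)) (t : RCube n → ℝ)
    (E : RCube n → Set (Fin n → ℝ)) (x : Fin n → ℝ) : ℝ≥0∞ :=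
  ⨆ (Q : RCube n) (_ : Q ∈ F) (_ : x ∈ E Q), ENNReal.ofReal (t Q)

/-- `p(·)` satisfies the `A_∞` condition with parameter `lam` and constant `C`. -/
def AInftyWith {n : ℕ} (p : (Fin n → ℝ) → ℝ) (lam C : ℝ) : Prop :=
  ∀ F : Set (RCube n), PairwiseDisjointCubes F →
    ∀ t : RCube n → ℝ, (∀ Q ∈ F, 0 ≤ t Q) →
      ∀ E : RCube n → Set (Fin n → ℝ),
        (∀ Q ∈ F, MeasurableSet (E Q) ∧ E Q ⊆ Q.toSet ∧
          ENNReal.ofReal lam * volume Q.toSet ≤ volume (E Q)) →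
        vnorm p (cubeSum F t RCube.toSet) ≤ ENNReal.ofReal C * vnorm p (cubeSum F t E)

/-- The `A_∞` condition for a real-valued exponent. -/
def AInfty {n : ℕ} (p : (Fin n → ℝ) → ℝ) : Prop :=
  ∃ lam ∈ Ioo (0 : ℝ) 1, ∃ C > (0 : ℝ), AInftyWith p lam C

/-- `p(·)` satisfies the `A_∞` condition with parameter `lam` and constant `C`
(exponent with values in `[1,∞]`). -/
def AInftyWithE {n : ℕ} (p : (Fin n → ℝ) → ℝ≥0∞) (lam C : ℝ) : Prop :=
  ∀ F : Set (RCube n), PairwiseDisjointCubes F →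
    ∀ t : RCube n → ℝ, (∀ Q ∈ F, 0 ≤ t Q) →
      ∀ E : RCube n → Set (Fin n → ℝ),
        (∀ Q ∈ F, MeasurableSet (E Q) ∧ E Q ⊆ Q.toSet ∧
          ENNReal.ofReal lam * volume Q.toSet ≤ volume (E Q)) →
        vnormE p (cubeSum F t RCube.toSet) ≤ ENNReal.ofReal C * vnormE p (cubeSum F t E)

/-- The `A_∞` condition for an exponent with values in `[1,∞]`. -/
def AInftyE {n : ℕ} (p : (Fin n → ℝ) → ℝ≥0∞) : Prop :=
  ∃ lam ∈ Ioo (0 : ℝ) 1, ∃ C > (0 : ℝ), AInftyWithE p lam C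

/-- The nonincreasing-rearrangement value `(f χ_Q)^*(s) = inf {α : |{x ∈ Q : |f x| > α}| ≤ s}`. -/
def rearr {n : ℕ} (f : (Fin n → ℝ) → ℝ) (Q : RCube n) (s : ℝ≥0∞) : ℝ≥0∞ :=
  sInf {a : ℝ≥0∞ | volume {x | x ∈ Q.toSet ∧ a < ENNReal.ofReal |f x|} ≤ s}

/-- The `λ`-median maximal operator `m_λ`. -/
def medianMax {n : ℕ} (lam : ℝ) (f : (Fin n → ℝ) → ℝ) (x : Fin n → ℝ) : ℝ≥0∞ :=
  ⨆ (Q : RCube n) (_ : x ∈ Q.toSet), rearr f Q (ENNReal.ofReal lam * volume Q.toSet)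

/-- The modified median maximal operator `m_{τ,r}` (supremum over cubes `Q` with `x ∈ rQ`). -/
def medianMaxR {n : ℕ} (tau r : ℝ) (f : (Fin n → ℝ) → ℝ) (x : Fin n → ℝ) : ℝ≥0∞ :=
  ⨆ (Q : RCube n) (_ : x ∈ Q.scaledSet r), rearr f Q (ENNReal.ofReal tau * volume Q.toSet)

/-- The average `⟨f⟩_Q = (1/|Q|) ∫_Q f`. -/
def cubeAvg {n : ℕ} (f : (Fin n → ℝ) → ℝ) (Q : RCube n) : ℝ :=
  (∫ y in Q.toSet, f y) / (volume Q.toSet).toReal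

/-- `|T_F f|` for a pairwise disjoint family `F`, written as a pointwise supremum. -/
def avgSum {n : ℕ} (F : Set (RCube n)) (f : (Fin n → ℝ) → ℝ) (x : Fin n → ℝ) : ℝ≥0∞ :=
  ⨆ (Q : RCube n) (_ : Q ∈ F) (_ : x ∈ Q.toSet), ENNReal.ofReal |cubeAvg f Q|

/-- The reverse Hölder condition `RH`. -/
def RHCond {n : ℕ} (p : (Fin n → ℝ) → ℝ) : Prop :=
  ∃ r : ℝ, 1 < r ∧ ∃ C : ℝ, 0 < C ∧
    ∀ S : Set (RCube n), PairwiseDisjointCubes S →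
      ∀ t : RCube n → ℝ, (∀ Q ∈ S, 0 ≤ t Q) →
        (∑' Q : S, ∫⁻ x in Q.1.toSet, ENNReal.ofReal (t Q.1) ^ p x) ≤ 1 →
        (∑' Q : S, volume Q.1.toSet *
            ((∫⁻ x in Q.1.toSet, ENNReal.ofReal (t Q.1) ^ (r * p x)) / volume Q.1.toSet)
              ^ (1 / r)) ≤ ENNReal.ofReal C


/-! ### Basic facts on cubes and modulars -/

lemma toSet_eq_closedBall {n : ℕ} (Q : RCube n) :
    Q.toSet = Metric.closedBall Q.center (Q.side / 2) := by
  ext x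
  have := Q.side_pos
  simp only [RCube.toSet, mem_ofPred_eq, Metric.mem_closedBall]
  rw [dist_pi_le_iff (by linarith)]
  rfl

lemma measurableSet_toSet {n : ℕ} (Q : RCube n) : MeasurableSet Q.toSet := by
  rw [toSet_eq_closedBall]; exact Metric.isClosed_closedBall.measurableSet

lemma volume_toSet {n : ℕ} (Q : RCube n) : volume Q.toSet = ENNReal.ofReal (Q.side ^ n) := by
  have := Q.side_pos
  rw [toSet_eq_closedBall, Real.volume_pi_closedBall _ (by linarith)]
  congr 1
  simp only [Fintype.card_fin]
  congr 1; ring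

lemma volume_toSet_ne_zero {n : ℕ} (Q : RCube n) : volume Q.toSet ≠ 0 := by
  rw [volume_toSet]
  have := pow_pos Q.side_pos n
  simpa using this

lemma volume_toSet_ne_top {n : ℕ} (Q : RCube n) : volume Q.toSet ≠ ∞ := by
  rw [volume_toSet]; exact ENNReal.ofReal_ne_top

lemma center_mem_toSet {n : ℕ} (Q : RCube n) : Q.center ∈ Q.toSet := by
  have := Q.side_pos
  intro i
  simp only [sub_self, abs_zero]; linarith

lemma interior_toSet_nonempty {n : ℕ} (Q : RCube n) : (interior Q.toSet).Nonempty := by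
  have := Q.side_pos
  refine ⟨Q.center, ?_⟩
  rw [toSet_eq_closedBall]
  exact Metric.ball_subset_interior_closedBall (Metric.mem_ball_self (by linarith))

/-- The cube with given center and half side. -/
def cubeOf {n : ℕ} (c : Fin n → ℝ) (r : ℝ) (hr : 0 < r) : RCube n := ⟨c, 2 * r, by linarith⟩

lemma cubeOf_toSet {n : ℕ} (c : Fin n → ℝ) (r : ℝ) (hr : 0 < r) :
    (cubeOf c r hr).toSet = Metric.closedBall c r := by
  rw [toSet_eq_closedBall]
  simp [cubeOf]

lemma countable_of_disjoint_cubes {n : ℕ} {ι : Type*} (s : Set ι) (Q : ι → RCube n)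
    (h : s.PairwiseDisjoint fun i => (Q i).toSet) : s.Countable :=
  h.countable_of_nonempty_interior fun i _ => interior_toSet_nonempty (Q i)

lemma injective_of_disjoint_cubes {n : ℕ} {ι : Type*} {Q : ι → RCube n}
    (h : Pairwise fun i j => Disjoint (Q i).toSet (Q j).toSet) : Function.Injective Q := by
  intro i j hij
  by_contra hne
  have : Disjoint (Q i).toSet (Q j).toSet := h hne
  rw [hij, disjoint_self] at this
  have h2 := center_mem_toSet (Q j)
  simp [this] at h2

lemma cubeSum_range_lintegral {n : ℕ} {ι : Type*} [Countable ι] (p : (Fin n → ℝ) → ℝ)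
    (hpm : Measurable p) (hp : ∀ᵐ x, 0 < p x) (Q : ι → RCube n)
    (hQ : Pairwise fun i j => Disjoint (Q i).toSet (Q j).toSet) (t : RCube n → ℝ)
    (E : RCube n → Set (Fin n → ℝ)) (hEm : ∀ i, MeasurableSet (E (Q i)))
    (hE : ∀ i, E (Q i) ⊆ (Q i).toSet) (mu : ℝ≥0∞) :
    ∫⁻ x, (cubeSum (range Q) t E x / mu) ^ p x
      = ∑' i, ∫⁻ x in E (Q i), (ENNReal.ofReal (t (Q i)) / mu) ^ p x := by
  have h1 : ∀ᵐ x, (cubeSum (range Q) t E x / mu) ^ p x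
      = ∑' i, (E (Q i)).indicator (fun x => (ENNReal.ofReal (t (Q i)) / mu) ^ p x) x := by
    filter_upwards [hp] with x hx
    by_cases hex : ∃ i, x ∈ E (Q i)
    · obtain ⟨i, hi⟩ := hex
      have huniq : ∀ j, x ∈ E (Q j) → j = i := by
        intro j hj
        by_contra hne
        exact Set.disjoint_left.1 (hQ hne) (hE j hj) (hE i hi)
      rw [tsum_eq_single i]
      · rw [indicator_of_mem hi]
        congr 2
        unfold cubeSum
        apply le_antisymm
        · refine iSup_le fun R => iSup_le fun hR => iSup_le fun hxR => ?_
          obtain ⟨j, rfl⟩ := hR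
          rw [huniq j hxR]
        · exact le_iSup_of_le (Q i) (le_iSup_of_le ⟨i, rfl⟩ (le_iSup_of_le hi le_rfl))
      · intro j hj
        rw [indicator_of_notMem]
        exact fun h => hj (huniq j h)
    · push Not at hex
      have h0 : cubeSum (range Q) t E x = 0 := by
        unfold cubeSum
        simp only [ENNReal.iSup_eq_zero]
        rintro R ⟨i, rfl⟩ hx
        exact absurd hx (hex i)
      rw [h0, ENNReal.zero_div, ENNReal.zero_rpow_of_pos hx]
      symm
      rw [ENNReal.tsum_eq_zero]
      intro i
      exact indicator_of_notMem (hex i) _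
  rw [lintegral_congr_ae h1, lintegral_tsum]
  · congr 1; ext i
    rw [lintegral_indicator (hEm i)]
  · intro i
    exact ((measurable_const.pow hpm).indicator (hEm i)).aemeasurable

/-- The modular `∫_S t^{p(x)} dx`. -/
def md {n : ℕ} (p : (Fin n → ℝ) → ℝ) (t : ℝ) (S : Set (Fin n → ℝ)) : ℝ≥0∞ :=
  ∫⁻ x in S, ENNReal.ofReal (t ^ p x)

lemma md_mono_set {n : ℕ} (p : (Fin n → ℝ) → ℝ) (t : ℝ) {S T : Set (Fin n → ℝ)} (h : S ⊆ T) :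
    md p t S ≤ md p t T := lintegral_mono_set h

lemma md_congr_set {n : ℕ} (p : (Fin n → ℝ) → ℝ) (t : ℝ) {S T : Set (Fin n → ℝ)}
    (h : S =ᵐ[volume] T) : md p t S = md p t T := setLIntegral_congr h

lemma md_mul_le {n : ℕ} {p : (Fin n → ℝ) → ℝ} {B : ℝ}
    (hB : ∀ x, p x ≤ B) {K t : ℝ} (hK : 1 ≤ K) (ht : 0 < t) (S : Set (Fin n → ℝ)) :
    md p (K * t) S ≤ ENNReal.ofReal (K ^ B) * md p t S := by
  unfold md
  rw [← lintegral_const_mul' _ _ ENNReal.ofReal_ne_top]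
  refine lintegral_mono fun x => ?_
  dsimp only
  rw [← ENNReal.ofReal_mul (by positivity), Real.mul_rpow (by positivity) ht.le]
  apply ENNReal.ofReal_le_ofReal
  have := Real.rpow_le_rpow_of_exponent_le hK (hB x)
  gcongr

lemma md_mul_ge {n : ℕ} {p : (Fin n → ℝ) → ℝ}
    (hp : ∀ x, 1 ≤ p x) {K t : ℝ} (hK : 1 ≤ K) (ht : 0 < t) (S : Set (Fin n → ℝ)) :
    ENNReal.ofReal K * md p t S ≤ md p (K * t) S := by
  unfold md
  rw [← lintegral_const_mul' _ _ ENNReal.ofReal_ne_top]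
  refine lintegral_mono fun x => ?_
  dsimp only
  rw [← ENNReal.ofReal_mul (by positivity), Real.mul_rpow (by positivity) ht.le]
  apply ENNReal.ofReal_le_ofReal
  have := Real.rpow_le_rpow_of_exponent_le hK (hp x)
  rw [Real.rpow_one] at this
  gcongr

/-- Modular form of the `A_∞` condition. -/
def AIm {n : ℕ} (p : (Fin n → ℝ) → ℝ) (lam C : ℝ) : Prop :=
  ∀ (ι : Type) [Countable ι] (Q : ι → RCube n) (t : ι → ℝ) (E : ι → Set (Fin n → ℝ)),
    (Pairwise fun i j => Disjoint (Q i).toSet (Q j).toSet) → (∀ i, 0 < t i) →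
    (∀ i, MeasurableSet (E i)) → (∀ i, E i ⊆ (Q i).toSet) →
    (∀ i, ENNReal.ofReal lam * volume (Q i).toSet ≤ volume (E i)) →
    ∑' i, md p (t i) (E i) ≤ 1 → ∑' i, md p (t i) (Q i).toSet ≤ ENNReal.ofReal C

lemma AIm_of_AInfty {n : ℕ} {p : (Fin n → ℝ) → ℝ} (hpm : Measurable p) {B : ℝ}
    (hp : ∀ x, 1 ≤ p x) (hB : ∀ x, p x ≤ B) (h : AInfty p) :
    ∃ lam ∈ Ioo (0 : ℝ) 1, ∃ C : ℝ, 1 ≤ C ∧ AIm p lam C := by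
  obtain ⟨lam, hlam, C, hC, hA⟩ := h
  have hB0 : 0 ≤ B := by linarith [hp 0, hB 0]
  refine ⟨lam, hlam, (C + 1) ^ B, Real.one_le_rpow (by linarith) hB0, ?_⟩
  intro ι _ Q t E hQ ht hEm hE hvol hsum
  have hinj := injective_of_disjoint_cubes hQ
  have hp0 : ∀ᵐ x, 0 < p x := Filter.Eventually.of_forall fun x => by linarith [hp x]
  have hF : PairwiseDisjointCubes (range Q) := by
    rintro _ ⟨i, rfl⟩ _ ⟨j, rfl⟩ hne
    exact hQ fun h => hne (by rw [h])
  have key := hA (range Q) hF (Function.extend Q t 0) (by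
    rintro _ ⟨i, rfl⟩
    rw [hinj.extend_apply]; exact (ht i).le) (Function.extend Q E fun _ => ∅) (by
    rintro _ ⟨i, rfl⟩
    rw [hinj.extend_apply]; exact ⟨hEm i, hE i, hvol i⟩)
  have e1 := fun mu => cubeSum_range_lintegral p hpm hp0 Q hQ (Function.extend Q t 0)
    (Function.extend Q E fun _ => ∅) (by intro i; rw [hinj.extend_apply]; exact hEm i)
    (by intro i; rw [hinj.extend_apply]; exact hE i) mu
  have e2 := fun mu => cubeSum_range_lintegral p hpm hp0 Q hQ (Function.extend Q t 0)
    RCube.toSet (fun i => measurableSet_toSet _) (fun i => le_rfl) mu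
  simp only [hinj.extend_apply] at e1 e2
  have hsmall : vnorm p (cubeSum (range Q) (Function.extend Q t 0)
      (Function.extend Q E fun _ => ∅)) ≤ 1 := by
    refine sInf_le ⟨one_pos, ?_⟩
    rw [e1 1]
    refine le_trans (le_of_eq ?_) hsum
    congr 1; ext i
    unfold md
    congr 1; ext x
    rw [div_one, ENNReal.ofReal_rpow_of_pos (ht i)]
  have hbig : vnorm p (cubeSum (range Q) (Function.extend Q t 0) RCube.toSet)
      < ENNReal.ofReal (C + 1) := by
    refine lt_of_le_of_lt key (lt_of_le_of_lt (mul_le_mul_right hsmall _) ?_)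
    rw [mul_one]
    exact (ENNReal.ofReal_lt_ofReal_iff (by linarith)).2 (by linarith)
  obtain ⟨mu, ⟨hmu0, hmu⟩, hmulr⟩ := sInf_lt_iff.1 hbig
  rw [e2 mu] at hmu
  have hmutop : mu ≠ ∞ := (hmulr.trans_le le_top).ne
  calc ∑' i, md p (t i) (Q i).toSet
      ≤ ∑' i, ENNReal.ofReal ((C + 1) ^ B) *
          ∫⁻ x in (Q i).toSet, (ENNReal.ofReal (t i) / mu) ^ p x := by
        refine ENNReal.tsum_le_tsum fun i => ?_
        unfold md
        rw [← lintegral_const_mul' _ _ ENNReal.ofReal_ne_top]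
        refine lintegral_mono fun x => ?_
        dsimp only
        have hpx : 0 ≤ p x := by linarith [hp x]
        have h1 : ENNReal.ofReal (t i) ≤ ENNReal.ofReal (C + 1) * (ENNReal.ofReal (t i) / mu) := by
          calc ENNReal.ofReal (t i) = mu * (ENNReal.ofReal (t i) / mu) :=
                (ENNReal.mul_div_cancel hmu0.ne' hmutop).symm
            _ ≤ _ := mul_le_mul_left hmulr.le _
        rw [← ENNReal.ofReal_rpow_of_pos (ht i)]
        calc ENNReal.ofReal (t i) ^ p x
            ≤ (ENNReal.ofReal (C + 1) * (ENNReal.ofReal (t i) / mu)) ^ p x :=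
              ENNReal.rpow_le_rpow h1 hpx
          _ = ENNReal.ofReal (C + 1) ^ p x * (ENNReal.ofReal (t i) / mu) ^ p x :=
              ENNReal.mul_rpow_of_nonneg _ _ hpx
          _ ≤ _ := by
              refine mul_le_mul_left ?_ _
              rw [ENNReal.ofReal_rpow_of_pos (by linarith)]
              exact ENNReal.ofReal_le_ofReal
                (Real.rpow_le_rpow_of_exponent_le (by linarith) (hB x))
    _ = ENNReal.ofReal ((C + 1) ^ B) *
          ∑' i, ∫⁻ x in (Q i).toSet, (ENNReal.ofReal (t i) / mu) ^ p x := ENNReal.tsum_mul_left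
    _ ≤ ENNReal.ofReal ((C + 1) ^ B) * 1 := mul_le_mul_right hmu _
    _ = _ := mul_one _

/-- Scaled version of the modular `A_∞` condition. -/
lemma AIm.scale {n : ℕ} {p : (Fin n → ℝ) → ℝ} {B : ℝ} (hp : ∀ x, 1 ≤ p x) (hB : ∀ x, p x ≤ B)
    {lam C : ℝ} (h : AIm p lam C) {A : ℝ} (hA : 1 ≤ A)
    (ι : Type) [Countable ι] (Q : ι → RCube n) (t : ι → ℝ) (E : ι → Set (Fin n → ℝ))
    (hQ : Pairwise fun i j => Disjoint (Q i).toSet (Q j).toSet) (ht : ∀ i, 0 < t i)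
    (hEm : ∀ i, MeasurableSet (E i)) (hE : ∀ i, E i ⊆ (Q i).toSet)
    (hvol : ∀ i, ENNReal.ofReal lam * volume (Q i).toSet ≤ volume (E i))
    (hsum : ∑' i, md p (t i) (E i) ≤ ENNReal.ofReal A) :
    ∑' i, md p (t i) (Q i).toSet ≤ ENNReal.ofReal (A ^ B * C) := by
  have hA0 : 0 < A := by linarith
  have e : ∀ i, A * (t i / A) = t i := fun i => by field_simp
  have hle : ∑' i, md p (t i / A) (E i) ≤ 1 := by
    have h1 : ENNReal.ofReal A * ∑' i, md p (t i / A) (E i) ≤ ENNReal.ofReal A * 1 := by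
      rw [← ENNReal.tsum_mul_left, mul_one]
      refine le_trans (ENNReal.tsum_le_tsum fun i => ?_) hsum
      have := md_mul_ge hp hA (div_pos (ht i) hA0) (E i)
      rwa [e] at this
    exact (ENNReal.mul_le_mul_iff_right (by simpa using hA0) ENNReal.ofReal_ne_top).1 h1
  have h2 := h ι Q (fun i => t i / A) E hQ (fun i => div_pos (ht i) hA0) hEm hE hvol hle
  rw [ENNReal.ofReal_mul (by positivity)]
  calc ∑' i, md p (t i) (Q i).toSet
      ≤ ∑' i, ENNReal.ofReal (A ^ B) * md p (t i / A) (Q i).toSet := by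
        refine ENNReal.tsum_le_tsum fun i => ?_
        have := md_mul_le hB hA (div_pos (ht i) hA0) (Q i).toSet
        rwa [e] at this
    _ = ENNReal.ofReal (A ^ B) * ∑' i, md p (t i / A) (Q i).toSet := ENNReal.tsum_mul_left
    _ ≤ _ := mul_le_mul_right h2 _

/-! ### Growing sets inside cubes: the parameter of the `A_∞` condition can be decreased -/

lemma growth_step {n : ℕ} (hn : 0 < n) {lam : ℝ} (h0 : 0 < lam) (h1 : lam < 1) :
    ∃ c : ℝ, 0 < c ∧ ∀ (Q : RCube n) (E : Set (Fin n → ℝ)), MeasurableSet E → E ⊆ Q.toSet →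
      ∃ (J : Type) (_ : Countable J) (P : J → RCube n),
        (Pairwise fun i j => Disjoint (P i).toSet (P j).toSet) ∧
        (∀ j, (P j).toSet ⊆ Q.toSet) ∧
        (∀ j, ENNReal.ofReal lam * volume (P j).toSet ≤ volume (E ∩ (P j).toSet)) ∧
        (ENNReal.ofReal (1 + c) * volume E ≤ volume (E ∪ ⋃ j, (P j).toSet) ∨
          volume Q.toSet ≤ volume (E ∪ ⋃ j, (P j).toSet)) := by
  have hs1 : √lam < 1 := by rw [Real.sqrt_lt' one_pos]; simpa using h1
  have hs0 : 0 < √lam := Real.sqrt_pos.2 h0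
  refine ⟨(1 - √lam) / 5 ^ n, by have : 0 < 1 - √lam := by linarith
                                 positivity, ?_⟩
  intro Q E hEm hE
  by_cases hbig : ENNReal.ofReal lam * volume Q.toSet ≤ volume E
  · refine ⟨Unit, inferInstance, fun _ => Q, ?_, fun _ => le_rfl, ?_, Or.inr ?_⟩
    · intro i j hij; exact absurd (Subsingleton.elim i j) hij
    · intro _; rwa [inter_eq_left.2 hE]
    · exact measure_mono (subset_union_of_subset_right (subset_iUnion (fun _ : Unit => Q.toSet) ()) _)
  push Not at hbig
  set mu : ℝ := lam ^ (1 / (2 * (n : ℝ))) with hmu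
  have hnR : (0 : ℝ) < n := by exact_mod_cast hn
  have hmu0 : 0 < mu := Real.rpow_pos_of_pos h0 _
  have hmu1 : mu < 1 := Real.rpow_lt_one h0.le h1 (by positivity)
  have hmun : mu ^ n = √lam := by
    rw [hmu, ← Real.rpow_natCast, ← Real.rpow_mul h0.le, Real.sqrt_eq_rpow]
    congr 1; field_simp
  set rho := Q.side / 2 with hrho
  have hrho0 : 0 < rho := by have := Q.side_pos; positivity
  set ctr : (Fin n → ℝ) → ℕ → (Fin n → ℝ) := fun x j => x + mu ^ j • (Q.center - x) with hctr
  set D : (Fin n → ℝ) → ℕ → Set (Fin n → ℝ) :=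
    fun x j => Metric.closedBall (ctr x j) (mu ^ j * rho) with hD
  have hQb : Q.toSet = Metric.closedBall Q.center rho := toSet_eq_closedBall Q
  have hD0 : ∀ x, D x 0 = Q.toSet := by intro x; simp [hD, hctr, hQb]
  have hnorm : ∀ x ∈ Q.toSet, ‖Q.center - x‖ ≤ rho := by
    intro x hx
    rw [hQb, Metric.mem_closedBall, dist_comm, dist_eq_norm] at hx
    exact hx
  have hxD : ∀ x ∈ Q.toSet, ∀ j, x ∈ D x j := by
    intro x hx j
    simp only [hD, hctr, Metric.mem_closedBall]
    rw [dist_comm, dist_eq_norm, add_sub_cancel_left, norm_smul, Real.norm_of_nonneg (by positivity)]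
    gcongr
    exact hnorm x hx
  have hDanti : ∀ x ∈ Q.toSet, ∀ j, D x (j + 1) ⊆ D x j := by
    intro x hx j
    apply Metric.closedBall_subset_closedBall'
    have : ctr x (j + 1) - ctr x j = (-(mu ^ j * (1 - mu))) • (Q.center - x) := by
      simp only [hctr]
      ext i; simp; ring
    rw [dist_eq_norm, this, norm_smul, norm_neg, Real.norm_of_nonneg
      (mul_nonneg (by positivity) (by linarith))]
    have h3 : mu ^ j * (1 - mu) * ‖Q.center - x‖ ≤ mu ^ j * (1 - mu) * rho :=
      mul_le_mul_of_nonneg_left (hnorm x hx) (mul_nonneg (by positivity) (by linarith))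
    rw [pow_succ]; nlinarith
  have hDQ : ∀ x ∈ Q.toSet, ∀ j, D x j ⊆ Q.toSet := by
    intro x hx j
    rw [← hD0 x]
    exact antitone_nat_of_succ_le (f := D x) (hDanti x hx) (Nat.zero_le j)
  have hDvol : ∀ x j, volume (D x j) = ENNReal.ofReal ((2 * (mu ^ j * rho)) ^ n) := by
    intro x j
    simp only [hD]
    rw [Real.volume_pi_closedBall _ (by positivity), Fintype.card_fin]
  have hDvolS : ∀ x j, ENNReal.ofReal √lam * volume (D x (j + 1))
      = ENNReal.ofReal lam * volume (D x j) := by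
    intro x j
    rw [hDvol, hDvol, ← ENNReal.ofReal_mul hs0.le, ← ENNReal.ofReal_mul h0.le]
    congr 1
    have : (2 * (mu ^ (j + 1) * rho)) ^ n = √lam * (2 * (mu ^ j * rho)) ^ n := by
      rw [← hmun, ← mul_pow]; congr 1; ring
    rw [this, ← mul_assoc, Real.mul_self_sqrt h0.le]
  -- density
  have hdens : ∀ᵐ x ∂(volume.restrict E), ∃ j, ENNReal.ofReal lam * volume (D x j)
      ≤ volume (E ∩ D x j) := by
    filter_upwards [IsUnifLocDoublingMeasure.ae_tendsto_measure_inter_div volume E 1,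
      ae_restrict_mem hEm] with x hx hxE
    have ht := hx (l := Filter.atTop) (fun j : ℕ => ctr x j) (fun j => mu ^ j * rho) (by
      rw [tendsto_nhdsWithin_iff]
      constructor
      · have := (tendsto_pow_atTop_nhds_zero_of_lt_one hmu0.le hmu1).mul_const rho
        simpa using this
      · exact Filter.Eventually.of_forall fun j => by
          show 0 < mu ^ j * rho
          positivity) (Filter.Eventually.of_forall fun j => by
          rw [one_mul]; exact hxD x (hE hxE) j)
    have hlt : ENNReal.ofReal lam < 1 := by simpa using h1
    obtain ⟨j, hj⟩ := (ht.eventually (lt_mem_nhds hlt)).exists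
    refine ⟨j, ?_⟩
    have := (ENNReal.le_div_iff_mul_le (a := ENNReal.ofReal lam) (b := volume (D x j))
      (c := volume (E ∩ D x j)) (Or.inl ?_) (Or.inl ?_)).1 hj.le
    · exact this
    · rw [hDvol]; simp; positivity
    · rw [hDvol]; exact ENNReal.ofReal_ne_top
  set G : Set (Fin n → ℝ) := {x | x ∈ E ∧ ∃ j, ENNReal.ofReal lam * volume (D x j)
      ≤ volume (E ∩ D x j)} with hG
  have hEG : volume E ≤ volume G := by
    rw [ae_restrict_iff' hEm] at hdens
    apply measure_mono_ae
    filter_upwards [hdens] with x hx hxE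
    exact ⟨hxE, hx hxE⟩
  have hsel : ∀ x, ∃ j, x ∈ G → ENNReal.ofReal lam * volume (D x j) ≤ volume (E ∩ D x j) ∧
      volume (E ∩ D x j) ≤ ENNReal.ofReal √lam * volume (D x j) := by
    intro x
    by_cases hx : x ∈ G
    · classical
      have hex := hx.2
      refine ⟨Nat.find hex, fun _ => ⟨Nat.find_spec hex, ?_⟩⟩
      have hne : Nat.find hex ≠ 0 := by
        intro h
        have := Nat.find_spec hex
        rw [h, hD0, inter_eq_left.2 hE] at this
        exact absurd this (not_le.2 hbig)
      obtain ⟨m, hm⟩ := Nat.exists_eq_succ_of_ne_zero hne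
      have hmin := Nat.find_min hex (m := m) (by omega)
      push Not at hmin
      rw [hm, Nat.succ_eq_add_one, hDvolS]
      exact le_trans (measure_mono (inter_subset_inter_right _ (hDanti x (hE hx.1) m))) hmin.le
    · exact ⟨0, fun h => absurd h hx⟩
  choose js hjs using hsel
  obtain ⟨u, huG, hud, hucov⟩ := Vitali.exists_disjoint_subfamily_covering_enlargement_closedBall
    G (fun x => ctr x (js x)) (fun x => mu ^ js x * rho) rho (by
      intro x _
      exact mul_le_of_le_one_left hrho0.le (pow_le_one₀ hmu0.le hmu1.le)) 5 (by norm_num)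
  have hrp : ∀ x, 0 < mu ^ js x * rho := fun x => by positivity
  set P : u → RCube n := fun x => cubeOf (ctr x (js x)) (mu ^ js x * rho) (hrp x) with hP
  have hPD : ∀ x : u, (P x).toSet = D x (js x) := fun x => cubeOf_toSet _ _ _
  have hucount : u.Countable := by
    refine hud.countable_of_nonempty_interior fun x _ => ?_
    exact ⟨ctr x (js x), Metric.ball_subset_interior_closedBall (Metric.mem_ball_self (hrp x))⟩
  have hcu : Countable u := hucount.to_subtype
  have hdisj : Pairwise fun i j : u => Disjoint (P i).toSet (P j).toSet := by
    intro i j hij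
    have : Disjoint (D i (js i)) (D j (js j)) := hud i.2 j.2 (fun h => hij (Subtype.ext h))
    simpa only [hPD] using this
  refine ⟨u, hcu, P, hdisj, ?_, ?_, Or.inl ?_⟩
  · intro j; rw [hPD]; exact hDQ _ (hE (huG j.2).1) _
  · intro j; rw [hPD]; exact (hjs j (huG j.2)).1
  · have hEtop : volume E ≠ ∞ := ne_top_of_le_ne_top (volume_toSet_ne_top Q) (measure_mono hE)
    have hcov : volume G ≤ ENNReal.ofReal (5 ^ n) * ∑' x : u, volume (P x).toSet := by
      calc volume G ≤ volume (⋃ x : u, Metric.closedBall (ctr x (js x)) (5 * (mu ^ js x * rho))) := by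
            apply measure_mono
            intro x hx
            obtain ⟨b, hb, hsub⟩ := hucov x hx
            exact mem_iUnion.2 ⟨⟨b, hb⟩, hsub (hxD x (hE hx.1) _)⟩
        _ ≤ ∑' x : u, volume (Metric.closedBall (ctr x (js x)) (5 * (mu ^ js x * rho))) :=
            measure_iUnion_le _
        _ = ∑' x : u, ENNReal.ofReal (5 ^ n) * volume (P x).toSet := by
            congr 1; ext x
            rw [hPD, hDvol, Real.volume_pi_closedBall _ (by positivity), Fintype.card_fin,
              ← ENNReal.ofReal_mul (by positivity), ← mul_pow]
            congr 2; ring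
        _ = _ := ENNReal.tsum_mul_left
    have hpiece : ∀ x : u, ENNReal.ofReal (1 - √lam) * volume (P x).toSet
        ≤ volume ((P x).toSet \ E) := by
      intro x
      have h4 : volume ((P x).toSet) = volume ((P x).toSet ∩ E) + volume ((P x).toSet \ E) :=
        (measure_inter_add_sdiff _ hEm).symm
      have h5 : volume ((P x).toSet ∩ E) ≤ ENNReal.ofReal √lam * volume (P x).toSet := by
        rw [inter_comm, hPD]; exact (hjs x (huG x.2)).2
      have h6 : ENNReal.ofReal (1 - √lam) * volume (P x).toSet + ENNReal.ofReal √lam * volume (P x).toSet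
          = volume (P x).toSet := by
        rw [← add_mul, ← ENNReal.ofReal_add (by linarith) hs0.le]; simp
      have h7 : ENNReal.ofReal √lam * volume (P x).toSet ≠ ∞ :=
        ENNReal.mul_ne_top ENNReal.ofReal_ne_top (volume_toSet_ne_top _)
      rw [← ENNReal.add_le_add_iff_right h7, h6, add_comm]
      exact h4.le.trans (add_le_add_left h5 _)
    have hun : volume (E ∪ ⋃ x : u, (P x).toSet) = volume E + ∑' x : u, volume ((P x).toSet \ E) := by
      rw [← union_sdiff_self, measure_union disjoint_sdiff_right
        ((MeasurableSet.iUnion fun x => measurableSet_toSet _).diff hEm), iUnion_sdiff,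
        measure_iUnion _ fun x => (measurableSet_toSet _).diff hEm]
      intro i j hij
      exact (hdisj hij).mono sdiff_subset sdiff_subset
    rw [hun, ENNReal.ofReal_add zero_le_one (by
      have : 0 < 1 - √lam := by linarith
      positivity), add_mul, ENNReal.ofReal_one, one_mul]
    refine add_le_add_right ?_ _
    calc ENNReal.ofReal ((1 - √lam) / 5 ^ n) * volume E
        ≤ ENNReal.ofReal ((1 - √lam) / 5 ^ n) *
            (ENNReal.ofReal (5 ^ n) * ∑' x : u, volume (P x).toSet) := by
          gcongr; exact hEG.trans hcov
      _ = ENNReal.ofReal (1 - √lam) * ∑' x : u, volume (P x).toSet := by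
          rw [← mul_assoc, ← ENNReal.ofReal_mul (div_nonneg (by linarith) (by positivity))]
          congr 2; field_simp
      _ = ∑' x : u, ENNReal.ofReal (1 - √lam) * volume (P x).toSet := ENNReal.tsum_mul_left.symm
      _ ≤ _ := ENNReal.tsum_le_tsum hpiece

lemma md_tsum_le {n : ℕ} (p : (Fin n → ℝ) → ℝ) (t : ℝ) {J : Type} [Countable J]
    {S : J → Set (Fin n → ℝ)} {T : Set (Fin n → ℝ)} (hm : ∀ j, MeasurableSet (S j))
    (hd : Pairwise fun i j => Disjoint (S i) (S j)) (hT : ∀ j, S j ⊆ T) :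
    ∑' j, md p t (S j) ≤ md p t T := by
  unfold md
  rw [← lintegral_iUnion hm hd]
  exact lintegral_mono_set (iUnion_subset hT)

lemma AIm_one {n : ℕ} (p : (Fin n → ℝ) → ℝ) : AIm p 1 1 := by
  intro ι _ Q t E hQ ht hEm hE hvol hsum
  simp only [ENNReal.ofReal_one, one_mul] at hvol ⊢
  refine le_trans (le_of_eq ?_) hsum
  congr 1; ext i
  apply md_congr_set
  exact (ae_eq_of_subset_of_measure_ge (hE i) (hvol i) (hEm i).nullMeasurableSet
    (volume_toSet_ne_top _)).symm

lemma AIm_improve {n : ℕ} (hn : 0 < n) {p : (Fin n → ℝ) → ℝ} {B : ℝ}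
    (hp : ∀ x, 1 ≤ p x) (hB : ∀ x, p x ≤ B) {lam C : ℝ} (h0 : 0 < lam) (h1 : lam < 1)
    (hC : 1 ≤ C) (h : AIm p lam C) (kap : ℝ) (hk : 0 < kap) :
    ∃ C', 1 ≤ C' ∧ AIm p kap C' := by
  have hB0 : 0 ≤ B := by linarith [hp 0, hB 0]
  obtain ⟨c, hc, hstep⟩ := growth_step hn h0 h1
  have hind : ∀ k : ℕ, ∃ C', 1 ≤ C' ∧ AIm p ((1 + c)⁻¹ ^ k) C' := by
    intro k
    induction k with
    | zero => exact ⟨1, le_rfl, by simpa using AIm_one p⟩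
    | succ k ih =>
      obtain ⟨C', hC', hA⟩ := ih
      refine ⟨(1 + C) ^ B * C', one_le_mul_of_one_le_of_one_le
        (Real.one_le_rpow (by linarith) hB0) hC', ?_⟩
      intro ι _ Q t E hQ ht hEm hE hvol hsum
      choose J hJ P hPd hPQ hPv hPg using fun i => hstep (Q i) (E i) (hEm i) (hE i)
      have hPE := h (Σ i, J i) (fun z => P z.1 z.2) (fun z => t z.1)
        (fun z => E z.1 ∩ (P z.1 z.2).toSet) (by
          rintro ⟨i, a⟩ ⟨j, b⟩ hij
          by_cases hne : i = j
          · subst hne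
            exact hPd i (fun hab : a = b => hij (by rw [hab]))
          · exact (hQ hne).mono (hPQ i a) (hPQ j b)) (fun z => ht _)
          (fun z => (hEm _).inter (measurableSet_toSet _)) (fun z => inter_subset_right)
          (fun z => hPv _ _) (by
            rw [ENNReal.tsum_sigma']
            refine le_trans (ENNReal.tsum_le_tsum fun i => ?_) hsum
            exact md_tsum_le p (t i) (fun b => (hEm _).inter (measurableSet_toSet _))
              (fun a b hab => (hPd i hab).mono inter_subset_right inter_subset_right)
              (fun b => inter_subset_left))
      rw [ENNReal.tsum_sigma'] at hPE
      refine hA.scale hp hB (A := 1 + C) (by linarith) ι Q t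
        (fun i => E i ∪ ⋃ j, (P i j).toSet) hQ ht
        (fun i => (hEm i).union (MeasurableSet.iUnion fun j => measurableSet_toSet _))
        (fun i => union_subset (hE i) (iUnion_subset fun j => hPQ i j)) ?_ ?_
      · intro i
        have hc1 : (1 + c)⁻¹ ≤ 1 := inv_le_one_of_one_le₀ (by linarith)
        rcases hPg i with hg | hg
        · refine le_trans ?_ hg
          refine le_trans (le_of_eq ?_) (mul_le_mul_right (hvol i) _)
          rw [← mul_assoc, ← ENNReal.ofReal_mul (by linarith)]
          congr 2
          rw [pow_succ]; field_simp
        · refine le_trans ?_ hg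
          refine mul_le_of_le_one_left (zero_le) ?_
          rw [ENNReal.ofReal_le_one]
          exact pow_le_one₀ (by positivity) hc1
      · rw [ENNReal.ofReal_add zero_le_one (by linarith), ENNReal.ofReal_one]
        refine le_trans ?_ (add_le_add hsum hPE)
        rw [← ENNReal.tsum_add]
        refine ENNReal.tsum_le_tsum fun i => ?_
        refine le_trans (lintegral_union_le _ _ _) ?_
        exact add_le_add_right (lintegral_iUnion_le _ _) _
  obtain ⟨k, hk2⟩ := exists_pow_lt_of_lt_one hk (inv_lt_one_of_one_lt₀ (by linarith : 1 < 1 + c))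
  obtain ⟨C', hC', hA⟩ := hind k
  refine ⟨C', hC', ?_⟩
  intro ι _ Q t E hQ ht hEm hE hvol hsum
  refine hA ι Q t E hQ ht hEm hE (fun i => le_trans ?_ (hvol i)) hsum
  gcongr

/-! ### Non-overlapping families -/

/-- The open cube. -/
def icube {n : ℕ} (Q : RCube n) : Set (Fin n → ℝ) := Metric.ball Q.center (Q.side / 2)

lemma icube_subset {n : ℕ} (Q : RCube n) : icube Q ⊆ Q.toSet := by
  rw [toSet_eq_closedBall]; exact Metric.ball_subset_closedBall

lemma measurableSet_icube {n : ℕ} (Q : RCube n) : MeasurableSet (icube Q) :=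
  Metric.isOpen_ball.measurableSet

lemma volume_icube {n : ℕ} (Q : RCube n) : volume (icube Q) = volume Q.toSet := by
  have := Q.side_pos
  rw [toSet_eq_closedBall, icube, Real.volume_pi_closedBall _ (by linarith),
    Real.volume_pi_ball _ (by linarith)]

lemma icube_ae_eq {n : ℕ} (Q : RCube n) : icube Q =ᵐ[volume] Q.toSet :=
  ae_eq_of_subset_of_measure_ge (icube_subset Q) (volume_icube Q).ge
    (measurableSet_icube Q).nullMeasurableSet (volume_toSet_ne_top Q)

lemma md_eq_withDensity {n : ℕ} (p : (Fin n → ℝ) → ℝ) (t : ℝ) {S : Set (Fin n → ℝ)}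
    (hS : MeasurableSet S) :
    md p t S = (volume.withDensity fun x => ENNReal.ofReal (t ^ p x)) S :=
  (withDensity_apply _ hS).symm

/-- `AIm` for families of cubes with disjoint interiors. -/
lemma AIm_nonoverlap {n : ℕ} {p : (Fin n → ℝ) → ℝ} {lam lam' C : ℝ} (h : AIm p lam C)
    (h0 : 0 ≤ lam) (hl : lam < lam')
    (ι : Type) [Countable ι] (Q : ι → RCube n) (t : ι → ℝ) (E : ι → Set (Fin n → ℝ))
    (hQ : Pairwise fun i j => Disjoint (icube (Q i)) (icube (Q j))) (ht : ∀ i, 0 < t i)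
    (hEm : ∀ i, MeasurableSet (E i)) (hE : ∀ i, E i ⊆ (Q i).toSet)
    (hvol : ∀ i, ENNReal.ofReal lam' * volume (Q i).toSet ≤ volume (E i))
    (hsum : ∑' i, md p (t i) (E i) ≤ 1) :
    ∑' i, md p (t i) (Q i).toSet ≤ ENNReal.ofReal C := by
  set th : ℕ → ℝ := fun k => 1 - 1 / ((k : ℝ) + 2) with hth
  have hth0 : ∀ k, 0 < th k := by
    intro k
    have : (0 : ℝ) < k + 2 := by positivity
    simp only [hth, sub_pos]; rw [div_lt_one this]
    have : (0 : ℝ) ≤ k := by positivity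
    linarith
  have hth1 : ∀ k, th k < 1 := by
    intro k
    have : (0 : ℝ) < 1 / ((k : ℝ) + 2) := by positivity
    simp only [hth]; linarith
  have hthm : Monotone th := by
    intro a b hab
    have : (a : ℝ) ≤ b := by exact_mod_cast hab
    simp only [hth]
    gcongr
  have htht : Filter.Tendsto th Filter.atTop (nhds 1) := by
    have : Filter.Tendsto (fun k : ℕ => 1 / ((k : ℝ) + 2)) Filter.atTop (nhds 0) := by
      have := (tendsto_one_div_add_atTop_nhds_zero_nat (𝕜 := ℝ)).comp (Filter.tendsto_add_atTop_nat 1)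
      refine this.congr fun k => ?_
      simp only [Function.comp]; push_cast; ring_nf
    have h2 := this.const_sub 1
    rw [sub_zero] at h2
    exact h2
  have hr0 : ∀ i k, 0 < th k * ((Q i).side / 2) := fun i k => by
    have := (Q i).side_pos; have := hth0 k; positivity
  set P : ℕ → ι → RCube n := fun k i => cubeOf (Q i).center (th k * ((Q i).side / 2)) (hr0 i k)
    with hP
  have hPs : ∀ k i, (P k i).toSet = Metric.closedBall (Q i).center (th k * ((Q i).side / 2)) :=
    fun k i => cubeOf_toSet _ _ _
  have hPi : ∀ k i, (P k i).toSet ⊆ icube (Q i) := by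
    intro k i
    rw [hPs]
    apply Metric.closedBall_subset_ball
    have := (Q i).side_pos
    have := hth1 k
    nlinarith
  have hPvol : ∀ k i, volume (P k i).toSet = ENNReal.ofReal (th k ^ n) * volume (Q i).toSet := by
    intro k i
    rw [volume_toSet, volume_toSet, ← ENNReal.ofReal_mul (pow_nonneg (hth0 k).le _), ← mul_pow]
    congr 2
    simp only [hP, cubeOf]; ring
  have hev : ∀ᶠ k in Filter.atTop, 1 - (lam' - lam) < th k ^ n := by
    have := (htht.pow n).eventually (lt_mem_nhds (a := 1 - (lam' - lam)) (by simp; linarith))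
    exact this
  have hmain : ∀ᶠ k in Filter.atTop, ∑' i, md p (t i) (P k i).toSet ≤ ENNReal.ofReal C := by
    filter_upwards [hev] with k hk
    refine h ι (P k) t (fun i => E i ∩ (P k i).toSet) ?_ ht
      (fun i => (hEm i).inter (measurableSet_toSet _)) (fun i => inter_subset_right) ?_ ?_
    · intro i j hij
      exact (hQ hij).mono (hPi k i) (hPi k j)
    · intro i
      have h1 : volume ((Q i).toSet \ (P k i).toSet)
          = ENNReal.ofReal (1 - th k ^ n) * volume (Q i).toSet := by
        rw [measure_sdiff ((hPi k i).trans (icube_subset _))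
          (measurableSet_toSet _).nullMeasurableSet (volume_toSet_ne_top _), hPvol,
          ENNReal.ofReal_sub _ (pow_nonneg (hth0 k).le _), ENNReal.ofReal_one,
          ENNReal.sub_mul, one_mul]
        intro _ _; exact volume_toSet_ne_top _
      have h2 : volume (E i) ≤ volume (E i ∩ (P k i).toSet)
          + ENNReal.ofReal (1 - th k ^ n) * volume (Q i).toSet := by
        rw [← h1, ← measure_inter_add_sdiff (E i) (measurableSet_toSet (P k i))]
        exact add_le_add_right (measure_mono (sdiff_subset_sdiff_left (hE i))) _
      have h3 : ENNReal.ofReal lam * volume (Q i).toSet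
          + ENNReal.ofReal (1 - th k ^ n) * volume (Q i).toSet
          ≤ volume (E i ∩ (P k i).toSet)
          + ENNReal.ofReal (1 - th k ^ n) * volume (Q i).toSet := by
        refine le_trans ?_ ((hvol i).trans h2)
        rw [← add_mul, ← ENNReal.ofReal_add h0 (by
          have := pow_le_one₀ (n := n) (hth0 k).le (hth1 k).le
          linarith)]
        gcongr
        linarith
      have h4 := (ENNReal.add_le_add_iff_right (ENNReal.mul_ne_top ENNReal.ofReal_ne_top
        (volume_toSet_ne_top _))).1 h3
      refine le_trans ?_ h4
      gcongr
      exact (hPi k i).trans (icube_subset _)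
    · exact le_trans (ENNReal.tsum_le_tsum fun i => md_mono_set p _ inter_subset_left) hsum
  have hlim : ∀ i, Filter.Tendsto (fun k => md p (t i) (P k i).toSet) Filter.atTop
      (nhds (md p (t i) (Q i).toSet)) := by
    intro i
    rw [← md_congr_set p (t i) (icube_ae_eq (Q i))]
    have hun : icube (Q i) = ⋃ k, (P k i).toSet := by
      apply subset_antisymm
      · intro x hx
        have hs := (Q i).side_pos
        have hx' : dist x (Q i).center < (Q i).side / 2 := hx
        have : ∀ᶠ k in Filter.atTop, dist x (Q i).center < th k * ((Q i).side / 2) := by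
          have := (htht.mul_const ((Q i).side / 2)).eventually
            (lt_mem_nhds (a := dist x (Q i).center) (by simpa using hx'))
          exact this
        obtain ⟨k, hk⟩ := this.exists
        refine mem_iUnion.2 ⟨k, ?_⟩
        rw [hPs]; exact hk.le
      · exact iUnion_subset fun k => hPi k i
    rw [md_eq_withDensity p (t i) (measurableSet_icube _), hun]
    have := tendsto_measure_iUnion_atTop (μ := volume.withDensity fun x => ENNReal.ofReal (t i ^ p x))
      (s := fun k => (P k i).toSet) (by
        intro a b hab
        simp only [hPs]
        apply Metric.closedBall_subset_closedBall
        have := (Q i).side_pos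
        have := hthm hab
        gcongr)
    refine this.congr fun k => ?_
    rw [Function.comp, md_eq_withDensity p (t i) (measurableSet_toSet _)]
  rw [ENNReal.tsum_eq_iSup_sum]
  refine iSup_le fun s => ?_
  refine le_of_tendsto (tendsto_finsetSum s fun i _ => hlim i) ?_
  filter_upwards [hmain] with k hk
  exact (ENNReal.sum_le_tsum s).trans hk

/-! ### Dyadic stopping cubes -/

/-- Index of the dyadic cell (relative to `Q`) of generation `m` containing `y`. -/
def didx {n : ℕ} (Q : RCube n) (m : ℕ) (y : Fin n → ℝ) : Fin n → ℤ :=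
  fun i => ⌊2 ^ m * ((y i - (Q.center i - Q.side / 2)) / Q.side)⌋

/-- The dyadic subcube with generation `m` and index `z`. -/
def dcube {n : ℕ} (Q : RCube n) (m : ℕ) (z : Fin n → ℤ) : RCube n where
  center := fun i => Q.center i - Q.side / 2 + Q.side * ((z i : ℝ) + 1 / 2) / 2 ^ m
  side := Q.side / 2 ^ m
  side_pos := div_pos Q.side_pos (by positivity)

lemma mem_dcube {n : ℕ} (Q : RCube n) (m : ℕ) (z : Fin n → ℤ) (y : Fin n → ℝ) :
    y ∈ (dcube Q m z).toSet ↔ ∀ i, (z i : ℝ) ≤ 2 ^ m * ((y i - (Q.center i - Q.side / 2)) / Q.side) ∧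
      2 ^ m * ((y i - (Q.center i - Q.side / 2)) / Q.side) ≤ z i + 1 := by
  have hs := Q.side_pos
  simp only [RCube.toSet, mem_ofPred_eq, dcube]
  refine forall_congr' fun i => ?_
  have h2 : (0 : ℝ) < 2 ^ m := by positivity
  set u := 2 ^ m * ((y i - (Q.center i - Q.side / 2)) / Q.side) with hu
  have hy : y i = Q.center i - Q.side / 2 + Q.side * u / 2 ^ m := by
    rw [hu]; field_simp; ring
  have e : y i - (Q.center i - Q.side / 2 + Q.side * ((z i : ℝ) + 1 / 2) / 2 ^ m)
      = (Q.side / 2 ^ m) * (u - z i - 1 / 2) := by rw [hy]; field_simp; ring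
  have hs2 : 0 < Q.side / 2 ^ m := by positivity
  rw [e, abs_mul, abs_of_pos hs2, div_eq_mul_one_div (Q.side / 2 ^ m) 2, mul_le_mul_iff_right₀ hs2,
    abs_le]
  constructor
  · rintro ⟨a, b⟩; constructor <;> linarith
  · rintro ⟨a, b⟩; constructor <;> linarith

lemma mem_dcube_didx {n : ℕ} (Q : RCube n) (m : ℕ) (y : Fin n → ℝ) :
    y ∈ (dcube Q m (didx Q m y)).toSet := by
  rw [mem_dcube]
  intro i
  exact ⟨Int.floor_le _, (Int.lt_floor_add_one _).le⟩

lemma mem_icube_dcube {n : ℕ} (Q : RCube n) (m : ℕ) (z : Fin n → ℤ) {y : Fin n → ℝ}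
    (hy : y ∈ icube (dcube Q m z)) : didx Q m y = z := by
  have hs := Q.side_pos
  ext i
  have h2 : (0 : ℝ) < 2 ^ m := by positivity
  have hs2 : 0 < Q.side / 2 ^ m := by positivity
  have h := hy
  rw [icube, Metric.mem_ball, dist_pi_lt_iff (by simp only [dcube]; positivity)] at h
  have h3 := h i
  simp only [didx]
  set u := 2 ^ m * ((y i - (Q.center i - Q.side / 2)) / Q.side) with hu
  have hy : y i = Q.center i - Q.side / 2 + Q.side * u / 2 ^ m := by
    rw [hu]; field_simp; ring
  rw [Real.dist_eq] at h3
  simp only [dcube] at h3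
  have e : y i - (Q.center i - Q.side / 2 + Q.side * ((z i : ℝ) + 1 / 2) / 2 ^ m)
      = (Q.side / 2 ^ m) * (u - z i - 1 / 2) := by rw [hy]; field_simp; ring
  rw [e, abs_mul, abs_of_pos hs2, div_eq_mul_one_div (Q.side / 2 ^ m) 2,
    mul_lt_mul_iff_right₀ hs2, abs_lt] at h3
  rw [Int.floor_eq_iff]
  constructor <;> linarith [h3.1, h3.2]

lemma dcube_succ_subset {n : ℕ} (Q : RCube n) (m : ℕ) (y : Fin n → ℝ) :
    (dcube Q (m + 1) (didx Q (m + 1) y)).toSet ⊆ (dcube Q m (didx Q m y)).toSet := by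
  intro x hx
  rw [mem_dcube] at hx ⊢
  intro i
  obtain ⟨h1, h2⟩ := hx i
  simp only [didx] at h1 h2 ⊢
  set u := (x i - (Q.center i - Q.side / 2)) / Q.side
  set v := (y i - (Q.center i - Q.side / 2)) / Q.side
  have e1 : (2 : ℝ) ^ (m + 1) * u = 2 * (2 ^ m * u) := by ring
  have e2 : (2 : ℝ) ^ (m + 1) * v = 2 * (2 ^ m * v) := by ring
  rw [e1, e2] at h1 h2
  set a := (2 : ℝ) ^ m * v
  have h3 : 2 * ⌊a⌋ ≤ ⌊2 * a⌋ := by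
    rw [Int.le_floor]; push_cast; linarith [Int.floor_le a]
  have h4 : ⌊2 * a⌋ < 2 * ⌊a⌋ + 2 := by
    rw [Int.floor_lt]; push_cast; linarith [Int.lt_floor_add_one a]
  have h3' : 2 * (⌊a⌋ : ℝ) ≤ ⌊2 * a⌋ := by exact_mod_cast h3
  have h4' : (⌊2 * a⌋ : ℝ) + 1 ≤ 2 * ⌊a⌋ + 2 := by exact_mod_cast h4
  constructor <;> linarith

lemma didx_congr {n : ℕ} (Q : RCube n) {m k : ℕ} (hk : m ≤ k) {y y' : Fin n → ℝ}
    (h : didx Q k y = didx Q k y') : didx Q m y = didx Q m y' := by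
  induction k, hk using Nat.le_induction with
  | base => exact h
  | succ k hk ih =>
    apply ih
    ext i
    have hi := congrFun h i
    simp only [didx] at hi ⊢
    set u := (y i - (Q.center i - Q.side / 2)) / Q.side
    set v := (y' i - (Q.center i - Q.side / 2)) / Q.side
    have key : ∀ a : ℝ, ⌊(2 : ℝ) ^ k * a⌋ = ⌊(2 : ℝ) ^ (k + 1) * a⌋ / 2 := by
      intro a
      have e1 : (2 : ℝ) ^ (k + 1) * a = 2 * (2 ^ k * a) := by ring
      rw [e1]
      set b := (2 : ℝ) ^ k * a
      have h3 : 2 * ⌊b⌋ ≤ ⌊2 * b⌋ := by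
        rw [Int.le_floor]; push_cast; linarith [Int.floor_le b]
      have h4 : ⌊2 * b⌋ < 2 * ⌊b⌋ + 2 := by
        rw [Int.floor_lt]; push_cast; linarith [Int.lt_floor_add_one b]
      omega
    rw [key, key, hi]

lemma dcube_subset {n : ℕ} (Q : RCube n) (m : ℕ) {y : Fin n → ℝ} (hy : y ∈ icube Q) :
    didx Q 0 y = 0 ∧ (dcube Q m (didx Q m y)).toSet ⊆ Q.toSet := by
  have h0 : dcube Q 0 0 = Q := by
    have hs := Q.side_pos
    cases Q
    simp [dcube]
    ring_nf
  have h1 : didx Q 0 y = 0 := mem_icube_dcube Q 0 0 (by rw [h0]; exact hy)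
  refine ⟨h1, ?_⟩
  have h2 : (dcube Q 0 (didx Q 0 y)).toSet = Q.toSet := by rw [h1, h0]
  rw [← h2]
  exact antitone_nat_of_succ_le (f := fun m => (dcube Q m (didx Q m y)).toSet)
    (fun m => dcube_succ_subset Q m y) (Nat.zero_le m)

lemma volume_dcube_succ {n : ℕ} (Q : RCube n) (m : ℕ) (z w : Fin n → ℤ) :
    volume (dcube Q m z).toSet = ENNReal.ofReal (2 ^ n) * volume (dcube Q (m + 1) w).toSet := by
  rw [volume_toSet, volume_toSet, ← ENNReal.ofReal_mul (by positivity), ← mul_pow]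
  congr 2
  simp only [dcube]; rw [pow_succ]; field_simp

lemma dyadic_stop {n : ℕ} (Q : RCube n) {E : Set (Fin n → ℝ)} (hEm : MeasurableSet E)
    (hE : E ⊆ Q.toSet) {del : ℝ} (hd1 : del < 1)
    (hvol : volume E ≤ ENNReal.ofReal del * volume Q.toSet) :
    ∃ (J : Type) (_ : Countable J) (P : J → RCube n),
      (Pairwise fun i j => Disjoint (icube (P i)) (icube (P j))) ∧
      (∀ j, (P j).toSet ⊆ Q.toSet) ∧
      (E ≤ᵐ[volume] ⋃ j, (P j).toSet) ∧
      (∀ j, volume (E ∩ (P j).toSet) ≤ ENNReal.ofReal (2 ^ n * del) * volume (P j).toSet) ∧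
      (∀ j, ENNReal.ofReal del * volume (P j).toSet ≤ volume (E ∩ (P j).toSet)) := by
  classical
  set st : ℕ → (Fin n → ℤ) → Prop := fun m z =>
    ENNReal.ofReal del * volume (dcube Q m z).toSet < volume (E ∩ (dcube Q m z).toSet) with hst
  set J : Set (ℕ × (Fin n → ℤ)) := {a | st a.1 a.2 ∧ ∃ y ∈ icube Q, didx Q a.1 y = a.2 ∧
    ∀ k < a.1, ¬ st k (didx Q k y)} with hJ
  have h00 : ∀ y ∈ icube Q, ¬ st 0 (didx Q 0 y) := by
    intro y hy
    have h0 : dcube Q 0 0 = Q := by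
      have hs := Q.side_pos
      cases Q
      simp [dcube]
      ring_nf
    rw [(dcube_subset Q 0 hy).1]
    simp only [hst, h0, not_lt]
    rwa [inter_eq_left.2 hE]
  refine ⟨J, inferInstance, fun a => dcube Q a.1.1 a.1.2, ?_, ?_, ?_, ?_, fun j => j.2.1.le⟩
  · have key : ∀ a ∈ J, ∀ b ∈ J, ∀ y, didx Q a.1 y = a.2 → didx Q b.1 y = b.2 → ¬ a.1 < b.1 := by
      rintro ⟨m, z⟩ ha ⟨k, w⟩ ⟨_, y', hy', hyk, hyn⟩ y hya hyb hlt
      simp only at *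
      have := didx_congr Q hlt.le (hyk.trans hyb.symm)
      refine hyn m hlt ?_
      rw [this, hya]; exact ha.1
    intro a b hab
    rw [Set.disjoint_left]
    intro y hya hyb
    have ha := mem_icube_dcube _ _ _ hya
    have hb := mem_icube_dcube _ _ _ hyb
    have e : a.1.1 = b.1.1 := by
      have h1 := key a a.2 b b.2 y ha hb
      have h2 := key b b.2 a a.2 y hb ha
      omega
    apply hab
    apply Subtype.ext
    apply Prod.ext e
    rw [← ha, ← hb, e]
  · rintro ⟨⟨m, z⟩, -, y, hy, hyz, -⟩
    simp only at hyz ⊢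
    rw [← hyz]
    exact (dcube_subset Q m hy).2
  · have hdens : ∀ᵐ y ∂(volume.restrict E), ∃ m, st m (didx Q m y) := by
      filter_upwards [IsUnifLocDoublingMeasure.ae_tendsto_measure_inter_div volume E 1,
        ae_restrict_mem hEm] with y hy hyE
      have hs := Q.side_pos
      have ht := hy (l := Filter.atTop) (fun m : ℕ => (dcube Q m (didx Q m y)).center)
        (fun m => (dcube Q m (didx Q m y)).side / 2) (by
        rw [tendsto_nhdsWithin_iff]
        constructor
        · have h3 := (tendsto_pow_atTop_nhds_zero_of_lt_one (r := (1 / 2 : ℝ)) (by norm_num)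
            (by norm_num)).const_mul (Q.side / 2)
          rw [mul_zero] at h3
          refine h3.congr fun m => ?_
          simp only [dcube]; rw [div_pow]; field_simp; simp
        · exact Filter.Eventually.of_forall fun m => by
            show 0 < (dcube Q m (didx Q m y)).side / 2
            exact half_pos (dcube Q m (didx Q m y)).side_pos)
        (Filter.Eventually.of_forall fun m => by
          rw [one_mul, ← toSet_eq_closedBall]
          exact mem_dcube_didx Q m y)
      have hlt : ENNReal.ofReal del < 1 := by simpa using hd1
      obtain ⟨m, hm⟩ := (ht.eventually (lt_mem_nhds hlt)).exists
      refine ⟨m, ?_⟩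
      rw [← toSet_eq_closedBall] at hm
      have h5 := (ENNReal.lt_div_iff_mul_lt (Or.inl (volume_toSet_ne_zero _))
        (Or.inl (volume_toSet_ne_top _))).1 hm
      exact h5
    rw [ae_restrict_iff' hEm] at hdens
    filter_upwards [hdens, (icube_ae_eq Q).mem_iff] with y hy hyi hyE
    have hex := hy hyE
    have hyQ : y ∈ icube Q := hyi.2 (hE hyE)
    refine mem_iUnion.2 ⟨⟨(Nat.find hex, didx Q (Nat.find hex) y), Nat.find_spec hex, y, hyQ, rfl,
      fun k hk => Nat.find_min hex hk⟩, ?_⟩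
    exact mem_dcube_didx Q _ y
  · rintro ⟨⟨m, z⟩, hz, y, hy, hyz, hyn⟩
    simp only at *
    cases m with
    | zero => exact absurd (by rw [hyz]; exact hz) (h00 y hy)
    | succ m =>
      have h1 := hyn m (Nat.lt_succ_self m)
      simp only [hst, not_lt] at h1
      rw [volume_dcube_succ Q m _ z, ← mul_assoc, mul_comm (ENNReal.ofReal del),
        ← ENNReal.ofReal_mul (by positivity)] at h1
      refine le_trans (measure_mono (inter_subset_inter_right _ ?_)) h1
      have hyz' : didx Q (m + 1) y = z := hyz
      rw [← hyz']
      exact dcube_succ_subset Q m y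

/-! ### Exponential decay -/

lemma md_tsum_le_ae {n : ℕ} (p : (Fin n → ℝ) → ℝ) (t : ℝ) {J : Type} [Countable J]
    {P : J → RCube n} {S T : Set (Fin n → ℝ)} (hm : MeasurableSet S)
    (hd : Pairwise fun i j => Disjoint (icube (P i)) (icube (P j)))
    (hT : ∀ j, S ∩ (P j).toSet ⊆ T) :
    ∑' j, md p t (S ∩ (P j).toSet) ≤ md p t T := by
  have e : ∀ j, md p t (S ∩ (P j).toSet) = md p t (S ∩ icube (P j)) := fun j =>
    md_congr_set p t ((Filter.EventuallyEq.refl _ _).inter (icube_ae_eq (P j)).symm)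
  simp only [e]
  refine md_tsum_le p t (fun j => hm.inter (measurableSet_icube _)) ?_ ?_
  · intro i j hij
    exact (hd hij).mono inter_subset_right inter_subset_right
  · intro j
    exact (inter_subset_inter_right _ (icube_subset _)).trans (hT j)

lemma volume_tsum_le_ae {n : ℕ} {J : Type} [Countable J]
    {P : J → RCube n} {S : Set (Fin n → ℝ)} (hm : MeasurableSet S)
    (hd : Pairwise fun i j => Disjoint (icube (P i)) (icube (P j))) :
    ∑' j, volume (S ∩ (P j).toSet) ≤ volume S := by
  have := md_tsum_le_ae (fun _ => 0) 1 (S := S) (T := S) (P := P) hm hd (fun j => inter_subset_left)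
  simpa [md] using this

lemma decay_aux {n : ℕ} {p : (Fin n → ℝ) → ℝ} {B : ℝ}
    (hp : ∀ x, 1 ≤ p x) (hB : ∀ x, p x ≤ B) {C : ℝ} (hC : 1 ≤ C) (h : AIm p (1 / 2) C)
    {be del : ℝ} (hbe : 1 ≤ be) (hbeB : be ^ B = 1 + (C ^ B)⁻¹) (hdel : 0 < del)
    (hdel2 : 2 ^ n * del ≤ 1 / 4) (k : ℕ) :
    ∀ (ι : Type) [Countable ι] (Q : ι → RCube n) (t : ι → ℝ) (E : ι → Set (Fin n → ℝ)),
      (Pairwise fun i j => Disjoint (Q i).toSet (Q j).toSet) → (∀ i, 0 < t i) →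
      (∀ i, MeasurableSet (E i)) → (∀ i, E i ⊆ (Q i).toSet) →
      (∀ i, volume (E i) ≤ ENNReal.ofReal (del ^ k) * volume (Q i).toSet) →
      ∑' i, md p (t i) (Q i).toSet ≤ 1 → ∑' i, md p (be ^ k * t i) (E i) ≤ 1 := by
  have hdel1 : del ≤ 1 / 4 := by
    have : (1 : ℝ) ≤ 2 ^ n := one_le_pow₀ (by norm_num)
    nlinarith
  induction k with
  | zero =>
    intro ι _ Q t E hQ ht hEm hE hvol hsum
    simp only [pow_zero, one_mul]
    exact (ENNReal.tsum_le_tsum fun i => md_mono_set p _ (hE i)).trans hsum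
  | succ k ih =>
    intro ι _ Q t E hQ ht hEm hE hvol hsum
    choose J hJ P hPd hPQ hPc hPu hPl using fun i => dyadic_stop (Q i) (hEm i) (hE i) (del := del)
      (by linarith) ((hvol i).trans (by
        gcongr
        rw [pow_succ]
        exact mul_le_of_le_one_left hdel.le (pow_le_one₀ hdel.le (by linarith))))
    set Om : ι → Set (Fin n → ℝ) := fun i => ⋃ j, (P i j).toSet with hOm
    have hOmm : ∀ i, MeasurableSet (Om i) := fun i => MeasurableSet.iUnion fun j => measurableSet_toSet _
    have hOmv : ∀ i, volume (Om i) ≤ ENNReal.ofReal (del ^ k) * volume (Q i).toSet := by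
      intro i
      have h1 : ENNReal.ofReal del * volume (Om i) ≤ ENNReal.ofReal del *
          (ENNReal.ofReal (del ^ k) * volume (Q i).toSet) := by
        calc ENNReal.ofReal del * volume (Om i)
            ≤ ENNReal.ofReal del * ∑' j, volume (P i j).toSet := by gcongr; exact measure_iUnion_le _
          _ = ∑' j, ENNReal.ofReal del * volume (P i j).toSet := ENNReal.tsum_mul_left.symm
          _ ≤ ∑' j, volume (E i ∩ (P i j).toSet) := ENNReal.tsum_le_tsum fun j => hPl i j
          _ ≤ volume (E i) := volume_tsum_le_ae (hEm i) (hPd i)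
          _ ≤ _ := hvol i
          _ = _ := by rw [← mul_assoc, ← ENNReal.ofReal_mul hdel.le, pow_succ']
      rwa [ENNReal.mul_le_mul_iff_right (by simpa using hdel) ENNReal.ofReal_ne_top] at h1
    have hIH := ih ι Q t Om hQ ht hOmm (fun i => iUnion_subset fun j => hPQ i j) hOmv hsum
    set tau : ι → ℝ := fun i => be ^ (k + 1) * t i with htau
    have htau0 : ∀ i, 0 < tau i := fun i => by have := ht i; positivity
    have hOt : ∑' i, md p (tau i) (Om i) ≤ 1 + ENNReal.ofReal ((C ^ B)⁻¹) := by
      calc ∑' i, md p (tau i) (Om i) ≤ ∑' i, ENNReal.ofReal (be ^ B) * md p (be ^ k * t i) (Om i) := by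
            refine ENNReal.tsum_le_tsum fun i => ?_
            have := md_mul_le hB hbe (t := be ^ k * t i) (by have := ht i; positivity) (Om i)
            rwa [← mul_assoc, ← pow_succ'] at this
        _ = ENNReal.ofReal (be ^ B) * ∑' i, md p (be ^ k * t i) (Om i) := ENNReal.tsum_mul_left
        _ ≤ ENNReal.ofReal (be ^ B) * 1 := by gcongr
        _ = _ := by rw [mul_one, hbeB, ENNReal.ofReal_add zero_le_one (by positivity), ENNReal.ofReal_one]
    have hEO : ∀ i, md p (tau i) (E i) = md p (tau i) (Om i ∩ E i) := by
      intro i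
      apply md_congr_set
      filter_upwards [hPc i] with x hx
      apply propext
      exact ⟨fun hxE => ⟨hx hxE, hxE⟩, fun hxE => hxE.2⟩
    by_contra hcon
    push Not at hcon
    have hsplit : ∑' i, md p (tau i) (E i) + ∑' i, md p (tau i) (Om i \ E i)
        ≤ 1 + ENNReal.ofReal ((C ^ B)⁻¹) := by
      refine le_trans (le_of_eq ?_) hOt
      rw [← ENNReal.tsum_add]
      congr 1; ext i
      rw [hEO i]
      exact lintegral_inter_add_sdiff _ _ (hEm i)
    have hD : ∑' i, md p (tau i) (Om i \ E i) ≤ ENNReal.ofReal ((C ^ B)⁻¹) := by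
      have : 1 + ∑' i, md p (tau i) (Om i \ E i) ≤ 1 + ENNReal.ofReal ((C ^ B)⁻¹) :=
        le_trans (add_le_add_left hcon.le _) hsplit
      rwa [ENNReal.add_le_add_iff_left ENNReal.one_ne_top] at this
    have hC0 : 0 < C := by linarith
    have key := AIm_nonoverlap h (by norm_num) (lam' := 3 / 4) (by norm_num) (Σ i, J i)
      (fun z => P z.1 z.2) (fun z => C * tau z.1) (fun z => (P z.1 z.2).toSet \ E z.1) (by
          rintro ⟨i, a⟩ ⟨j, b⟩ hij
          by_cases hne : i = j
          · subst hne
            exact hPd i (fun hab : a = b => hij (by rw [hab]))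
          · exact (hQ hne).mono ((icube_subset _).trans (hPQ i a)) ((icube_subset _).trans (hPQ j b)))
      (fun z => by have := htau0 z.1; positivity) (fun z => (measurableSet_toSet _).diff (hEm _))
      (fun z => sdiff_subset) (by
        rintro ⟨i, j⟩
        simp only
        have h4 : volume ((P i j).toSet) = volume ((P i j).toSet ∩ E i) + volume ((P i j).toSet \ E i) :=
          (measure_inter_add_sdiff _ (hEm i)).symm
        have h5 : volume ((P i j).toSet ∩ E i) ≤ ENNReal.ofReal (1 / 4) * volume (P i j).toSet := by
          rw [inter_comm]
          refine (hPu i j).trans ?_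
          gcongr
        have h6 : ENNReal.ofReal (3 / 4) * volume (P i j).toSet
            + ENNReal.ofReal (1 / 4) * volume (P i j).toSet = volume (P i j).toSet := by
          rw [← add_mul, ← ENNReal.ofReal_add (by norm_num) (by norm_num)]; norm_num
        have h7 : ENNReal.ofReal (1 / 4) * volume (P i j).toSet ≠ ∞ :=
          ENNReal.mul_ne_top ENNReal.ofReal_ne_top (volume_toSet_ne_top _)
        rw [← ENNReal.add_le_add_iff_right h7, h6, add_comm]
        exact h4.le.trans (add_le_add_left h5 _))
      (by
        rw [ENNReal.tsum_sigma']
        calc ∑' i, ∑' j, md p (C * tau i) ((P i j).toSet \ E i)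
            ≤ ∑' i, md p (C * tau i) (Om i \ E i) := by
              refine ENNReal.tsum_le_tsum fun i => ?_
              have := md_tsum_le_ae p (C * tau i) (S := (E i)ᶜ) (T := Om i \ E i) (P := P i)
                (hEm i).compl (hPd i) (by
                  rintro j x ⟨hx1, hx2⟩
                  exact ⟨mem_iUnion.2 ⟨j, hx2⟩, hx1⟩)
              refine le_trans (le_of_eq ?_) this
              congr 1; ext j; rw [sdiff_eq, inter_comm]
          _ ≤ ∑' i, ENNReal.ofReal (C ^ B) * md p (tau i) (Om i \ E i) :=
              ENNReal.tsum_le_tsum fun i => md_mul_le hB hC (htau0 i) _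
          _ = ENNReal.ofReal (C ^ B) * ∑' i, md p (tau i) (Om i \ E i) := ENNReal.tsum_mul_left
          _ ≤ ENNReal.ofReal (C ^ B) * ENNReal.ofReal ((C ^ B)⁻¹) := by gcongr
          _ = 1 := by
              rw [← ENNReal.ofReal_mul (by positivity), mul_inv_cancel₀ (by positivity),
                ENNReal.ofReal_one])
    rw [ENNReal.tsum_sigma'] at key
    have h8 : ENNReal.ofReal C * ∑' i, md p (tau i) (E i) ≤ ENNReal.ofReal C * 1 := by
      rw [mul_one]
      refine le_trans ?_ key
      rw [← ENNReal.tsum_mul_left]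
      refine ENNReal.tsum_le_tsum fun i => ?_
      calc ENNReal.ofReal C * md p (tau i) (E i) ≤ ENNReal.ofReal C * md p (tau i) (Om i) := by
            rw [hEO]; gcongr; exact md_mono_set p _ inter_subset_left
        _ ≤ md p (C * tau i) (Om i) := md_mul_ge hp hC (htau0 i) _
        _ ≤ _ := lintegral_iUnion_le _ _
    rw [ENNReal.mul_le_mul_iff_right (by simpa using hC0) ENNReal.ofReal_ne_top] at h8
    exact absurd h8 (not_le.2 hcon)

/-- Scaled decay. -/
lemma decay {n : ℕ} {p : (Fin n → ℝ) → ℝ} {B : ℝ}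
    (hp : ∀ x, 1 ≤ p x) (hB : ∀ x, p x ≤ B) {C : ℝ} (hC : 1 ≤ C) (h : AIm p (1 / 2) C) :
    ∃ be del : ℝ, 1 < be ∧ 0 < del ∧ del < 1 ∧ ∀ (k : ℕ) (A : ℝ), 1 ≤ A →
    ∀ (ι : Type) [Countable ι] (Q : ι → RCube n) (t : ι → ℝ) (E : ι → Set (Fin n → ℝ)),
      (Pairwise fun i j => Disjoint (Q i).toSet (Q j).toSet) → (∀ i, 0 < t i) →
      (∀ i, MeasurableSet (E i)) → (∀ i, E i ⊆ (Q i).toSet) →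
      (∀ i, volume (E i) ≤ ENNReal.ofReal (del ^ k) * volume (Q i).toSet) →
      ∑' i, md p (t i) (Q i).toSet ≤ ENNReal.ofReal A →
      ∑' i, md p (t i) (E i) ≤ ENNReal.ofReal (A ^ B * (be ^ k)⁻¹) := by
  have hB1 : 1 ≤ B := (hp 0).trans (hB 0)
  have hC0 : 0 < C := by linarith
  have hbase : 1 < 1 + (C ^ B)⁻¹ := by
    have : 0 < (C ^ B)⁻¹ := by positivity
    linarith
  have hbe : 1 < (1 + (C ^ B)⁻¹) ^ (1 / B) := Real.one_lt_rpow hbase (by positivity)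
  refine ⟨(1 + (C ^ B)⁻¹) ^ (1 / B), (1 / 2) ^ n * (1 / 4), hbe, by positivity, ?_, ?_⟩
  · have : (1 / 2 : ℝ) ^ n ≤ 1 := pow_le_one₀ (by norm_num) (by norm_num)
    linarith
  set be := (1 + (C ^ B)⁻¹) ^ (1 / B) with hbed
  intro k A hA ι _ Q t E hQ ht hEm hE hvol hsum
  have hA0 : 0 < A := by linarith
  have e : ∀ i, A * (t i / A) = t i := fun i => by field_simp
  have ht' : ∀ i, 0 < t i / A := fun i => div_pos (ht i) hA0
  have h1 : ∑' i, md p (t i / A) (Q i).toSet ≤ 1 := by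
    have h2 : ENNReal.ofReal A * ∑' i, md p (t i / A) (Q i).toSet ≤ ENNReal.ofReal A * 1 := by
      rw [mul_one, ← ENNReal.tsum_mul_left]
      refine le_trans (ENNReal.tsum_le_tsum fun i => ?_) hsum
      have := md_mul_ge hp hA (ht' i) (Q i).toSet
      rwa [e] at this
    rwa [ENNReal.mul_le_mul_iff_right (by simpa using hA0) ENNReal.ofReal_ne_top] at h2
  have h3 := decay_aux hp hB hC h hbe.le (by
      rw [hbed, ← Real.rpow_mul (by positivity), one_div_mul_cancel (by positivity), Real.rpow_one])
    (del := (1 / 2) ^ n * (1 / 4)) (by positivity) (by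
      rw [← mul_assoc, ← mul_pow]; norm_num) k ι Q (fun i => t i / A) E hQ ht' hEm hE hvol h1
  have hbk : 1 ≤ be ^ k := one_le_pow₀ hbe.le
  have h4 : ENNReal.ofReal (be ^ k) * ∑' i, md p (t i / A) (E i) ≤ 1 := by
    refine le_trans ?_ h3
    rw [← ENNReal.tsum_mul_left]
    exact ENNReal.tsum_le_tsum fun i => md_mul_ge hp hbk (ht' i) _
  have hbk0 : 0 < be ^ k := by linarith
  have h5 : ∑' i, md p (t i / A) (E i) ≤ ENNReal.ofReal ((be ^ k)⁻¹) := by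
    rw [ENNReal.ofReal_inv_of_pos hbk0, ENNReal.le_inv_iff_mul_le, mul_comm]
    exact h4
  calc ∑' i, md p (t i) (E i) ≤ ∑' i, ENNReal.ofReal (A ^ B) * md p (t i / A) (E i) := by
        refine ENNReal.tsum_le_tsum fun i => ?_
        have := md_mul_le hB hA (ht' i) (E i)
        rwa [e] at this
    _ = ENNReal.ofReal (A ^ B) * ∑' i, md p (t i / A) (E i) := ENNReal.tsum_mul_left
    _ ≤ ENNReal.ofReal (A ^ B) * ENNReal.ofReal ((be ^ k)⁻¹) := by gcongr
    _ = _ := by rw [← ENNReal.ofReal_mul (by positivity)]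

/-! ### Medians and the bad cubes -/

lemma measure_le_of_forall_add {n : ℕ} (Q : RCube n) {f : (Fin n → ℝ) → ℝ} (hf : Measurable f)
    {q : ℝ} {a : ℝ≥0∞} (h : ∀ e > 0, a ≤ volume (Q.toSet ∩ {x | f x ≤ q + e})) :
    a ≤ volume (Q.toSet ∩ {x | f x ≤ q}) := by
  have e : Q.toSet ∩ {x | f x ≤ q} = ⋂ k : ℕ, Q.toSet ∩ {x | f x ≤ q + 1 / ((k : ℝ) + 1)} := by
    rw [← inter_iInter]
    congr 1
    ext x
    simp only [mem_ofPred_eq, mem_iInter]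
    constructor
    · intro hx k
      have : (0 : ℝ) < 1 / ((k : ℝ) + 1) := by positivity
      linarith
    · intro hx
      have ht := (tendsto_one_div_add_atTop_nhds_zero_nat (𝕜 := ℝ)).const_add q
      rw [add_zero] at ht
      exact ge_of_tendsto' ht hx
  rw [e]
  have ht := tendsto_measure_iInter_atTop (μ := volume)
    (s := fun k : ℕ => Q.toSet ∩ {x | f x ≤ q + 1 / ((k : ℝ) + 1)})
    (fun k => ((measurableSet_toSet Q).inter (measurableSet_le hf measurable_const)).nullMeasurableSet)
    (by
      intro i j hij
      refine inter_subset_inter_right _ ?_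
      intro x hx
      simp only [mem_ofPred_eq] at hx ⊢
      refine hx.trans ?_
      have : (i : ℝ) ≤ j := by exact_mod_cast hij
      gcongr)
    ⟨0, ne_top_of_le_ne_top (volume_toSet_ne_top Q) (measure_mono inter_subset_left)⟩
  exact ge_of_tendsto' ht fun k => h _ (by positivity)

/-- `q` is a median of `p` on `Q`. -/
def IsMed {n : ℕ} (p : (Fin n → ℝ) → ℝ) (Q : RCube n) (q : ℝ) : Prop :=
  ENNReal.ofReal (1 / 2) * volume Q.toSet ≤ volume (Q.toSet ∩ {x | p x ≤ q}) ∧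
  ENNReal.ofReal (1 / 2) * volume Q.toSet ≤ volume (Q.toSet ∩ {x | q ≤ p x})

lemma half_add_half {n : ℕ} (Q : RCube n) : ENNReal.ofReal (1 / 2) * volume Q.toSet
    + ENNReal.ofReal (1 / 2) * volume Q.toSet = volume Q.toSet := by
  rw [← add_mul, ← ENNReal.ofReal_add (by norm_num) (by norm_num)]; norm_num

lemma exists_median {n : ℕ} {p : (Fin n → ℝ) → ℝ} (hpm : Measurable p) {a B : ℝ}
    (hp : ∀ x, a ≤ p x) (hB : ∀ x, p x ≤ B) (Q : RCube n) :
    ∃ q, a ≤ q ∧ q ≤ B ∧ IsMed p Q q := by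
  set S := {s : ℝ | ENNReal.ofReal (1 / 2) * volume Q.toSet ≤ volume (Q.toSet ∩ {x | p x ≤ s})} with hS
  have hBS : B ∈ S := by
    have e : Q.toSet ∩ {x | p x ≤ B} = Q.toSet := inter_eq_left.2 fun x _ => hB x
    simp only [hS, mem_ofPred_eq, e]
    exact mul_le_of_le_one_left (zero_le) (by rw [ENNReal.ofReal_le_one]; norm_num)
  have hlb : a ∈ lowerBounds S := by
    intro s hs
    by_contra hlt
    push Not at hlt
    have e : Q.toSet ∩ {x | p x ≤ s} = ∅ := by
      ext x
      simp only [mem_inter_iff, mem_ofPred_eq, mem_empty_iff_false, iff_false, not_and, not_le]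
      intro _; linarith [hp x]
    simp only [hS, mem_ofPred_eq, e, measure_empty, nonpos_iff_eq_zero, mul_eq_zero] at hs
    rcases hs with hs | hs
    · norm_num at hs
    · exact volume_toSet_ne_zero Q hs
  refine ⟨sInf S, le_csInf ⟨B, hBS⟩ hlb, csInf_le ⟨a, hlb⟩ hBS, ?_, ?_⟩
  · apply measure_le_of_forall_add Q hpm
    intro e he
    obtain ⟨s, hs, hlt⟩ := exists_lt_of_csInf_lt ⟨B, hBS⟩ (show sInf S < sInf S + e by linarith)
    refine le_trans hs (measure_mono (inter_subset_inter_right _ fun x hx => ?_))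
    simp only [mem_ofPred_eq] at hx ⊢; linarith
  · have h2 : ENNReal.ofReal (1 / 2) * volume Q.toSet
        ≤ volume (Q.toSet ∩ {x | -p x ≤ -sInf S}) := by
      apply measure_le_of_forall_add Q hpm.neg
      intro e he
      have hns : sInf S - e ∉ S := fun hmem => by
        have := csInf_le ⟨a, hlb⟩ hmem
        linarith
      simp only [hS, mem_ofPred_eq, not_le] at hns
      have h3 : volume Q.toSet ≤ ENNReal.ofReal (1 / 2) * volume Q.toSet
          + volume (Q.toSet ∩ {x | -p x ≤ -sInf S + e}) := by
        rw [← measure_inter_add_sdiff Q.toSet (measurableSet_le hpm (measurable_const (a := sInf S - e)))]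
        refine add_le_add ?_ (measure_mono ?_)
        · rw [measure_inter_add_sdiff Q.toSet (measurableSet_le hpm (measurable_const (a := sInf S - e)))]
          exact hns.le
        · intro x hx
          refine ⟨hx.1, ?_⟩
          have := hx.2
          simp only [mem_ofPred_eq, not_le] at this ⊢
          linarith
      nth_rewrite 1 [← half_add_half Q] at h3
      exact (ENNReal.add_le_add_iff_left (ENNReal.mul_ne_top ENNReal.ofReal_ne_top
        (volume_toSet_ne_top _))).1 h3
    refine h2.trans (measure_mono (inter_subset_inter_right _ fun x hx => ?_))
    simp only [mem_ofPred_eq] at hx ⊢; linarith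

lemma md_le_const {n : ℕ} (p : (Fin n → ℝ) → ℝ) (t q : ℝ) {S T : Set (Fin n → ℝ)}
    (hS : MeasurableSet S) (hST : S ⊆ T) (h : ∀ x ∈ S, t ^ p x ≤ t ^ q) :
    md p t S ≤ volume T * ENNReal.ofReal (t ^ q) := by
  calc md p t S ≤ ∫⁻ _ in S, ENNReal.ofReal (t ^ q) :=
        setLIntegral_mono' hS fun x hx => ENNReal.ofReal_le_ofReal (h x hx)
    _ = volume S * ENNReal.ofReal (t ^ q) := by rw [setLIntegral_const, mul_comm]
    _ ≤ _ := by gcongr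

lemma med_bound {n : ℕ} {p : (Fin n → ℝ) → ℝ} (hpm : Measurable p) {C : ℝ} (h : AIm p (1 / 2) C)
    (ι : Type) [Countable ι] (Q : ι → RCube n) (t q : ι → ℝ)
    (hQ : Pairwise fun i j => Disjoint (Q i).toSet (Q j).toSet) (ht : ∀ i, 0 < t i)
    (hq : ∀ i, IsMed p (Q i) (q i))
    (hsum : ∑' i, volume (Q i).toSet * ENNReal.ofReal (t i ^ q i) ≤ 1) :
    ∑' i, md p (t i) (Q i).toSet ≤ ENNReal.ofReal C := by
  classical
  have hex : ∀ i, ∃ E : Set (Fin n → ℝ), MeasurableSet E ∧ E ⊆ (Q i).toSet ∧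
      ENNReal.ofReal (1 / 2) * volume (Q i).toSet ≤ volume E ∧
      md p (t i) E ≤ volume (Q i).toSet * ENNReal.ofReal (t i ^ q i) := by
    intro i
    rcases le_total 1 (t i) with h1 | h1
    · have hm : MeasurableSet ((Q i).toSet ∩ {x | p x ≤ q i}) :=
        (measurableSet_toSet _).inter (measurableSet_le hpm measurable_const)
      exact ⟨_, hm, inter_subset_left, (hq i).1, md_le_const p _ _ hm inter_subset_left
        fun x hx => Real.rpow_le_rpow_of_exponent_le h1 hx.2⟩
    · have hm : MeasurableSet ((Q i).toSet ∩ {x | q i ≤ p x}) :=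
        (measurableSet_toSet _).inter (measurableSet_le measurable_const hpm)
      exact ⟨_, hm, inter_subset_left, (hq i).2, md_le_const p _ _ hm inter_subset_left
        fun x hx => Real.rpow_le_rpow_of_exponent_ge (ht i) h1 hx.2⟩
  choose E hE1 hE2 hE3 hE4 using hex
  exact h ι Q t E hQ ht hE1 hE2 hE3 ((ENNReal.tsum_le_tsum hE4).trans hsum)

/-- Bad cubes. -/
def Bad {n : ℕ} (p : (Fin n → ℝ) → ℝ) (R K : ℝ) (Q : RCube n) (t q : ℝ) : Prop :=
  ENNReal.ofReal K * volume Q.toSet < ∫⁻ x in Q.toSet, ENNReal.ofReal (t ^ (R * (p x - q)))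

lemma pow_le_layers {u K0 a ep : ℝ} (hu : 0 < u) (hK0 : 0 < K0) (ha : 1 < a) (hep : 0 < ep) :
    ENNReal.ofReal (u ^ ep) ≤ ENNReal.ofReal (K0 ^ ep) *
      (1 + ∑' k : ℕ, ENNReal.ofReal ((a ^ ep) ^ (k + 1)) * (if K0 * a ^ k ≤ u then 1 else 0)) := by
  rcases le_total u K0 with h | h
  · calc ENNReal.ofReal (u ^ ep) ≤ ENNReal.ofReal (K0 ^ ep) * 1 := by
          rw [mul_one]; gcongr
      _ ≤ _ := by gcongr; exact le_self_add
  · obtain ⟨k, hk1, hk2⟩ := exists_nat_pow_near (x := u / K0) (y := a) (by rwa [one_le_div hK0]) ha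
    rw [le_div_iff₀ hK0] at hk1
    rw [div_lt_iff₀ hK0] at hk2
    have ha0 : 0 < a := by linarith
    calc ENNReal.ofReal (u ^ ep) ≤ ENNReal.ofReal ((a ^ (k + 1) * K0) ^ ep) := by gcongr
      _ = ENNReal.ofReal (K0 ^ ep) * ENNReal.ofReal ((a ^ ep) ^ (k + 1)) := by
          rw [← ENNReal.ofReal_mul (by positivity), Real.mul_rpow (by positivity) hK0.le, mul_comm,
            ← Real.rpow_natCast, ← Real.rpow_natCast, ← Real.rpow_mul ha0.le, ← Real.rpow_mul ha0.le,
            mul_comm ep]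
      _ = ENNReal.ofReal (K0 ^ ep) * (ENNReal.ofReal ((a ^ ep) ^ (k + 1)) *
            (if K0 * a ^ k ≤ u then 1 else 0)) := by
          rw [if_pos (by linarith), mul_one]
      _ ≤ _ := by
          gcongr
          refine le_trans ?_ le_add_self
          exact ENNReal.le_tsum (f := fun k : ℕ => ENNReal.ofReal ((a ^ ep) ^ (k + 1)) *
            (if K0 * a ^ k ≤ u then 1 else 0)) k

lemma bad_sum {n : ℕ} {p : (Fin n → ℝ) → ℝ} (hpm : Measurable p) {B : ℝ}
    (hp : ∀ x, 1 ≤ p x) (hB : ∀ x, p x ≤ B) {C : ℝ} (hC : 1 ≤ C) (h : AIm p (1 / 2) C) :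
    ∃ R K : ℝ, 1 < R ∧ 1 ≤ K ∧ ∀ (ι : Type) [Countable ι] (Q : ι → RCube n) (t q : ι → ℝ),
      (Pairwise fun i j => Disjoint (Q i).toSet (Q j).toSet) → (∀ i, 0 < t i) →
      (∀ i, IsMed p (Q i) (q i)) → (∀ i, Bad p R K (Q i) (t i) (q i)) →
      ∑' i, volume (Q i).toSet * ENNReal.ofReal (t i ^ q i) ≤ 1 →
      ∑' i, volume (Q i).toSet * ENNReal.ofReal (t i ^ q i) ≤ ENNReal.ofReal (1 / 4) := by
  classical
  obtain ⟨be, del, hbe, hdel, hdel1, hdec⟩ := decay hp hB hC h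
  have hC0 : 0 < C := by linarith
  have hB1 : 1 ≤ B := (hp 0).trans (hB 0)
  set a := del⁻¹ with ha
  have ha1 : 1 < a := (one_lt_inv₀ hdel).2 hdel1
  have ha0 : 0 < a := by linarith
  have hbe0 : 0 < be := by linarith
  set g := √be with hg
  have hg1 : 1 < g := by rw [hg, Real.lt_sqrt (by norm_num)]; simpa using hbe
  have hg0 : 0 < g := by linarith
  have hgg : g * g = be := Real.mul_self_sqrt hbe0.le
  set ep := Real.log g / Real.log a with hep
  have hla : 0 < Real.log a := Real.log_pos ha1
  have hep0 : 0 < ep := div_pos (Real.log_pos hg1) hla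
  have hag : a ^ ep = g := by
    rw [Real.rpow_def_of_pos ha0, hep, mul_div_cancel₀ _ hla.ne', Real.exp_log hg0]
  set K0 := 8 * C with hK0
  have hK00 : 0 < K0 := by positivity
  set G := K0 ^ ep * (C + C ^ B * (g * (1 - g⁻¹)⁻¹)) with hG
  have hginv : 0 < 1 - g⁻¹ := by
    have := inv_lt_one_of_one_lt₀ hg1; linarith
  have hG0 : 0 < G := by positivity
  refine ⟨1 + ep, 8 * G + 1, by linarith, by linarith, ?_⟩
  set K := 8 * G + 1 with hK
  have hKpos : 0 < K := by positivity
  intro ι _ Q t q hQ ht hmed hbad hsum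
  have hmd := med_bound hpm h ι Q t q hQ ht hmed hsum
  set A : ι → Prop := fun i => ENNReal.ofReal K0 * volume (Q i).toSet <
    ∫⁻ x in (Q i).toSet, ENNReal.ofReal (t i ^ (p x - q i)) with hA
  set E : ℕ → ι → Set (Fin n → ℝ) := fun k i => if A i then ∅ else
    (Q i).toSet ∩ {x | K0 * a ^ k ≤ t i ^ (p x - q i)} with hE
  have hum : ∀ i, Measurable fun x => t i ^ (p x - q i) := fun i =>
    (measurable_const).pow (hpm.sub measurable_const)
  have hpow : ∀ i, Measurable fun x => t i ^ p x := fun i => measurable_const.pow hpm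
  have hEm : ∀ k i, MeasurableSet (E k i) := by
    intro k i
    simp only [hE]
    split_ifs
    · exact MeasurableSet.empty
    · exact (measurableSet_toSet _).inter (measurableSet_le measurable_const (hum i))
  have hEs : ∀ k i, E k i ⊆ (Q i).toSet := by
    intro k i
    simp only [hE]
    split_ifs
    · exact empty_subset _
    · exact inter_subset_left
  have hEv : ∀ k i, volume (E k i) ≤ ENNReal.ofReal (del ^ k) * volume (Q i).toSet := by
    intro k i
    simp only [hE]
    split_ifs with hAi
    · simp
    · simp only [hA, not_lt] at hAi
      have h1 : ENNReal.ofReal (K0 * a ^ k) * volume ((Q i).toSet ∩ {x | K0 * a ^ k ≤ t i ^ (p x - q i)})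
          ≤ ENNReal.ofReal K0 * volume (Q i).toSet := by
        refine le_trans ?_ hAi
        rw [← setLIntegral_const]
        refine le_trans (setLIntegral_mono' ((measurableSet_toSet _).inter
          (measurableSet_le measurable_const (hum i))) fun x hx => ENNReal.ofReal_le_ofReal hx.2) ?_
        exact lintegral_mono_set inter_subset_left
      have h2 : ENNReal.ofReal (K0 * a ^ k) * (ENNReal.ofReal (del ^ k) * volume (Q i).toSet)
          = ENNReal.ofReal K0 * volume (Q i).toSet := by
        rw [← mul_assoc, ← ENNReal.ofReal_mul (by positivity), mul_assoc, ← mul_pow, ha,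
          inv_mul_cancel₀ hdel.ne', one_pow, mul_one]
      rw [← h2] at h1
      rwa [ENNReal.mul_le_mul_iff_right (by simp; positivity) ENNReal.ofReal_ne_top] at h1
  have hEd : ∀ k, ∑' i, md p (t i) (E k i) ≤ ENNReal.ofReal (C ^ B * (be ^ k)⁻¹) := fun k =>
    hdec k C hC ι Q t (E k) hQ ht (hEm k) (hEs k) (hEv k) hmd
  have hadd : ∀ i x, ENNReal.ofReal (t i ^ q i) * ENNReal.ofReal (t i ^ (p x - q i))
      = ENNReal.ofReal (t i ^ p x) := by
    intro i x
    rw [← ENNReal.ofReal_mul (Real.rpow_nonneg (ht i).le _), ← Real.rpow_add (ht i)]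
    congr 2; ring
  -- pointwise estimate for each cube
  have hpt : ∀ i, volume (Q i).toSet * ENNReal.ofReal (t i ^ q i) ≤
      ENNReal.ofReal (K0⁻¹) * md p (t i) (Q i).toSet + ENNReal.ofReal (K⁻¹) * (ENNReal.ofReal (K0 ^ ep) *
        (md p (t i) (Q i).toSet + ∑' k : ℕ, ENNReal.ofReal (g ^ (k + 1)) * md p (t i) (E k i))) := by
    intro i
    by_cases hAi : A i
    · refine le_trans ?_ le_self_add
      have h1 : ENNReal.ofReal K0 * (volume (Q i).toSet * ENNReal.ofReal (t i ^ q i))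
          ≤ md p (t i) (Q i).toSet := by
        calc _ = ENNReal.ofReal (t i ^ q i) * (ENNReal.ofReal K0 * volume (Q i).toSet) := by ring
          _ ≤ ENNReal.ofReal (t i ^ q i) * ∫⁻ x in (Q i).toSet, ENNReal.ofReal (t i ^ (p x - q i)) := by
              gcongr
          _ = md p (t i) (Q i).toSet := by
              rw [← lintegral_const_mul' _ _ ENNReal.ofReal_ne_top]
              simp only [hadd]; rfl
      calc _ = ENNReal.ofReal (K0⁻¹) * (ENNReal.ofReal K0 *
              (volume (Q i).toSet * ENNReal.ofReal (t i ^ q i))) := by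
            rw [← mul_assoc, ← ENNReal.ofReal_mul (by positivity), inv_mul_cancel₀ hK00.ne',
              ENNReal.ofReal_one, one_mul]
        _ ≤ _ := by gcongr
    · refine le_trans ?_ le_add_self
      have h1 : ENNReal.ofReal K * (volume (Q i).toSet * ENNReal.ofReal (t i ^ q i))
          ≤ ENNReal.ofReal (K0 ^ ep) * (md p (t i) (Q i).toSet +
            ∑' k : ℕ, ENNReal.ofReal (g ^ (k + 1)) * md p (t i) (E k i)) := by
        calc _ = ENNReal.ofReal (t i ^ q i) * (ENNReal.ofReal K * volume (Q i).toSet) := by ring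
          _ ≤ ENNReal.ofReal (t i ^ q i) *
              ∫⁻ x in (Q i).toSet, ENNReal.ofReal (t i ^ ((1 + ep) * (p x - q i))) := by
              gcongr; exact (hbad i).le
          _ = ∫⁻ x in (Q i).toSet, ENNReal.ofReal (t i ^ p x) *
                ENNReal.ofReal ((t i ^ (p x - q i)) ^ ep) := by
              rw [← lintegral_const_mul' _ _ ENNReal.ofReal_ne_top]
              refine lintegral_congr fun x => ?_
              have e : t i ^ ((1 + ep) * (p x - q i)) = t i ^ (p x - q i) * (t i ^ (p x - q i)) ^ ep := by
                rw [← Real.rpow_mul (ht i).le, ← Real.rpow_add (ht i)]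
                congr 1; ring
              rw [e, ENNReal.ofReal_mul (Real.rpow_nonneg (ht i).le _), ← mul_assoc, hadd]
          _ ≤ ∫⁻ x in (Q i).toSet, ENNReal.ofReal (K0 ^ ep) * (ENNReal.ofReal (t i ^ p x) +
                ∑' k : ℕ, ENNReal.ofReal (g ^ (k + 1)) *
                  ({x | K0 * a ^ k ≤ t i ^ (p x - q i)}.indicator
                    (fun x => ENNReal.ofReal (t i ^ p x)) x)) := by
              refine lintegral_mono fun x => ?_
              have h2 := pow_le_layers (Real.rpow_pos_of_pos (ht i) (p x - q i)) hK00 ha1 hep0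
              rw [hag] at h2
              refine le_trans (mul_le_mul_right h2 _) (le_of_eq ?_)
              rw [mul_left_comm, mul_add, mul_one, ← ENNReal.tsum_mul_left]
              congr 3; ext k
              rw [mul_left_comm]
              congr 1
              by_cases hx : K0 * a ^ k ≤ t i ^ (p x - q i)
              · rw [if_pos hx, indicator_of_mem (by exact hx), mul_one]
              · rw [if_neg hx, indicator_of_notMem (by exact hx), mul_zero]
          _ = _ := by
              have hmE : ∀ k, MeasurableSet {x | K0 * a ^ k ≤ t i ^ (p x - q i)} := fun k =>
                measurableSet_le measurable_const (hum i)
              rw [lintegral_const_mul' _ _ ENNReal.ofReal_ne_top,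
                lintegral_add_left (hpow i).ennreal_ofReal, lintegral_tsum fun k =>
                ((((hpow i).ennreal_ofReal).indicator (hmE k)).const_mul _).aemeasurable]
              congr 2
              congr 1; ext k
              rw [lintegral_const_mul' _ _ ENNReal.ofReal_ne_top]
              congr 1
              rw [lintegral_indicator (hmE k), Measure.restrict_restrict (hmE k)]
              simp only [md, hE, if_neg hAi]
              rw [inter_comm]
      calc _ = ENNReal.ofReal (K⁻¹) * (ENNReal.ofReal K *
              (volume (Q i).toSet * ENNReal.ofReal (t i ^ q i))) := by
            rw [← mul_assoc, ← ENNReal.ofReal_mul (by positivity), inv_mul_cancel₀ hKpos.ne',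
              ENNReal.ofReal_one, one_mul]
        _ ≤ _ := by gcongr
  refine (ENNReal.tsum_le_tsum hpt).trans ?_
  rw [ENNReal.tsum_add, ENNReal.tsum_mul_left, ENNReal.tsum_mul_left, ENNReal.tsum_mul_left,
    ENNReal.tsum_add, ENNReal.tsum_comm]
  have hser : ∑' k : ℕ, ∑' i, ENNReal.ofReal (g ^ (k + 1)) * md p (t i) (E k i)
      ≤ ENNReal.ofReal (C ^ B * (g * (1 - g⁻¹)⁻¹)) := by
    calc _ ≤ ∑' k : ℕ, ENNReal.ofReal (C ^ B * g * g⁻¹ ^ k) := by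
          refine ENNReal.tsum_le_tsum fun k => ?_
          rw [ENNReal.tsum_mul_left]
          refine (mul_le_mul_right (hEd k) _).trans (le_of_eq ?_)
          rw [← ENNReal.ofReal_mul (by positivity), ← hgg]
          congr 1
          rw [mul_pow, pow_succ, inv_pow]; field_simp
      _ = ENNReal.ofReal (∑' k : ℕ, C ^ B * g * g⁻¹ ^ k) := by
          rw [ENNReal.ofReal_tsum_of_nonneg (fun k => by positivity)]
          exact (summable_geometric_of_lt_one (by positivity) (inv_lt_one_of_one_lt₀ hg1)).mul_left _
      _ = _ := by
          rw [tsum_mul_left, tsum_geometric_of_lt_one (by positivity) (inv_lt_one_of_one_lt₀ hg1),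
            mul_assoc]
  calc _ ≤ ENNReal.ofReal (K0⁻¹) * ENNReal.ofReal C + ENNReal.ofReal (K⁻¹) * (ENNReal.ofReal (K0 ^ ep) *
        (ENNReal.ofReal C + ENNReal.ofReal (C ^ B * (g * (1 - g⁻¹)⁻¹)))) := by gcongr
    _ = ENNReal.ofReal (K0⁻¹ * C + K⁻¹ * G) := by
        rw [← ENNReal.ofReal_add hC0.le (by positivity), ← ENNReal.ofReal_mul (by positivity),
          ← ENNReal.ofReal_mul (by positivity), ← ENNReal.ofReal_mul (by positivity),
          ← ENNReal.ofReal_add (by positivity) (by positivity)]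
    _ ≤ _ := by
        apply ENNReal.ofReal_le_ofReal
        have e1 : K0⁻¹ * C = 1 / 8 := by rw [hK0]; field_simp
        have e2 : K⁻¹ * G ≤ 1 / 8 := by
          rw [inv_mul_le_iff₀ hKpos]; linarith
        linarith

/-- The bad lemma, greedy form. -/
lemma bad_lemma {n : ℕ} {p : (Fin n → ℝ) → ℝ} (hpm : Measurable p) {B : ℝ}
    (hp : ∀ x, 1 ≤ p x) (hB : ∀ x, p x ≤ B) {C : ℝ} (hC : 1 ≤ C) (h : AIm p (1 / 2) C) :
    ∃ R K : ℝ, 1 < R ∧ 1 ≤ K ∧ ∀ (ι : Type) [Countable ι] (Q : ι → RCube n) (t q : ι → ℝ),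
      (Pairwise fun i j => Disjoint (Q i).toSet (Q j).toSet) → (∀ i, 0 < t i) →
      (∀ i, IsMed p (Q i) (q i)) → (∀ i, Bad p R K (Q i) (t i) (q i)) →
      (∀ i, volume (Q i).toSet * ENNReal.ofReal (t i ^ q i) ≤ 1) →
      ∑' i, volume (Q i).toSet * ENNReal.ofReal (t i ^ q i) ≤ ENNReal.ofReal (1 / 4) := by
  classical
  obtain ⟨R, K, hR, hK, hmain⟩ := bad_sum hpm hp hB hC h
  refine ⟨R, K, hR, hK, ?_⟩
  intro ι _ Q t q hQ ht hmed hbad hone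
  have hsingle : ∀ i, volume (Q i).toSet * ENNReal.ofReal (t i ^ q i) ≤ ENNReal.ofReal (1 / 4) := by
    intro i
    have := hmain Unit (fun _ => Q i) (fun _ => t i) (fun _ => q i)
      (fun a b hab => absurd (Subsingleton.elim a b) hab) (fun _ => ht i) (fun _ => hmed i)
      (fun _ => hbad i) (by simpa using hone i)
    simpa using this
  rw [ENNReal.tsum_eq_iSup_sum]
  refine iSup_le fun s => ?_
  induction s using Finset.induction_on with
  | empty => simp
  | insert i s hi ih =>
    have := hmain ↥(insert i s) (fun j => Q j) (fun j => t j) (fun j => q j)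
      (fun a b hab => hQ (fun h => hab (Subtype.ext h))) (fun j => ht j) (fun j => hmed j)
      (fun j => hbad j) (by
        rw [Finset.tsum_subtype (insert i s)
          (fun j => volume (Q j).toSet * ENNReal.ofReal (t j ^ q j)), Finset.sum_insert hi]
        refine (add_le_add (hsingle i) ih).trans ?_
        rw [← ENNReal.ofReal_add (by norm_num) (by norm_num), ENNReal.ofReal_le_one]; norm_num)
    rwa [Finset.tsum_subtype (insert i s)
          (fun j => volume (Q j).toSet * ENNReal.ofReal (t j ^ q j))] at this

/-! ### Young inequality on cubes -/

lemma rpow_le_one_add {a th Th y : ℝ} (ha : 0 < a) (h0 : 0 ≤ th) (h1 : th ≤ Th) :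
    a ^ (th * y) ≤ 1 + a ^ (Th * y) := by
  rw [mul_comm th, mul_comm Th, Real.rpow_mul ha.le, Real.rpow_mul ha.le]
  have hb : 0 < a ^ y := Real.rpow_pos_of_pos ha _
  rcases le_total (a ^ y) 1 with h | h
  · have h2 := Real.rpow_le_one hb.le h h0
    have h3 : 0 < (a ^ y) ^ Th := Real.rpow_pos_of_pos hb _
    linarith
  · have h2 := Real.rpow_le_rpow_of_exponent_le h h1
    linarith

lemma young_point {P t q ka : ℝ} (hP : 1 < P) (ht : 0 < t) (hka : 0 < ka) (hka1 : ka ≤ 1)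
    (G : ℝ≥0∞) :
    G * ENNReal.ofReal (t ^ (q - 1)) ≤ ENNReal.ofReal (ka⁻¹ ^ P) * G ^ P
      + ENNReal.ofReal (ka * (t ^ q * t ^ ((q - P) / (P - 1)))) := by
  have hc := Real.HolderConjugate.conjExponent hP
  have hP0 : 0 < P := by linarith
  have hP1 : 0 < P - 1 := by linarith
  have hP'1 : 1 < Real.conjExponent P := hc.symm.lt
  have hy := ENNReal.young_inequality (ENNReal.ofReal ka⁻¹ * G) (ENNReal.ofReal (ka * t ^ (q - 1))) hc
  have e1 : ENNReal.ofReal ka⁻¹ * G * ENNReal.ofReal (ka * t ^ (q - 1))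
      = G * ENNReal.ofReal (t ^ (q - 1)) := by
    rw [mul_comm (ENNReal.ofReal ka⁻¹), mul_assoc, ← ENNReal.ofReal_mul (by positivity), ← mul_assoc,
      inv_mul_cancel₀ hka.ne', one_mul]
  have hdiv : ∀ (a : ℝ≥0∞) {b : ℝ}, 1 ≤ b → a / ENNReal.ofReal b ≤ a := by
    intro a b hb
    apply ENNReal.div_le_of_le_mul
    exact le_mul_of_one_le_right (zero_le) (by rwa [ENNReal.one_le_ofReal])
  rw [e1] at hy
  refine hy.trans (add_le_add ((hdiv _ hP.le).trans (le_of_eq ?_)) ((hdiv _ hP'1.le).trans ?_))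
  · rw [ENNReal.mul_rpow_of_nonneg _ _ hP0.le, ENNReal.ofReal_rpow_of_pos (by positivity)]
  · rw [ENNReal.ofReal_rpow_of_pos (by positivity)]
    apply ENNReal.ofReal_le_ofReal
    rw [Real.mul_rpow hka.le (by positivity), ← Real.rpow_mul ht.le, ← Real.rpow_add ht]
    have e2 : (q - 1) * Real.conjExponent P = q + (q - P) / (P - 1) := by
      rw [Real.conjExponent]; field_simp; ring
    rw [e2]
    gcongr
    have := Real.rpow_le_rpow_of_exponent_ge hka hka1 hP'1.le
    rwa [Real.rpow_one] at this

lemma young_cube {n : ℕ} {p : (Fin n → ℝ) → ℝ} (hpm : Measurable p) {c B : ℝ} (hc : 1 < c)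
    (hp : ∀ x, c ≤ p x) (hB : ∀ x, p x ≤ B) (Q : RCube n) {t q s ep K ka : ℝ} (ht : 0 < t)
    (hs : 1 < s) (hep0 : 0 ≤ ep) (hep : ep ≤ (c - 1) * (1 - 1 / s)) (hka : 0 < ka) (hka1 : ka ≤ 1)
    (hK0 : 0 ≤ K)
    (hK : ∫⁻ x in Q.toSet, ENNReal.ofReal (t ^ (s * ((q - p x) / (p x - 1))))
      ≤ ENNReal.ofReal K * volume Q.toSet) (G : (Fin n → ℝ) → ℝ≥0∞) (hG : Measurable G) :
    ENNReal.ofReal (t ^ (q - ep - 1)) * (∫⁻ x in Q.toSet, G x) ≤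
      ENNReal.ofReal (ka⁻¹ ^ B) * (∫⁻ x in Q.toSet, G x ^ (p x - ep))
      + ENNReal.ofReal (ka * (1 + K) * t ^ (q - ep)) * volume Q.toSet := by
  have hpt : ∀ x, ENNReal.ofReal (t ^ (q - ep - 1)) * G x ≤
      ENNReal.ofReal (ka⁻¹ ^ B) * G x ^ (p x - ep) + ENNReal.ofReal (ka * t ^ (q - ep)) *
        (1 + ENNReal.ofReal (t ^ (s * ((q - p x) / (p x - 1))))) := by
    intro x
    have hpx := hp x
    have hs0 : 0 < s := by linarith
    have h1s : 0 < 1 - 1 / s := by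
      rw [sub_pos, div_lt_one hs0]; exact hs
    have hep2 : ep ≤ (p x - 1) * (1 - 1 / s) := hep.trans (by gcongr)
    have hpe : (p x - 1) / s ≤ p x - ep - 1 := by
      have : (p x - 1) * (1 - 1 / s) = (p x - 1) - (p x - 1) / s := by ring
      linarith
    have hp1 : 0 < p x - 1 := by linarith
    have hpe0 : 0 < p x - ep - 1 := lt_of_lt_of_le (by positivity) hpe
    have hy := young_point (P := p x - ep) (q := q - ep) (by linarith) ht hka hka1 (G x)
    rw [mul_comm]
    refine hy.trans (add_le_add ?_ ?_)
    · gcongr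
      · exact (one_le_inv₀ hka).2 hka1
      · linarith [hB x]
    · rw [← ENNReal.ofReal_one, ← ENNReal.ofReal_add zero_le_one (by positivity),
        ← ENNReal.ofReal_mul (by positivity)]
      apply ENNReal.ofReal_le_ofReal
      rw [← mul_assoc]
      refine mul_le_mul_of_nonneg_left ?_ (by positivity)
      have e : (q - ep - (p x - ep)) / (p x - ep - 1)
          = ((p x - 1) / s / (p x - ep - 1)) * (s * ((q - p x) / (p x - 1))) := by
        field_simp; ring
      rw [e]
      have := rpow_le_one_add (a := t) (th := (p x - 1) / s / (p x - ep - 1)) (Th := 1)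
        (y := s * ((q - p x) / (p x - 1))) ht (by positivity) (by rw [div_le_one hpe0]; exact hpe)
      rwa [one_mul] at this
  have hm1 : Measurable fun x => ENNReal.ofReal (ka⁻¹ ^ B) * G x ^ (p x - ep) :=
    (hG.pow (hpm.sub measurable_const)).const_mul _
  calc ENNReal.ofReal (t ^ (q - ep - 1)) * (∫⁻ x in Q.toSet, G x)
      = ∫⁻ x in Q.toSet, ENNReal.ofReal (t ^ (q - ep - 1)) * G x :=
        (lintegral_const_mul' _ _ ENNReal.ofReal_ne_top).symm
    _ ≤ _ := lintegral_mono hpt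
    _ = ENNReal.ofReal (ka⁻¹ ^ B) * (∫⁻ x in Q.toSet, G x ^ (p x - ep))
        + ENNReal.ofReal (ka * t ^ (q - ep)) * (volume Q.toSet +
          ∫⁻ x in Q.toSet, ENNReal.ofReal (t ^ (s * ((q - p x) / (p x - 1))))) := by
        rw [lintegral_add_left hm1, lintegral_const_mul' _ _ ENNReal.ofReal_ne_top,
          lintegral_const_mul' _ _ ENNReal.ofReal_ne_top, lintegral_add_left measurable_const,
          setLIntegral_one]
    _ ≤ ENNReal.ofReal (ka⁻¹ ^ B) * (∫⁻ x in Q.toSet, G x ^ (p x - ep))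
        + ENNReal.ofReal (ka * t ^ (q - ep)) * (volume Q.toSet +
          ENNReal.ofReal K * volume Q.toSet) := by gcongr
    _ = _ := by
        congr 1
        have : volume Q.toSet + ENNReal.ofReal K * volume Q.toSet
            = ENNReal.ofReal (1 + K) * volume Q.toSet := by
          rw [ENNReal.ofReal_add zero_le_one hK0, ENNReal.ofReal_one, add_mul, one_mul]
        rw [this, ← mul_assoc, ← ENNReal.ofReal_mul (by positivity)]
        congr 2; ring

/-! ### Combining the conditions on the exponent and its conjugate -/

lemma IsMed.conj {n : ℕ} {p : (Fin n → ℝ) → ℝ} (hp : ∀ x, 1 < p x) {Q : RCube n} {q : ℝ}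
    (hq : 1 < q) (h : IsMed p Q q) : IsMed (fun x => p x / (p x - 1)) Q (q / (q - 1)) := by
  have key : ∀ a b : ℝ, 1 < a → 1 < b → (a / (a - 1) ≤ b / (b - 1) ↔ b ≤ a) := by
    intro a b ha hb
    rw [div_le_div_iff₀ (by linarith) (by linarith)]
    constructor <;> intro h <;> nlinarith
  have e1 : {x | p x / (p x - 1) ≤ q / (q - 1)} = {x | q ≤ p x} := by
    ext x; exact key _ _ (hp x) hq
  have e2 : {x | q / (q - 1) ≤ p x / (p x - 1)} = {x | p x ≤ q} := by
    ext x; exact key _ _ hq (hp x)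
  exact ⟨by rw [e1]; exact h.2, by rw [e2]; exact h.1⟩

lemma conj_rpow_self {t q : ℝ} (ht : 0 < t) (hq : 1 < q) : (t ^ (q - 1)) ^ (q / (q - 1)) = t ^ q := by
  have : q - 1 ≠ 0 := by linarith
  rw [← Real.rpow_mul ht.le]; congr 1; field_simp

lemma conj_rpow {t q a R : ℝ} (ht : 0 < t) (hq : 1 < q) (ha : 1 < a) :
    (t ^ (q - 1)) ^ (R * (a / (a - 1) - q / (q - 1))) = t ^ (R * ((q - a) / (a - 1))) := by
  have : q - 1 ≠ 0 := by linarith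
  have : a - 1 ≠ 0 := by linarith
  rw [← Real.rpow_mul ht.le]; congr 1; field_simp; ring

/-- Either the exponent or its conjugate oscillates too much on `Q` at height `t`. -/
def BB {n : ℕ} (p : (Fin n → ℝ) → ℝ) (R K : ℝ) (Q : RCube n) (t q : ℝ) : Prop :=
  (ENNReal.ofReal K * volume Q.toSet < ∫⁻ x in Q.toSet, ENNReal.ofReal (t ^ (R * (p x - q)))) ∨
  (ENNReal.ofReal K * volume Q.toSet <
    ∫⁻ x in Q.toSet, ENNReal.ofReal (t ^ (R * ((q - p x) / (p x - 1)))))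

lemma lower_exp {n : ℕ} (Q : RCube n) {y : (Fin n → ℝ) → ℝ} {t th Th K : ℝ} (ht : 0 < t)
    (h0 : 0 ≤ th) (h1 : th ≤ Th) (hK : 0 ≤ K)
    (h : ∫⁻ x in Q.toSet, ENNReal.ofReal (t ^ (Th * y x)) ≤ ENNReal.ofReal K * volume Q.toSet) :
    ∫⁻ x in Q.toSet, ENNReal.ofReal (t ^ (th * y x)) ≤ ENNReal.ofReal (1 + K) * volume Q.toSet := by
  calc ∫⁻ x in Q.toSet, ENNReal.ofReal (t ^ (th * y x))
      ≤ ∫⁻ x in Q.toSet, (1 + ENNReal.ofReal (t ^ (Th * y x))) := by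
        apply lintegral_mono
        intro x
        simp only []
        rw [← ENNReal.ofReal_one, ← ENNReal.ofReal_add zero_le_one (by positivity)]
        exact ENNReal.ofReal_le_ofReal (rpow_le_one_add ht h0 h1)
    _ = volume Q.toSet + ∫⁻ x in Q.toSet, ENNReal.ofReal (t ^ (Th * y x)) := by
        rw [lintegral_add_left measurable_const, setLIntegral_one]
    _ ≤ volume Q.toSet + ENNReal.ofReal K * volume Q.toSet := by gcongr
    _ = _ := by
        rw [ENNReal.ofReal_add zero_le_one hK, ENNReal.ofReal_one, add_mul, one_mul]

lemma tsum_split {ι : Type} (f : ι → ℝ≥0∞) (P S : ι → Prop) (h : ∀ i, P i ∨ S i) :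
    ∑' i, f i ≤ (∑' i : {i // P i}, f i) + ∑' i : {i // S i}, f i := by
  have e1 : ∑' i : {i // P i}, f i = ∑' i, ({i | P i} : Set ι).indicator f i := tsum_subtype {i | P i} f
  have e2 : ∑' i : {i // S i}, f i = ∑' i, ({i | S i} : Set ι).indicator f i := tsum_subtype {i | S i} f
  rw [e1, e2, ← ENNReal.tsum_add]
  refine ENNReal.tsum_le_tsum fun i => ?_
  rcases h i with h | h
  · exact le_add_right (by rw [indicator_of_mem (by exact h)])
  · exact le_add_left (by rw [indicator_of_mem (by exact h)])

lemma bb_lemma {n : ℕ} {p : (Fin n → ℝ) → ℝ} (hpm : Measurable p) {c B : ℝ} (hc : 1 < c)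
    (hp : ∀ x, c ≤ p x) (hB : ∀ x, p x ≤ B) {C C2 : ℝ} (hC : 1 ≤ C) (h : AIm p (1 / 2) C)
    (hC2 : 1 ≤ C2) (h2 : AIm (fun x => p x / (p x - 1)) (1 / 2) C2) :
    ∃ R K : ℝ, 1 < R ∧ 1 ≤ K ∧
      (∀ (Q : RCube n) (t q : ℝ), c ≤ q → IsMed p Q q → 0 < t →
        volume Q.toSet * ENNReal.ofReal (t ^ q) = 1 → ¬ BB p R K Q t q) ∧
      (∀ (ι : Type) [Countable ι] (Q : ι → RCube n) (t q : ι → ℝ),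
        (Pairwise fun i j => Disjoint (Q i).toSet (Q j).toSet) → (∀ i, 0 < t i) →
        (∀ i, c ≤ q i) → (∀ i, IsMed p (Q i) (q i)) →
        (∀ i, volume (Q i).toSet * ENNReal.ofReal (t i ^ q i) ≤ 1) →
        (∀ i, BB p R K (Q i) (t i) (q i)) →
        ∑' i, md p (t i) (Q i).toSet ≤ ENNReal.ofReal C) := by
  have hp1 : ∀ x, 1 < p x := fun x => hc.trans_le (hp x)
  have hp'm : Measurable fun x => p x / (p x - 1) := hpm.div (hpm.sub measurable_const)
  have hp'1 : ∀ x, 1 ≤ p x / (p x - 1) := by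
    intro x
    rw [le_div_iff₀ (by linarith [hp1 x])]; linarith
  have hp'B : ∀ x, p x / (p x - 1) ≤ c / (c - 1) := by
    intro x
    rw [div_le_div_iff₀ (by linarith [hp1 x]) (by linarith)]
    nlinarith [hp x]
  obtain ⟨R1, K1, hR1, hK1, H1⟩ := bad_lemma hpm (fun x => (hp1 x).le) hB hC h
  obtain ⟨R2, K2, hR2, hK2, H2⟩ := bad_lemma hp'm hp'1 hp'B hC2 h2
  have bbsplit : ∀ (Q : RCube n) (t q : ℝ), 0 < t → 1 < q → BB p (min R1 R2) (1 + max K1 K2) Q t q →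
      Bad p R1 K1 Q t q ∨ Bad (fun x => p x / (p x - 1)) R2 K2 Q (t ^ (q - 1)) (q / (q - 1)) := by
    intro Q t q ht hq hbb
    have hmin : 0 ≤ min R1 R2 := (lt_min (by linarith) (by linarith)).le
    rcases hbb with hb | hb
    · left
      by_contra hn
      unfold Bad at hn
      push Not at hn
      have := lower_exp Q (y := fun x => p x - q) ht hmin (min_le_left R1 R2) (by linarith : 0 ≤ K1) hn
      refine absurd (hb.trans_le this) (not_lt.2 ?_)
      gcongr
      exact le_max_left _ _
    · right
      by_contra hn
      unfold Bad at hn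
      push Not at hn
      simp only [conj_rpow ht hq (hp1 _)] at hn
      have := lower_exp Q (y := fun x => (q - p x) / (p x - 1)) ht hmin (min_le_right R1 R2)
        (by linarith : 0 ≤ K2) hn
      refine absurd (hb.trans_le this) (not_lt.2 ?_)
      gcongr
      exact le_max_right _ _
  have F2 : ∀ (ι : Type) [Countable ι] (Q : ι → RCube n) (t q : ι → ℝ),
        (Pairwise fun i j => Disjoint (Q i).toSet (Q j).toSet) → (∀ i, 0 < t i) →
        (∀ i, c ≤ q i) → (∀ i, IsMed p (Q i) (q i)) →
        (∀ i, volume (Q i).toSet * ENNReal.ofReal (t i ^ q i) ≤ 1) →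
        (∀ i, BB p (min R1 R2) (1 + max K1 K2) (Q i) (t i) (q i)) →
        ∑' i, volume (Q i).toSet * ENNReal.ofReal (t i ^ q i) ≤ ENNReal.ofReal (1 / 2) := by
    intro ι _ Q t q hQ ht hcq hmed hvol hbb
    have hq1 : ∀ i, 1 < q i := fun i => hc.trans_le (hcq i)
    refine (tsum_split _ (fun i => Bad p R1 K1 (Q i) (t i) (q i))
      (fun i => Bad (fun x => p x / (p x - 1)) R2 K2 (Q i) (t i ^ (q i - 1)) (q i / (q i - 1)))
      (fun i => bbsplit _ _ _ (ht i) (hq1 i) (hbb i))).trans ?_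
    have e : ENNReal.ofReal (1 / 2) = ENNReal.ofReal (1 / 4) + ENNReal.ofReal (1 / 4) := by
      rw [← ENNReal.ofReal_add (by norm_num) (by norm_num)]; norm_num
    rw [e]
    refine add_le_add ?_ ?_
    · exact H1 {i // Bad p R1 K1 (Q i) (t i) (q i)} (fun i => Q i.1) (fun i => t i.1) (fun i => q i.1)
        (fun i j hij => hQ fun h => hij (Subtype.ext h)) (fun i => ht i.1) (fun i => hmed i.1)
        (fun i => i.2) (fun i => hvol i.1)
    · have := H2 {i // Bad (fun x => p x / (p x - 1)) R2 K2 (Q i) (t i ^ (q i - 1)) (q i / (q i - 1))}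
        (fun i => Q i.1) (fun i => t i.1 ^ (q i.1 - 1)) (fun i => q i.1 / (q i.1 - 1))
        (fun i j hij => hQ fun h => hij (Subtype.ext h)) (fun i => Real.rpow_pos_of_pos (ht i.1) _)
        (fun i => (hmed i.1).conj hp1 (hq1 i.1))
        (fun i => i.2) (fun i => by rw [conj_rpow_self (ht i.1) (hq1 i.1)]; exact hvol i.1)
      simpa only [conj_rpow_self (ht _) (hq1 _)] using this
  refine ⟨min R1 R2, 1 + max K1 K2, lt_min hR1 hR2, by linarith [le_max_left K1 K2], ?_, ?_⟩
  · intro Q t q hcq hmed ht hv hbb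
    have := F2 Unit (fun _ => Q) (fun _ => t) (fun _ => q) (fun i j hij => (hij rfl).elim)
      (fun _ => ht) (fun _ => hcq) (fun _ => hmed) (fun _ => hv.le) (fun _ => hbb)
    simp only [hv, tsum_fintype, Finset.univ_unique, Finset.sum_const, Finset.card_singleton,
      one_smul] at this
    rw [ENNReal.one_le_ofReal] at this
    norm_num at this
  · intro ι _ Q t q hQ ht hcq hmed hvol hbb
    exact med_bound hpm h ι Q t q hQ ht hmed ((F2 ι Q t q hQ ht hcq hmed hvol hbb).trans
      (by rw [ENNReal.ofReal_le_one]; norm_num))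

/-! ### Estimates on a single level -/

lemma exists_t1 {n : ℕ} (Q : RCube n) {q : ℝ} (hq : 0 < q) :
    ∃ t1 : ℝ, 0 < t1 ∧ volume Q.toSet * ENNReal.ofReal (t1 ^ q) = 1 := by
  have h0 := volume_toSet_ne_zero Q
  have h1 := volume_toSet_ne_top Q
  have hv : 0 < (volume Q.toSet).toReal := ENNReal.toReal_pos h0 h1
  refine ⟨(volume Q.toSet).toReal ^ (-(1 / q)), by positivity, ?_⟩
  rw [← Real.rpow_mul hv.le]
  have e : -(1 / q) * q = -1 := by field_simp
  rw [e, Real.rpow_neg_one, ENNReal.ofReal_inv_of_pos hv, ENNReal.ofReal_toReal h1,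
    ENNReal.mul_inv_cancel h0 h1]

lemma le_t1_iff {n : ℕ} (Q : RCube n) {q t t1 : ℝ} (hq : 0 < q) (ht : 0 < t) (ht1 : 0 < t1)
    (h : volume Q.toSet * ENNReal.ofReal (t1 ^ q) = 1) :
    volume Q.toSet * ENNReal.ofReal (t ^ q) ≤ 1 ↔ t ≤ t1 := by
  rw [← h, ENNReal.mul_le_mul_iff_right (volume_toSet_ne_zero Q) (volume_toSet_ne_top Q),
    ENNReal.ofReal_le_ofReal_iff (by positivity), Real.rpow_le_rpow_iff ht.le ht1.le hq]

lemma level_norm {n : ℕ} {p : (Fin n → ℝ) → ℝ} (hpm : Measurable p) {c B : ℝ} (hc : 1 < c)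
    (hp : ∀ x, c ≤ p x) (hB : ∀ x, p x ≤ B) {R K ka : ℝ} (hR : 1 < R) (hK : 1 ≤ K) (hka : 0 < ka)
    (hka1 : ka ≤ 1) (hka2 : ka * (1 + K) ≤ 1 / 4) (Q : RCube n) {q t : ℝ} (hcq : c ≤ q)
    (ht : 0 < t)
    (hF1 : ∀ t1 : ℝ, 0 < t1 → volume Q.toSet * ENNReal.ofReal (t1 ^ q) = 1 → ¬ BB p R K Q t1 q)
    (g : (Fin n → ℝ) → ℝ≥0∞) (hg : Measurable g)
    (hgp : ∫⁻ x, g x ^ p x ≤ ENNReal.ofReal (ka ^ B / 4))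
    (htQ : ENNReal.ofReal t * volume Q.toSet ≤ ∫⁻ x in Q.toSet, g x) :
    volume Q.toSet * ENNReal.ofReal (t ^ q) ≤ 1 := by
  have hq0 : 0 < q := by linarith
  obtain ⟨t1, ht1, h1⟩ := exists_t1 Q hq0
  by_contra hcon
  rw [le_t1_iff Q hq0 ht ht1 h1] at hcon
  push Not at hcon
  have hnb := hF1 t1 ht1 h1
  unfold BB at hnb
  push Not at hnb
  have hR0 : 0 < R := by linarith
  have h1R : 0 ≤ 1 - 1 / R := by
    have : 1 / R ≤ 1 := by rw [div_le_one hR0]; exact hR.le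
    linarith
  have hy := young_cube hpm hc hp hB Q ht1 hR le_rfl (mul_nonneg (by linarith) h1R) hka hka1
    (by linarith) hnb.2 g hg
  simp only [sub_zero] at hy
  have l1 : 1 ≤ ENNReal.ofReal (t1 ^ (q - 1)) * (∫⁻ x in Q.toSet, g x) := by
    calc 1 = ENNReal.ofReal (t1 ^ (q - 1)) * (ENNReal.ofReal t1 * volume Q.toSet) := by
          rw [← h1, ← mul_assoc, ← ENNReal.ofReal_mul (by positivity), mul_comm]
          congr 2
          rw [Real.rpow_sub_one ht1.ne']; field_simp
      _ ≤ ENNReal.ofReal (t1 ^ (q - 1)) * (ENNReal.ofReal t * volume Q.toSet) := by gcongr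
      _ ≤ _ := by gcongr
  have l2 : ENNReal.ofReal (ka⁻¹ ^ B) * (∫⁻ x in Q.toSet, g x ^ p x) ≤ ENNReal.ofReal (1 / 4) := by
    calc _ ≤ ENNReal.ofReal (ka⁻¹ ^ B) * ENNReal.ofReal (ka ^ B / 4) := by
          gcongr; exact (setLIntegral_le_lintegral _ _).trans hgp
      _ = _ := by
          rw [← ENNReal.ofReal_mul (by positivity), Real.inv_rpow hka.le]
          congr 1
          have : ka ^ B ≠ 0 := (Real.rpow_pos_of_pos hka _).ne'
          field_simp
  have l3 : ENNReal.ofReal (ka * (1 + K) * t1 ^ q) * volume Q.toSet ≤ ENNReal.ofReal (1 / 4) := by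
    rw [ENNReal.ofReal_mul (by positivity), mul_assoc, mul_comm (ENNReal.ofReal (t1 ^ q)), h1, mul_one]
    exact ENNReal.ofReal_le_ofReal hka2
  have := (l1.trans hy).trans (add_le_add l2 l3)
  rw [← ENNReal.ofReal_add (by norm_num) (by norm_num), ENNReal.one_le_ofReal] at this
  norm_num at this

lemma dich_point {t t1 s y : ℝ} (ht : 0 < t) (ht1 : 0 < t1) (hs : 1 < s)
    (h : (1 ≤ t ∧ t ≤ t1) ∨ (t < 1 ∧ t1 < t ^ (1 / s))) :
    t ^ (s * y) ≤ 1 + t1 ^ (s * s * y) := by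
  have hs0 : 0 < s := by linarith
  have hpos : 0 < t1 ^ (s * s * y) := Real.rpow_pos_of_pos ht1 _
  rcases h with ⟨h1, h2⟩ | ⟨h1, h2⟩
  · rcases le_total 0 y with hy | hy
    · have a1 : t ^ (s * y) ≤ t1 ^ (s * y) := Real.rpow_le_rpow ht.le h2 (by positivity)
      exact a1.trans (rpow_le_one_add ht1 hs0.le (by nlinarith))
    · have := Real.rpow_le_one_of_one_le_of_nonpos h1 (mul_nonpos_of_nonneg_of_nonpos hs0.le hy)
      linarith
  · rcases le_total 0 y with hy | hy
    · have := Real.rpow_le_one ht.le h1.le (by positivity : 0 ≤ s * y)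
      linarith
    · have a1 : t1 ^ s ≤ t := by
        have := Real.rpow_le_rpow ht1.le h2.le hs0.le
        rwa [← Real.rpow_mul ht.le, one_div, inv_mul_cancel₀ hs0.ne', Real.rpow_one] at this
      have := Real.rpow_le_rpow_of_nonpos (Real.rpow_pos_of_pos ht1 s) a1
        (mul_nonpos_of_nonneg_of_nonpos hs0.le hy)
      rw [← Real.rpow_mul ht1.le, ← mul_assoc] at this
      linarith

lemma dichotomy {n : ℕ} {p : (Fin n → ℝ) → ℝ} {R K s : ℝ} (hs : 1 < s)
    (hsR : s * s = R) (hK : 1 ≤ K) (Q : RCube n) {q t : ℝ} (hq : 0 < q) (ht : 0 < t)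
    (hF1 : ∀ t1 : ℝ, 0 < t1 → volume Q.toSet * ENNReal.ofReal (t1 ^ q) = 1 → ¬ BB p R K Q t1 q)
    (hv : volume Q.toSet * ENNReal.ofReal (t ^ q) ≤ 1) :
    ((∫⁻ x in Q.toSet, ENNReal.ofReal (t ^ (p x - q)) ≤ ENNReal.ofReal (2 + K) * volume Q.toSet) ∧
      (∫⁻ x in Q.toSet, ENNReal.ofReal (t ^ (s * ((q - p x) / (p x - 1))))
        ≤ ENNReal.ofReal (1 + K) * volume Q.toSet)) ∨
    (t < 1 ∧ volume Q.toSet * ENNReal.ofReal ((t ^ (1 / s)) ^ q) ≤ 1 ∧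
      BB p R K Q (t ^ (1 / s)) q) := by
  obtain ⟨t1, ht1, h1⟩ := exists_t1 Q hq
  have hs0 : 0 < s := by linarith
  have htau : 0 < t ^ (1 / s) := Real.rpow_pos_of_pos ht _
  rw [le_t1_iff Q hq ht ht1 h1] at hv
  rw [le_t1_iff Q hq htau ht1 h1]
  have hnb := hF1 t1 ht1 h1
  by_cases hR : (t < 1 ∧ t ^ (1 / s) ≤ t1 ∧ BB p R K Q (t ^ (1 / s)) q)
  · exact Or.inr hR
  left
  have key : ∃ t2 : ℝ, 0 < t2 ∧ ¬ BB p R K Q t2 q ∧ ∀ y, t ^ (s * y) ≤ 1 + t2 ^ (R * y) := by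
    rcases le_or_gt 1 t with h | h
    · exact ⟨t1, ht1, hnb, fun y => by rw [← hsR]; exact dich_point ht ht1 hs (Or.inl ⟨h, hv⟩)⟩
    rcases lt_or_ge t1 (t ^ (1 / s)) with h' | h'
    · exact ⟨t1, ht1, hnb, fun y => by rw [← hsR]; exact dich_point ht ht1 hs (Or.inr ⟨h, h'⟩)⟩
    · refine ⟨t ^ (1 / s), htau, fun hb => hR ⟨h, h', hb⟩, fun y => ?_⟩
      have : (t ^ (1 / s)) ^ (R * y) = t ^ (s * y) := by
        rw [← Real.rpow_mul ht.le, ← hsR]; congr 1; field_simp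
      rw [this]; linarith
  obtain ⟨t2, ht2, hnb2, hpt⟩ := key
  unfold BB at hnb2
  push Not at hnb2
  have main : ∀ y : (Fin n → ℝ) → ℝ, 
      ∫⁻ x in Q.toSet, ENNReal.ofReal (t2 ^ (R * y x)) ≤ ENNReal.ofReal K * volume Q.toSet →
      ∫⁻ x in Q.toSet, ENNReal.ofReal (t ^ (s * y x)) ≤ ENNReal.ofReal (1 + K) * volume Q.toSet := by
    intro y hy
    calc ∫⁻ x in Q.toSet, ENNReal.ofReal (t ^ (s * y x))
        ≤ ∫⁻ x in Q.toSet, (1 + ENNReal.ofReal (t2 ^ (R * y x))) := by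
          apply lintegral_mono
          intro x
          simp only []
          rw [← ENNReal.ofReal_one, ← ENNReal.ofReal_add zero_le_one (by positivity)]
          exact ENNReal.ofReal_le_ofReal (hpt _)
      _ = volume Q.toSet + ∫⁻ x in Q.toSet, ENNReal.ofReal (t2 ^ (R * y x)) := by
          rw [lintegral_add_left measurable_const, setLIntegral_one]
      _ ≤ volume Q.toSet + ENNReal.ofReal K * volume Q.toSet := by gcongr
      _ = _ := by
          rw [ENNReal.ofReal_add zero_le_one (by linarith), ENNReal.ofReal_one, add_mul, one_mul]
  refine ⟨?_, main _ hnb2.2⟩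
  have := lower_exp Q (y := fun x => p x - q) ht zero_le_one hs.le (by linarith) (main _ hnb2.1)
  simp only [one_mul] at this
  rwa [← add_assoc, show (1 : ℝ) + 1 = 2 by norm_num] at this

/-- Truncation from below. -/
def trunc {n : ℕ} (g : (Fin n → ℝ) → ℝ≥0∞) (t : ℝ) : (Fin n → ℝ) → ℝ≥0∞ :=
  {x | ENNReal.ofReal (t / 2) < g x}.indicator g

lemma measurable_trunc {n : ℕ} {g : (Fin n → ℝ) → ℝ≥0∞} (hg : Measurable g) (t : ℝ) :
    Measurable (trunc g t) :=
  hg.indicator (measurableSet_lt measurable_const hg)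

lemma half_le_trunc {n : ℕ} (Q : RCube n) {g : (Fin n → ℝ) → ℝ≥0∞} (hg : Measurable g) {t : ℝ}
    (ht : 0 < t) (htQ : ENNReal.ofReal t * volume Q.toSet ≤ ∫⁻ x in Q.toSet, g x) :
    ENNReal.ofReal (t / 2) * volume Q.toSet ≤ ∫⁻ x in Q.toSet, trunc g t x := by
  have h1 : ∫⁻ x in Q.toSet, g x ≤ (∫⁻ x in Q.toSet, trunc g t x)
      + ENNReal.ofReal (t / 2) * volume Q.toSet := by
    calc ∫⁻ x in Q.toSet, g x ≤ ∫⁻ x in Q.toSet, (trunc g t x + ENNReal.ofReal (t / 2)) := by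
          apply lintegral_mono
          intro x
          simp only [trunc]
          by_cases hx : ENNReal.ofReal (t / 2) < g x
          · rw [indicator_of_mem (by exact hx)]; exact le_self_add
          · exact le_add_left (not_lt.1 hx)
      _ = _ := by
          rw [lintegral_add_left (measurable_trunc hg t), setLIntegral_const]
  have h2 := htQ.trans h1
  have e : ENNReal.ofReal t = ENNReal.ofReal (t / 2) + ENNReal.ofReal (t / 2) := by
    rw [← ENNReal.ofReal_add (by positivity) (by positivity)]; congr 1; ring
  rw [e, add_mul] at h2
  exact (ENNReal.add_le_add_iff_right (ENNReal.mul_ne_top ENNReal.ofReal_ne_top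
    (volume_toSet_ne_top Q))).1 h2

lemma good_cube {n : ℕ} {p : (Fin n → ℝ) → ℝ} (hpm : Measurable p) {c B : ℝ} (hc : 1 < c)
    (hp : ∀ x, c ≤ p x) (hB : ∀ x, p x ≤ B) {K s ka ep : ℝ} (hs : 1 < s) (hK : 1 ≤ K) (hka : 0 < ka)
    (hka1 : ka ≤ 1) (hka2 : ka * (2 + K) ≤ 1 / 4) (hep0 : 0 ≤ ep) (hep : ep ≤ (c - 1) * (1 - 1 / s))
    (Q : RCube n) {q t : ℝ} (ht : 0 < t) (g : (Fin n → ℝ) → ℝ≥0∞) (hg : Measurable g)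
    (htQ : ENNReal.ofReal t * volume Q.toSet ≤ ∫⁻ x in Q.toSet, g x)
    (h1 : ∫⁻ x in Q.toSet, ENNReal.ofReal (t ^ (p x - q)) ≤ ENNReal.ofReal (2 + K) * volume Q.toSet)
    (h2 : ∫⁻ x in Q.toSet, ENNReal.ofReal (t ^ (s * ((q - p x) / (p x - 1))))
        ≤ ENNReal.ofReal (1 + K) * volume Q.toSet) :
    md p t Q.toSet ≤ ENNReal.ofReal (4 * (2 + K) * ka⁻¹ ^ B * t ^ ep) *
      ∫⁻ x in Q.toSet, trunc g t x ^ (p x - ep) := by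
  have hy := young_cube hpm hc hp hB Q ht hs hep0 hep hka hka1 (by linarith) h2 (trunc g t)
    (measurable_trunc hg t)
  have l1 : ENNReal.ofReal (t ^ (q - ep) / 2) * volume Q.toSet ≤
      ENNReal.ofReal (t ^ (q - ep - 1)) * (∫⁻ x in Q.toSet, trunc g t x) := by
    calc _ = ENNReal.ofReal (t ^ (q - ep - 1)) * (ENNReal.ofReal (t / 2) * volume Q.toSet) := by
          rw [← mul_assoc, ← ENNReal.ofReal_mul (by positivity), Real.rpow_sub_one ht.ne']
          congr 2; field_simp
      _ ≤ _ := by gcongr; exact half_le_trunc Q hg ht htQ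
  have l2 : ENNReal.ofReal (ka * (1 + (1 + K)) * t ^ (q - ep)) * volume Q.toSet ≤
      ENNReal.ofReal (t ^ (q - ep) / 4) * volume Q.toSet := by
    gcongr
    have : 0 < t ^ (q - ep) := Real.rpow_pos_of_pos ht _
    nlinarith
  have l3 : ENNReal.ofReal (t ^ (q - ep) / 4) * volume Q.toSet ≤
      ENNReal.ofReal (ka⁻¹ ^ B) * (∫⁻ x in Q.toSet, trunc g t x ^ (p x - ep)) := by
    have h3 := (l1.trans hy).trans (add_le_add_right l2 _)
    have e : ENNReal.ofReal (t ^ (q - ep) / 2)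
        = ENNReal.ofReal (t ^ (q - ep) / 4) + ENNReal.ofReal (t ^ (q - ep) / 4) := by
      rw [← ENNReal.ofReal_add (by positivity) (by positivity)]; congr 1; ring
    rw [e, add_mul] at h3
    exact (ENNReal.add_le_add_iff_right (ENNReal.mul_ne_top ENNReal.ofReal_ne_top
      (volume_toSet_ne_top Q))).1 h3
  calc md p t Q.toSet = ENNReal.ofReal (t ^ q) * ∫⁻ x in Q.toSet, ENNReal.ofReal (t ^ (p x - q)) := by
        rw [md, ← lintegral_const_mul' _ _ ENNReal.ofReal_ne_top]
        congr 1; ext x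
        rw [← ENNReal.ofReal_mul (by positivity), ← Real.rpow_add ht]; congr 2; ring
    _ ≤ ENNReal.ofReal (t ^ q) * (ENNReal.ofReal (2 + K) * volume Q.toSet) := by gcongr
    _ = ENNReal.ofReal (4 * (2 + K) * t ^ ep) * (ENNReal.ofReal (t ^ (q - ep) / 4) * volume Q.toSet) := by
        rw [← mul_assoc, ← mul_assoc, ← ENNReal.ofReal_mul (by positivity),
          ← ENNReal.ofReal_mul (by positivity), Real.rpow_sub ht]
        have : t ^ ep ≠ 0 := (Real.rpow_pos_of_pos ht _).ne'
        congr 2; field_simp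
    _ ≤ ENNReal.ofReal (4 * (2 + K) * t ^ ep) * (ENNReal.ofReal (ka⁻¹ ^ B) *
          (∫⁻ x in Q.toSet, trunc g t x ^ (p x - ep))) := by gcongr
    _ = _ := by
        rw [← mul_assoc, ← ENNReal.ofReal_mul (by positivity)]; congr 2; ring

lemma bad_cube {n : ℕ} {p : (Fin n → ℝ) → ℝ} (hp : ∀ x, 1 ≤ p x) {s t : ℝ} (hs : 1 < s) (ht : 0 < t)
    (ht1 : t < 1) (S : Set (Fin n → ℝ)) :
    md p t S ≤ ENNReal.ofReal (t ^ (1 - 1 / s)) * md p (t ^ (1 / s)) S := by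
  rw [md, md, ← lintegral_const_mul' _ _ ENNReal.ofReal_ne_top]
  apply lintegral_mono
  intro x
  simp only []
  rw [← ENNReal.ofReal_mul (by positivity)]
  apply ENNReal.ofReal_le_ofReal
  rw [← Real.rpow_mul ht.le, ← Real.rpow_add ht]
  apply Real.rpow_le_rpow_of_exponent_ge ht ht1.le
  have h1 : 0 ≤ 1 - 1 / s := by
    have : 1 / s ≤ 1 := by rw [div_le_one (by linarith)]; exact hs.le
    linarith
  nlinarith [hp x]

theorem level_lemma {n : ℕ} {p : (Fin n → ℝ) → ℝ} (hpm : Measurable p) {c B : ℝ} (hc : 1 < c)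
    (hp : ∀ x, c ≤ p x) (hB : ∀ x, p x ≤ B) {C C2 : ℝ} (hC : 1 ≤ C) (h : AIm p (1 / 2) C)
    (hC2 : 1 ≤ C2) (h2 : AIm (fun x => p x / (p x - 1)) (1 / 2) C2) :
    ∃ c0 A ep de : ℝ, 0 < c0 ∧ 0 < A ∧ 0 < ep ∧ ep < c ∧ 0 < de ∧
      ∀ g : (Fin n → ℝ) → ℝ≥0∞, Measurable g → ∫⁻ x, g x ^ p x ≤ ENNReal.ofReal c0 →
        ∀ t : ℝ, 0 < t →
        (∀ Q : RCube n, ENNReal.ofReal t * volume Q.toSet ≤ (∫⁻ x in Q.toSet, g x) →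
          volume Q.toSet ≤ ENNReal.ofReal ((max 1 t⁻¹) ^ B)) ∧
        ∀ (ι : Type) [Countable ι] (Q : ι → RCube n),
          (Pairwise fun i j => Disjoint (Q i).toSet (Q j).toSet) →
          (∀ i, ENNReal.ofReal t * volume (Q i).toSet ≤ ∫⁻ x in (Q i).toSet, g x) →
          ∑' i, md p t (Q i).toSet ≤
            ENNReal.ofReal (A * t ^ ep) * (∫⁻ x, trunc g t x ^ (p x - ep)) +
            (if t < 1 then ENNReal.ofReal (C * t ^ de) else 0) := by
  obtain ⟨R, K, hR, hK, F1, F2⟩ := bb_lemma hpm hc hp hB hC h hC2 h2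
  set s := √R with hsdef
  have hsR : s * s = R := Real.mul_self_sqrt (by linarith)
  have hs : 1 < s := by rw [hsdef, Real.lt_sqrt (by norm_num)]; simpa using hR
  have hs0 : 0 < s := by linarith
  have h1s : 0 < 1 - 1 / s := by
    have : 1 / s < 1 := by rw [div_lt_one hs0]; exact hs
    linarith
  have hs1 : 0 < 1 / s := by positivity
  set ka := 1 / (4 * (2 + K)) with hkadef
  have hka : 0 < ka := by positivity
  have hka2 : ka * (2 + K) = 1 / 4 := by rw [hkadef]; field_simp
  have hka1 : ka ≤ 1 := by nlinarith
  set ep := (c - 1) * (1 - 1 / s) with hepdef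
  have hep0 : 0 < ep := mul_pos (by linarith) h1s
  refine ⟨ka ^ B / 4, 4 * (2 + K) * ka⁻¹ ^ B, ep, 1 - 1 / s, by positivity, by positivity, hep0,
    by nlinarith, h1s, ?_⟩
  intro g hg hgp t ht
  choose q hcq hqB hmed using fun Q : RCube n => exists_median hpm hp hB Q
  have hvol : ∀ Q : RCube n, ENNReal.ofReal t * volume Q.toSet ≤ (∫⁻ x in Q.toSet, g x) →
      volume Q.toSet * ENNReal.ofReal (t ^ q Q) ≤ 1 := by
    intro Q hQ
    exact level_norm hpm hc hp hB hR hK hka hka1 (by nlinarith) Q (hcq Q) ht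
      (fun t1 ht1 hv => F1 Q t1 (q Q) (hcq Q) (hmed Q) ht1 hv) g hg hgp hQ
  refine ⟨fun Q hQ => ?_, ?_⟩
  · have h3 := hvol Q hQ
    have hq0 : 0 < q Q := by linarith [hcq Q]
    have h4 : volume Q.toSet ≤ ENNReal.ofReal (t⁻¹ ^ q Q) := by
      calc volume Q.toSet = volume Q.toSet * ENNReal.ofReal (t ^ q Q) * ENNReal.ofReal (t⁻¹ ^ q Q) := by
            rw [mul_assoc, ← ENNReal.ofReal_mul (by positivity),
              ← Real.mul_rpow ht.le (by positivity), mul_inv_cancel₀ ht.ne', Real.one_rpow,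
              ENNReal.ofReal_one, mul_one]
        _ ≤ 1 * ENNReal.ofReal (t⁻¹ ^ q Q) := by gcongr
        _ = _ := one_mul _
    refine h4.trans (ENNReal.ofReal_le_ofReal ?_)
    calc t⁻¹ ^ q Q ≤ (max 1 t⁻¹) ^ q Q := by gcongr; exact le_max_right _ _
      _ ≤ _ := Real.rpow_le_rpow_of_exponent_le (le_max_left _ _) (hqB Q)
  · intro ι _ Q hQ htQ
    refine (tsum_split _ (fun i => 
      (∫⁻ x in (Q i).toSet, ENNReal.ofReal (t ^ (p x - q (Q i)))
        ≤ ENNReal.ofReal (2 + K) * volume (Q i).toSet) ∧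
      (∫⁻ x in (Q i).toSet, ENNReal.ofReal (t ^ (s * ((q (Q i) - p x) / (p x - 1))))
        ≤ ENNReal.ofReal (1 + K) * volume (Q i).toSet))
      (fun i => t < 1 ∧ volume (Q i).toSet * ENNReal.ofReal ((t ^ (1 / s)) ^ q (Q i)) ≤ 1 ∧
        BB p R K (Q i) (t ^ (1 / s)) (q (Q i)))
      (fun i => dichotomy hs hsR hK (Q i) (by linarith [hcq (Q i)]) ht
        (fun t1 ht1 hv => F1 (Q i) t1 _ (hcq _) (hmed _) ht1 hv) (hvol _ (htQ i)))).trans ?_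
    refine add_le_add ?_ ?_
    · refine le_trans (ENNReal.tsum_le_tsum fun i => by
        exact good_cube hpm hc hp hB hs hK hka hka1 hka2.le hep0.le le_rfl
          (Q i.1) ht g hg (htQ i.1) i.2.1 i.2.2) ?_
      rw [ENNReal.tsum_mul_left]
      gcongr
      rw [← lintegral_iUnion (fun i => measurableSet_toSet _)
        (fun i j hij => hQ fun h => hij (Subtype.ext h))]
      exact setLIntegral_le_lintegral _ _
    · split_ifs with ht1
      · refine le_trans (ENNReal.tsum_le_tsum fun i => by
          exact bad_cube (fun x => hc.le.trans (hp x)) hs ht ht1 _) ?_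
        rw [ENNReal.tsum_mul_left, mul_comm C, ENNReal.ofReal_mul (by positivity)]
        gcongr
        exact F2 {i // t < 1 ∧ volume (Q i).toSet * ENNReal.ofReal ((t ^ (1 / s)) ^ q (Q i)) ≤ 1 ∧
          BB p R K (Q i) (t ^ (1 / s)) (q (Q i))} (fun i => Q i.1) (fun _ => t ^ (1 / s))
          (fun i => q (Q i.1)) (fun i j hij => hQ fun h => hij (Subtype.ext h))
          (fun _ => Real.rpow_pos_of_pos ht _) (fun i => hcq _) (fun i => hmed _)
          (fun i => i.2.2.1) (fun i => i.2.2.2)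
      · simp [ht1]

/-! ### Covering the level sets and summing over the levels -/

lemma big_cube {n : ℕ} (Q : RCube n) {x : Fin n → ℝ} (hx : x ∈ Q.toSet) :
    Q.toSet ⊆ (cubeOf x Q.side Q.side_pos).toSet ∧
      volume (cubeOf x Q.side Q.side_pos).toSet = ENNReal.ofReal (2 ^ n) * volume Q.toSet := by
  constructor
  · rw [cubeOf_toSet]
    rw [toSet_eq_closedBall] at hx ⊢
    apply Metric.closedBall_subset_closedBall'
    have h1 := Metric.mem_closedBall'.1 hx
    linarith
  · rw [volume_toSet, volume_toSet, ← ENNReal.ofReal_mul (by positivity), ← mul_pow]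
    rfl

lemma level_cover {n : ℕ} (hn : 0 < n) : ∃ N : ℕ, ∀ (f : (Fin n → ℝ) → ℝ) (t V : ℝ), 0 < t → 1 ≤ V →
    (∀ Q : RCube n, ENNReal.ofReal t * volume Q.toSet ≤ (∫⁻ x in Q.toSet, ENNReal.ofReal |f x|) →
      volume Q.toSet ≤ ENNReal.ofReal V) →
    ∃ s : Fin N → Set (RCube n),
      (∀ a, (s a).PairwiseDisjoint RCube.toSet) ∧
      (∀ a, ∀ Q ∈ s a, ENNReal.ofReal t * volume Q.toSet ≤ ∫⁻ x in Q.toSet, ENNReal.ofReal |f x|) ∧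
      ∀ x, ENNReal.ofReal (2 ^ n) * ENNReal.ofReal t < hlMaximal f x → ∃ a, ∃ Q ∈ s a, x ∈ Q.toSet := by
  obtain ⟨N, τ, hτ, hN⟩ := HasBesicovitchCovering.no_satelliteConfig (α := Fin n → ℝ)
  refine ⟨N, ?_⟩
  intro f t V ht hV hvol
  have hex : ∀ x : {x // ENNReal.ofReal (2 ^ n) * ENNReal.ofReal t < hlMaximal f x},
      ∃ r : ℝ, ∃ hr : 0 < r, ENNReal.ofReal t * volume (cubeOf x.1 r hr).toSet
        ≤ ∫⁻ y in (cubeOf x.1 r hr).toSet, ENNReal.ofReal |f y| := by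
    rintro ⟨x, hx⟩
    unfold hlMaximal at hx
    simp only [lt_iSup_iff] at hx
    obtain ⟨Q, hQ, hlt⟩ := hx
    obtain ⟨hsub, hv⟩ := big_cube Q hQ
    refine ⟨Q.side, Q.side_pos, ?_⟩
    rw [hv]
    rw [ENNReal.lt_div_iff_mul_lt (Or.inl (volume_toSet_ne_zero Q)) (Or.inl (volume_toSet_ne_top Q))] at hlt
    calc _ = ENNReal.ofReal (2 ^ n) * ENNReal.ofReal t * volume Q.toSet := by ring
      _ ≤ _ := hlt.le
      _ ≤ _ := lintegral_mono_set hsub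
  choose r hr hint using hex
  have hrV : ∀ x, r x ≤ V := by
    intro x
    have h1 := hvol _ (hint x)
    rw [volume_toSet, ENNReal.ofReal_le_ofReal_iff (by linarith)] at h1
    have h2 : (cubeOf x.1 (r x) (hr x)).side = 2 * r x := rfl
    rw [h2] at h1
    by_contra hlt
    push Not at hlt
    have h3 : 1 ≤ 2 * r x := by linarith
    have h4 : 2 * r x ≤ (2 * r x) ^ n := le_self_pow₀ h3 hn.ne'
    linarith
  let P : Besicovitch.BallPackage {x // ENNReal.ofReal (2 ^ n) * ENNReal.ofReal t < hlMaximal f x}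
      (Fin n → ℝ) := ⟨fun x => x.1, r, hr, V, hrV⟩
  obtain ⟨s, hs1, hs2⟩ := Besicovitch.exist_disjoint_covering_families hτ hN P
  refine ⟨fun a => (fun x => cubeOf x.1 (r x) (hr x)) '' s a, ?_, ?_, ?_⟩
  · rintro a _ ⟨x, hx, rfl⟩ _ ⟨y, hy, rfl⟩ hne
    have hxy : x ≠ y := by rintro rfl; exact hne rfl
    have := hs1 a hx hy hxy
    simp only [Function.onFun, cubeOf_toSet] at this ⊢
    exact this
  · rintro a _ ⟨x, hx, rfl⟩
    exact hint x
  · intro x hx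
    have hm := hs2 (mem_range_self (f := P.c) ⟨x, hx⟩)
    simp only [mem_iUnion] at hm
    obtain ⟨a, y, hy, hb⟩ := hm
    refine ⟨a, _, ⟨y, hy, rfl⟩, ?_⟩
    rw [cubeOf_toSet]
    exact Metric.ball_subset_closedBall hb

lemma geo_sum {e : ℝ} (he : 0 < e) : ∃ S : ℝ≥0∞, S ≠ ∞ ∧ ∀ m : ℤ,
    ∑' k : ℤ, (if k ≤ m then ENNReal.ofReal (((2 : ℝ) ^ k) ^ e) else 0)
      = S * ENNReal.ofReal (((2 : ℝ) ^ m) ^ e) := by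
  have hr : ENNReal.ofReal ((2 : ℝ) ^ (-e)) < 1 := by
    rw [ENNReal.ofReal_lt_one]
    exact Real.rpow_lt_one_of_one_lt_of_neg (by norm_num) (by linarith)
  refine ⟨∑' j : ℕ, ENNReal.ofReal ((2 : ℝ) ^ (-e)) ^ j, ?_, ?_⟩
  · rw [ENNReal.tsum_geometric]
    exact ENNReal.inv_ne_top.2 (tsub_pos_of_lt hr).ne'
  · intro m
    have hinj : Function.Injective fun j : ℕ => m - (j : ℤ) := by
      intro a b hab
      simp only at hab
      omega
    rw [← hinj.tsum_eq, ← ENNReal.tsum_mul_right]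
    · congr 1
      ext j
      rw [if_pos (by omega), ← ENNReal.ofReal_pow (by positivity), ← ENNReal.ofReal_mul (by positivity)]
      congr 1
      rw [← Real.rpow_natCast, ← Real.rpow_mul (by norm_num), ← Real.rpow_intCast, ← Real.rpow_intCast,
        ← Real.rpow_mul (by norm_num), ← Real.rpow_mul (by norm_num), ← Real.rpow_add (by norm_num)]
      congr 1
      push_cast; ring
    · intro k hk
      simp only [Function.mem_support, ne_eq, ite_eq_right_iff, not_forall] at hk
      obtain ⟨hk, -⟩ := hk
      exact ⟨(m - k).toNat, by simp only; omega⟩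

lemma trunc_sum {n : ℕ} {p : (Fin n → ℝ) → ℝ} {c ep : ℝ} (hp : ∀ x, c ≤ p x) (hep : 0 < ep)
    (hepc : ep < c) : ∃ S : ℝ≥0∞, S ≠ ∞ ∧ ∀ (f : (Fin n → ℝ) → ℝ) (x : Fin n → ℝ),
    ∑' k : ℤ, ENNReal.ofReal (((2 : ℝ) ^ k) ^ ep) *
      trunc (fun x => ENNReal.ofReal |f x|) ((2 : ℝ) ^ k) x ^ (p x - ep)
      ≤ S * ENNReal.ofReal |f x| ^ p x := by
  obtain ⟨S, hS, hgeo⟩ := geo_sum hep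
  refine ⟨S * ENNReal.ofReal (2 ^ ep), ENNReal.mul_ne_top hS ENNReal.ofReal_ne_top, ?_⟩
  intro f x
  have hpe : 0 < p x - ep := by linarith [hp x]
  rcases (abs_nonneg (f x)).eq_or_lt with h0 | h0
  · have : ∀ k : ℤ, trunc (fun x => ENNReal.ofReal |f x|) ((2 : ℝ) ^ k) x = 0 := by
      intro k
      have : x ∉ {x | ENNReal.ofReal ((2 : ℝ) ^ k / 2) < ENNReal.ofReal |f x|} := by
        simp [← h0]
      rw [trunc, indicator_of_notMem this]
    simp only [this, ENNReal.zero_rpow_of_pos hpe, mul_zero, tsum_zero]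
    exact zero_le
  · obtain ⟨m, hm1, hm2⟩ := exists_mem_Ico_zpow (x := 2 * |f x|) (y := (2 : ℝ)) (by positivity) (by norm_num)
    have hterm : ∀ k : ℤ, ENNReal.ofReal (((2 : ℝ) ^ k) ^ ep) *
        trunc (fun x => ENNReal.ofReal |f x|) ((2 : ℝ) ^ k) x ^ (p x - ep) ≤
        (if k ≤ m then ENNReal.ofReal (((2 : ℝ) ^ k) ^ ep) else 0) * ENNReal.ofReal |f x| ^ (p x - ep) := by
      intro k
      by_cases hx : ENNReal.ofReal ((2 : ℝ) ^ k / 2) < ENNReal.ofReal |f x|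
      · have hk : k ≤ m := by
          rw [ENNReal.ofReal_lt_ofReal_iff h0] at hx
          have : (2 : ℝ) ^ k < 2 ^ (m + 1) := by linarith
          rw [zpow_lt_zpow_iff_right₀ (by norm_num)] at this
          omega
        rw [if_pos hk, trunc, indicator_of_mem (by exact hx)]
      · rw [trunc, indicator_of_notMem (by exact hx), ENNReal.zero_rpow_of_pos hpe, mul_zero]
        exact zero_le
    refine (ENNReal.tsum_le_tsum hterm).trans ?_
    rw [ENNReal.tsum_mul_right, hgeo, mul_assoc, mul_assoc]
    refine mul_le_mul_right ?_ S
    calc _ ≤ ENNReal.ofReal ((2 * |f x|) ^ ep) * ENNReal.ofReal |f x| ^ (p x - ep) := by gcongr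
      _ = ENNReal.ofReal (2 ^ ep) * ENNReal.ofReal |f x| ^ p x := by
        rw [ENNReal.ofReal_rpow_of_pos h0, ENNReal.ofReal_rpow_of_pos h0,
          ← ENNReal.ofReal_mul (by positivity), ← ENNReal.ofReal_mul (by positivity),
          Real.mul_rpow (by norm_num) h0.le, mul_assoc, ← Real.rpow_add h0]
        congr 3; ring

theorem modular_bound {n : ℕ} (hn : 0 < n) {p : (Fin n → ℝ) → ℝ} (hpm : Measurable p) {c B : ℝ}
    (hc : 1 < c) (hp : ∀ x, c ≤ p x) (hB : ∀ x, p x ≤ B) {C C2 : ℝ} (hC : 1 ≤ C)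
    (h : AIm p (1 / 2) C) (hC2 : 1 ≤ C2) (h2 : AIm (fun x => p x / (p x - 1)) (1 / 2) C2) :
    ∃ c0 : ℝ, 0 < c0 ∧ ∃ D : ℝ≥0∞, D ≠ ∞ ∧ ∀ f : (Fin n → ℝ) → ℝ, Measurable f →
      ∫⁻ x, ENNReal.ofReal |f x| ^ p x ≤ ENNReal.ofReal c0 →
      ∫⁻ x, hlMaximal f x ^ p x ≤ D := by
  obtain ⟨c0, A, ep, de, hc0, hA, hep, hepc, hde, hlev⟩ := level_lemma hpm hc hp hB hC h hC2 h2
  obtain ⟨N, hcov⟩ := level_cover hn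
  obtain ⟨S1, hS1, htr⟩ := trunc_sum hp hep hepc
  obtain ⟨S2, hS2, hgeo⟩ := geo_sum hde
  have hB1 : 1 ≤ B := hc.le.trans ((hp 0).trans (hB 0))
  have hp0 : ∀ x, 0 < p x := fun x => by linarith [hp x]
  refine ⟨c0, hc0, ENNReal.ofReal ((2 ^ (n + 1)) ^ B) * (N * (ENNReal.ofReal A * (S1 * ENNReal.ofReal c0) +
    ENNReal.ofReal C * (S2 * ENNReal.ofReal (((2 : ℝ) ^ (-1 : ℤ)) ^ de)))), ?_, ?_⟩
  · refine ENNReal.mul_ne_top ENNReal.ofReal_ne_top (ENNReal.mul_ne_top (ENNReal.natCast_ne_top N)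
      (ENNReal.add_ne_top.2 ⟨ENNReal.mul_ne_top ENNReal.ofReal_ne_top (ENNReal.mul_ne_top hS1 ENNReal.ofReal_ne_top),
        ENNReal.mul_ne_top ENNReal.ofReal_ne_top (ENNReal.mul_ne_top hS2 ENNReal.ofReal_ne_top)⟩))
  intro f hf hfp
  set g : (Fin n → ℝ) → ℝ≥0∞ := fun x => ENNReal.ofReal |f x| with hgdef
  have hg : Measurable g := ENNReal.measurable_ofReal.comp (continuous_abs.measurable.comp hf)
  have h2k : ∀ k : ℤ, (0 : ℝ) < 2 ^ k := fun k => by positivity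
  have hL := fun k : ℤ => hlev g hg hfp (2 ^ k) (h2k k)
  have hcv := fun k : ℤ => hcov f (2 ^ k) _ (h2k k)
    (Real.one_le_rpow (le_max_left _ _) (by linarith)) (hL k).1
  choose s hs1 hs2 hs3 using hcv
  have hcount : ∀ k a, (s k a).Countable := fun k a =>
    countable_of_disjoint_cubes (s k a) (fun Q => Q) (hs1 k a)
  have : ∀ k a, Countable (s k a) := fun k a => (hcount k a).to_subtype
  have hmW : ∀ (k : ℤ), Measurable fun x => ENNReal.ofReal (((2 : ℝ) ^ k) ^ p x) := fun k =>
    ENNReal.measurable_ofReal.comp (measurable_const.pow hpm)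
  set W : ℤ → (Fin n → ℝ) → ℝ≥0∞ := fun k x => ∑ a, ∑' Q : s k a,
    Q.1.toSet.indicator (fun x => ENNReal.ofReal (((2 : ℝ) ^ k) ^ p x)) x with hW
  have hWm : ∀ k, Measurable (W k) := fun k =>
    Finset.measurable_fun_sum _ fun a _ => Measurable.tsum fun Q =>
      (hmW k).indicator (measurableSet_toSet _)
  have hWint : ∀ k, ∫⁻ x, W k x ≤ N * (ENNReal.ofReal (A * ((2 : ℝ) ^ k) ^ ep) *
      (∫⁻ x, trunc g (2 ^ k) x ^ (p x - ep)) +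
      (if (2 : ℝ) ^ k < 1 then ENNReal.ofReal (C * ((2 : ℝ) ^ k) ^ de) else 0)) := by
    intro k
    simp only [hW]
    rw [lintegral_finsetSum _ fun a _ => Measurable.tsum fun Q =>
      (hmW k).indicator (measurableSet_toSet _)]
    refine (Finset.sum_le_card_nsmul _ _ (ENNReal.ofReal (A * ((2 : ℝ) ^ k) ^ ep) *
        (∫⁻ x, trunc g (2 ^ k) x ^ (p x - ep)) +
        (if (2 : ℝ) ^ k < 1 then ENNReal.ofReal (C * ((2 : ℝ) ^ k) ^ de) else 0))
        fun a _ => ?_).trans (le_of_eq ?_)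
    · rw [lintegral_tsum fun Q => ((hmW k).indicator (measurableSet_toSet _)).aemeasurable]
      have := (hL k).2 (s k a) (fun Q => Q.1)
        (fun Q Q' hne => hs1 k a Q.2 Q'.2 fun h => hne (Subtype.ext h)) (fun Q => hs2 k a Q.1 Q.2)
      refine le_trans (ENNReal.tsum_le_tsum fun Q => ?_) this
      rw [lintegral_indicator (measurableSet_toSet _)]
      exact le_rfl
    · rw [Finset.card_univ, Fintype.card_fin, nsmul_eq_mul]
  have hWge : ∀ k x, ENNReal.ofReal (2 ^ n) * ENNReal.ofReal (2 ^ k) < hlMaximal f x →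
      ENNReal.ofReal (((2 : ℝ) ^ k) ^ p x) ≤ W k x := by
    intro k x hx
    obtain ⟨a, Q, hQ, hxQ⟩ := hs3 k x hx
    calc ENNReal.ofReal (((2 : ℝ) ^ k) ^ p x)
        = Q.toSet.indicator (fun x => ENNReal.ofReal (((2 : ℝ) ^ k) ^ p x)) x := by
          rw [indicator_of_mem hxQ]
      _ ≤ ∑' Q : s k a, Q.1.toSet.indicator (fun x => ENNReal.ofReal (((2 : ℝ) ^ k) ^ p x)) x :=
          ENNReal.le_tsum (f := fun Q : s k a =>
            Q.1.toSet.indicator (fun x => ENNReal.ofReal (((2 : ℝ) ^ k) ^ p x)) x) ⟨Q, hQ⟩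
      _ ≤ W k x := Finset.single_le_sum (f := fun a => ∑' Q : s k a,
            Q.1.toSet.indicator (fun x => ENNReal.ofReal (((2 : ℝ) ^ k) ^ p x)) x)
            (fun _ _ => zero_le) (Finset.mem_univ a)
  have h2n : ENNReal.ofReal (2 ^ n) ≠ 0 := by
    rw [ne_eq, ENNReal.ofReal_eq_zero, not_le]; positivity
  have hpt : ∀ x, hlMaximal f x ^ p x ≤ ENNReal.ofReal ((2 ^ (n + 1)) ^ B) * ∑' k, W k x := by
    intro x
    by_cases h0 : hlMaximal f x = 0
    · rw [h0, ENNReal.zero_rpow_of_pos (hp0 x)]; exact zero_le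
    by_cases htop : hlMaximal f x = ∞
    · have hsum : ∑' k, W k x = ∞ := by
        rw [eq_top_iff]
        calc ∞ = ∑' _ : ℕ, (1 : ℝ≥0∞) := (ENNReal.tsum_const_eq_top_of_ne_zero one_ne_zero).symm
          _ ≤ ∑' j : ℕ, W (j : ℤ) x := by
              refine ENNReal.tsum_le_tsum fun j => ?_
              refine le_trans ?_ (hWge j x ?_)
              · rw [ENNReal.one_le_ofReal]
                refine Real.one_le_rpow ?_ (hp0 x).le
                exact one_le_zpow₀ (by norm_num) (by omega)
              · rw [htop]
                exact ENNReal.mul_lt_top ENNReal.ofReal_lt_top ENNReal.ofReal_lt_top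
          _ ≤ _ := ENNReal.tsum_comp_le_tsum_of_injective Nat.cast_injective (fun k : ℤ => W k x)
      rw [hsum, ENNReal.mul_top]
      · exact le_top
      · rw [ne_eq, ENNReal.ofReal_eq_zero, not_le]; positivity
    · obtain ⟨k, hk1, hk2⟩ := ENNReal.exists_mem_Ioc_zpow
        (x := hlMaximal f x / ENNReal.ofReal (2 ^ n)) (y := 2)
        (ENNReal.div_ne_zero.2 ⟨h0, ENNReal.ofReal_ne_top⟩)
        (ENNReal.div_ne_top htop h2n) (by norm_num) (by norm_num)
      have e2 : ∀ k : ℤ, (2 : ℝ≥0∞) ^ k = ENNReal.ofReal (2 ^ k) := by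
        intro k
        rw [← ENNReal.rpow_intCast, ← Real.rpow_intCast, ← ENNReal.ofReal_rpow_of_pos (by norm_num),
          ENNReal.ofReal_ofNat]
      rw [e2, ENNReal.lt_div_iff_mul_lt (Or.inl h2n) (Or.inl ENNReal.ofReal_ne_top), mul_comm] at hk1
      rw [e2, ENNReal.div_le_iff h2n ENNReal.ofReal_ne_top, ← ENNReal.ofReal_mul (by positivity)] at hk2
      calc hlMaximal f x ^ p x ≤ ENNReal.ofReal (2 ^ (k + 1) * 2 ^ n) ^ p x := by
            gcongr; exact (hp0 x).le
        _ = ENNReal.ofReal ((2 ^ (n + 1)) ^ p x) * ENNReal.ofReal (((2 : ℝ) ^ k) ^ p x) := by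
            rw [ENNReal.ofReal_rpow_of_pos (by positivity), ← ENNReal.ofReal_mul (by positivity),
              ← Real.mul_rpow (by positivity) (by positivity)]
            congr 2
            rw [zpow_add_one₀ (by norm_num), pow_succ]; ring
        _ ≤ ENNReal.ofReal ((2 ^ (n + 1)) ^ B) * W k x := by
            gcongr
            · exact one_le_pow₀ (by norm_num)
            · exact hB x
            · exact hWge k x hk1
        _ ≤ _ := by
            gcongr
            exact ENNReal.le_tsum (f := fun k => W k x) k
  calc ∫⁻ x, hlMaximal f x ^ p x ≤ ∫⁻ x, ENNReal.ofReal ((2 ^ (n + 1)) ^ B) * ∑' k, W k x :=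
        lintegral_mono hpt
    _ = ENNReal.ofReal ((2 ^ (n + 1)) ^ B) * ∑' k, ∫⁻ x, W k x := by
        rw [lintegral_const_mul' _ _ ENNReal.ofReal_ne_top, lintegral_tsum fun k => (hWm k).aemeasurable]
    _ ≤ _ := by
        gcongr
        refine (ENNReal.tsum_le_tsum hWint).trans ?_
        rw [ENNReal.tsum_mul_left, ENNReal.tsum_add]
        gcongr
        · calc ∑' k : ℤ, ENNReal.ofReal (A * ((2 : ℝ) ^ k) ^ ep) * (∫⁻ x, trunc g (2 ^ k) x ^ (p x - ep))
              = ∑' k : ℤ, ENNReal.ofReal A * ∫⁻ x, ENNReal.ofReal (((2 : ℝ) ^ k) ^ ep) *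
                  trunc g (2 ^ k) x ^ (p x - ep) := by
                congr 1; ext k
                rw [lintegral_const_mul' _ _ ENNReal.ofReal_ne_top, ENNReal.ofReal_mul hA.le, mul_assoc]
            _ = ENNReal.ofReal A * ∫⁻ x, ∑' k : ℤ, ENNReal.ofReal (((2 : ℝ) ^ k) ^ ep) *
                  trunc g (2 ^ k) x ^ (p x - ep) := by
                have hmm : ∀ k : ℤ, Measurable fun x => ENNReal.ofReal (((2 : ℝ) ^ k) ^ ep) *
                    trunc g (2 ^ k) x ^ (p x - ep) := fun k =>
                  ((measurable_trunc hg _).pow (hpm.sub measurable_const)).const_mul _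
                rw [ENNReal.tsum_mul_left, lintegral_tsum fun k => (hmm k).aemeasurable]
            _ ≤ ENNReal.ofReal A * ∫⁻ x, S1 * g x ^ p x := by
                gcongr with x
                exact htr f x
            _ ≤ _ := by
                rw [lintegral_const_mul' _ _ hS1]
                gcongr
        · calc ∑' k : ℤ, (if (2 : ℝ) ^ k < 1 then ENNReal.ofReal (C * ((2 : ℝ) ^ k) ^ de) else 0)
              = ∑' k : ℤ, ENNReal.ofReal C * 
                (if k ≤ -1 then ENNReal.ofReal (((2 : ℝ) ^ k) ^ de) else 0) := by
                congr 1; ext k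
                have : (2 : ℝ) ^ k < 1 ↔ k ≤ -1 := by
                  rw [zpow_lt_one_iff_right₀ (by norm_num)]; omega
                simp only [this]
                split_ifs
                · rw [ENNReal.ofReal_mul (by linarith)]
                · simp
            _ = _ := by rw [ENNReal.tsum_mul_left, hgeo]
            _ ≤ _ := le_rfl

/-! ### Boundedness of the maximal operator -/

lemma hlMaximal_const_mul {n : ℕ} (f : (Fin n → ℝ) → ℝ) {a : ℝ} (ha : 0 ≤ a) (x : Fin n → ℝ) :
    hlMaximal (fun y => a * f y) x = ENNReal.ofReal a * hlMaximal f x := by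
  unfold hlMaximal
  simp only [ENNReal.mul_iSup]
  congr 1; ext Q; congr 1; ext hQ
  simp only [abs_mul, abs_of_nonneg ha, ENNReal.ofReal_mul ha]
  rw [lintegral_const_mul' _ _ ENNReal.ofReal_ne_top, mul_div_assoc]

lemma hlMaximal_zero_dim (f : (Fin 0 → ℝ) → ℝ) (x : Fin 0 → ℝ) : hlMaximal f x = ofR f x := by
  have h1 : ∀ Q : RCube 0, (∫⁻ y in Q.toSet, ENNReal.ofReal |f y|) / volume Q.toSet
      = ENNReal.ofReal |f x| := by
    intro Q
    have : ∀ y, ENNReal.ofReal |f y| = ENNReal.ofReal |f x| := fun y => by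
      rw [Subsingleton.elim y x]
    simp only [this]
    rw [setLIntegral_const, mul_div_assoc, ENNReal.div_self (volume_toSet_ne_zero Q)
      (volume_toSet_ne_top Q), mul_one]
  unfold hlMaximal ofR
  simp only [h1]
  apply le_antisymm
  · exact iSup_le fun Q => iSup_le fun _ => le_rfl
  · have hx : x ∈ (cubeOf x 1 one_pos).toSet := by
      rw [cubeOf_toSet]; exact Metric.mem_closedBall_self zero_le_one
    exact le_iSup₂_of_le (cubeOf x 1 one_pos) hx le_rfl

lemma modular_div {n : ℕ} {p : (Fin n → ℝ) → ℝ} (hp : ∀ᵐ x, 1 ≤ p x) (F : (Fin n → ℝ) → ℝ≥0∞)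
    {a : ℝ≥0∞} (ha : a ≤ 1) (ha' : a ≠ ∞) :
    ∫⁻ x, (a * F x) ^ p x ≤ a * ∫⁻ x, F x ^ p x := by
  rw [← lintegral_const_mul' _ _ ha']
  apply lintegral_mono_ae
  filter_upwards [hp] with x hx
  rw [ENNReal.mul_rpow_of_nonneg _ _ (by linarith)]
  gcongr
  calc a ^ p x ≤ a ^ (1 : ℝ) := ENNReal.rpow_le_rpow_of_exponent_ge ha hx
    _ = a := ENNReal.rpow_one a

theorem hard_direction {n : ℕ} {p : (Fin n → ℝ) → ℝ} (hpm : Measurable p) {c B : ℝ}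
    (hc : 1 < c) (hp : ∀ x, c ≤ p x) (hB : ∀ x, p x ≤ B) (h1 : AInfty p)
    (h2 : AInfty fun x => p x / (p x - 1)) : MaximalBounded p := by
  rcases Nat.eq_zero_or_pos n with rfl | hn
  · refine ⟨1, one_pos, fun f _ _ => ?_⟩
    have : hlMaximal f = ofR f := funext (hlMaximal_zero_dim f)
    rw [this, ENNReal.ofReal_one, one_mul]
  have hp1 : ∀ x, 1 < p x := fun x => hc.trans_le (hp x)
  have hp'm : Measurable fun x => p x / (p x - 1) := hpm.div (hpm.sub measurable_const)
  have hp'1 : ∀ x, 1 ≤ p x / (p x - 1) := by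
    intro x
    rw [le_div_iff₀ (by linarith [hp1 x])]; linarith
  have hp'B : ∀ x, p x / (p x - 1) ≤ c / (c - 1) := by
    intro x
    rw [div_le_div_iff₀ (by linarith [hp1 x]) (by linarith)]
    nlinarith [hp x]
  obtain ⟨l1, ⟨hl1, hl1'⟩, C1, hC1, hA1⟩ := AIm_of_AInfty hpm (fun x => (hp1 x).le) hB h1
  obtain ⟨l2, ⟨hl2, hl2'⟩, C2, hC2, hA2⟩ := AIm_of_AInfty hp'm hp'1 hp'B h2
  obtain ⟨C3, hC3, hA3⟩ := AIm_improve hn (fun x => (hp1 x).le) hB hl1 hl1' hC1 hA1 (1 / 2) (by norm_num)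
  obtain ⟨C4, hC4, hA4⟩ := AIm_improve hn hp'1 hp'B hl2 hl2' hC2 hA2 (1 / 2) (by norm_num)
  obtain ⟨c0, hc0, D, hD, H⟩ := modular_bound hn hpm hc hp hB hC3 hA3 hC4 hA4
  set L := max 1 c0⁻¹ with hL
  have hL1 : 1 ≤ L := le_max_left _ _
  set D1 := max 1 D.toReal with hD1
  have hD11 : 1 ≤ D1 := le_max_left _ _
  have hL0 : 0 < L := by linarith
  have hD0 : 0 < D1 := by linarith
  refine ⟨L * D1, by positivity, fun f hf _ => ?_⟩
  rw [mul_comm, ← ENNReal.div_le_iff (by rw [ne_eq, ENNReal.ofReal_eq_zero, not_le]; positivity)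
    ENNReal.ofReal_ne_top]
  apply le_sInf
  rintro mu ⟨hmu0, hmu⟩
  rcases eq_or_ne mu ∞ with rfl | hmut
  · exact le_top
  rw [ENNReal.div_le_iff (by rw [ne_eq, ENNReal.ofReal_eq_zero, not_le]; positivity)
    ENNReal.ofReal_ne_top]
  set m := mu.toReal with hm
  have hm0 : 0 < m := ENNReal.toReal_pos hmu0.ne' hmut
  have hmue : mu = ENNReal.ofReal m := (ENNReal.ofReal_toReal hmut).symm
  have hap : ∀ᵐ x, 1 ≤ p x := Filter.Eventually.of_forall fun x => (hp1 x).le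
  have hk := H (fun y => (L * m)⁻¹ * f y) (hf.const_mul _) (by
    calc ∫⁻ x, ENNReal.ofReal |(L * m)⁻¹ * f x| ^ p x
        = ∫⁻ x, (ENNReal.ofReal L⁻¹ * (ofR f x / mu)) ^ p x := by
          congr 1; ext x
          congr 1
          rw [ofR, hmue, ← ENNReal.ofReal_div_of_pos hm0, ← ENNReal.ofReal_mul (by positivity),
            abs_mul, abs_of_pos (by positivity : 0 < (L * m)⁻¹)]
          congr 1
          rw [mul_inv]; ring
      _ ≤ ENNReal.ofReal L⁻¹ * ∫⁻ x, (ofR f x / mu) ^ p x :=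
          modular_div hap _ (by rw [ENNReal.ofReal_le_one]; exact inv_le_one_of_one_le₀ hL1)
            ENNReal.ofReal_ne_top
      _ ≤ ENNReal.ofReal L⁻¹ * 1 := by gcongr
      _ ≤ _ := by
          rw [mul_one]
          apply ENNReal.ofReal_le_ofReal
          rw [inv_le_comm₀ hL0 hc0]; exact le_max_right _ _)
  simp only [hlMaximal_const_mul f (by positivity : 0 ≤ (L * m)⁻¹)] at hk
  apply sInf_le
  refine ⟨by rw [hmue, ← ENNReal.ofReal_mul hm0.le, ENNReal.ofReal_pos]; positivity, ?_⟩
  calc ∫⁻ x, (hlMaximal f x / (mu * ENNReal.ofReal (L * D1))) ^ p x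
      = ∫⁻ x, (ENNReal.ofReal D1⁻¹ * (ENNReal.ofReal (L * m)⁻¹ * hlMaximal f x)) ^ p x := by
        congr 1; ext x
        congr 1
        rw [hmue, ← ENNReal.ofReal_mul hm0.le, ← mul_assoc (ENNReal.ofReal D1⁻¹), ← ENNReal.ofReal_mul (by positivity),
          div_eq_mul_inv, ← ENNReal.ofReal_inv_of_pos (by positivity), mul_comm]
        congr 2
        rw [← mul_inv]; congr 1; ring
    _ ≤ ENNReal.ofReal D1⁻¹ * ∫⁻ x, (ENNReal.ofReal (L * m)⁻¹ * hlMaximal f x) ^ p x :=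
        modular_div hap _ (by rw [ENNReal.ofReal_le_one]; exact inv_le_one_of_one_le₀ hD11)
            ENNReal.ofReal_ne_top
    _ ≤ ENNReal.ofReal D1⁻¹ * ENNReal.ofReal D1 := by
        gcongr
        refine hk.trans ?_
        rw [← ENNReal.ofReal_toReal hD]
        exact ENNReal.ofReal_le_ofReal (le_max_right _ _)
    _ = 1 := by
        rw [← ENNReal.ofReal_mul (by positivity), inv_mul_cancel₀ hD0.ne', ENNReal.ofReal_one]

/-! ### Changing the exponent on a null set -/

lemma vnorm_congr {n : ℕ} {p q : (Fin n → ℝ) → ℝ} (h : ∀ᵐ x, p x = q x)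
    (f : (Fin n → ℝ) → ℝ≥0∞) : vnorm p f = vnorm q f := by
  unfold vnorm
  congr 1; ext lam
  have : ∫⁻ x, (f x / lam) ^ p x = ∫⁻ x, (f x / lam) ^ q x := by
    apply lintegral_congr_ae
    filter_upwards [h] with x hx
    rw [hx]
  simp only [mem_ofPred_eq, this]

lemma MaximalBounded_congr {n : ℕ} {p q : (Fin n → ℝ) → ℝ} (h : ∀ᵐ x, p x = q x) :
    MaximalBounded p ↔ MaximalBounded q := by
  unfold MaximalBounded
  simp only [vnorm_congr h]

lemma AInfty_congr {n : ℕ} {p q : (Fin n → ℝ) → ℝ} (h : ∀ᵐ x, p x = q x) :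
    AInfty p ↔ AInfty q := by
  unfold AInfty AInftyWith
  simp only [vnorm_congr h]

/-! ### Necessity of the conditions -/

lemma vnorm_le_mul {n : ℕ} {p : (Fin n → ℝ) → ℝ} (hp : ∀ x, 0 ≤ p x) {F G : (Fin n → ℝ) → ℝ≥0∞}
    {a : ℝ} (ha : 0 < a) (h : ∀ x, F x ≤ ENNReal.ofReal a * G x) :
    vnorm p F ≤ ENNReal.ofReal a * vnorm p G := by
  have ha0 : ENNReal.ofReal a ≠ 0 := by rw [ne_eq, ENNReal.ofReal_eq_zero, not_le]; exact ha
  rw [mul_comm, ← ENNReal.div_le_iff ha0 ENNReal.ofReal_ne_top]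
  apply le_sInf
  rintro mu ⟨hmu0, hmu⟩
  rw [ENNReal.div_le_iff ha0 ENNReal.ofReal_ne_top]
  apply sInf_le
  refine ⟨ENNReal.mul_pos hmu0.ne' ha0, (lintegral_mono fun x => ?_).trans hmu⟩
  refine ENNReal.rpow_le_rpow ?_ (hp x)
  rw [mul_comm mu]
  calc F x / (ENNReal.ofReal a * mu) ≤ (ENNReal.ofReal a * G x) / (ENNReal.ofReal a * mu) :=
        ENNReal.div_le_div_right (h x) _
    _ = G x / mu := ENNReal.mul_div_mul_left _ _ ha0 ENNReal.ofReal_ne_top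

lemma cubeSum_eq {n : ℕ} {F : Set (RCube n)} (hF : PairwiseDisjointCubes F) (t : RCube n → ℝ)
    {E : RCube n → Set (Fin n → ℝ)} (hE : ∀ Q ∈ F, E Q ⊆ Q.toSet) {Q : RCube n} (hQ : Q ∈ F)
    {x : Fin n → ℝ} (hx : x ∈ E Q) : cubeSum F t E x = ENNReal.ofReal (t Q) := by
  unfold cubeSum
  apply le_antisymm
  · refine iSup_le fun Q' => iSup_le fun hQ' => iSup_le fun hx' => ?_
    have : Q' = Q := by
      by_contra hne
      exact Set.disjoint_left.1 (hF hQ' hQ hne) (hE _ hQ' hx') (hE _ hQ hx)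
    rw [this]
  · exact le_iSup_of_le Q (le_iSup_of_le hQ (le_iSup_of_le hx le_rfl))

lemma cubeSum_eq_zero {n : ℕ} {F : Set (RCube n)} (t : RCube n → ℝ)
    {E : RCube n → Set (Fin n → ℝ)} {x : Fin n → ℝ} (hx : ∀ Q ∈ F, x ∉ E Q) :
    cubeSum F t E x = 0 := by
  unfold cubeSum
  simp only [iSup_eq_zero]
  intro Q hQ hxQ
  exact (hx Q hQ hxQ).elim

lemma countable_of_pd {n : ℕ} {F : Set (RCube n)} (hF : PairwiseDisjointCubes F) : F.Countable :=
  countable_of_disjoint_cubes F (fun Q => Q) (fun _ hQ _ hQ' hne => hF hQ hQ' hne)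

lemma measurable_cubeSum {n : ℕ} {F : Set (RCube n)} (hF : F.Countable) (t : RCube n → ℝ)
    {E : RCube n → Set (Fin n → ℝ)} (hE : ∀ Q ∈ F, MeasurableSet (E Q)) :
    Measurable (cubeSum F t E) := by
  classical
  have : cubeSum F t E = fun x => ⨆ Q ∈ F, (E Q).indicator (fun _ => ENNReal.ofReal (t Q)) x := by
    funext x
    unfold cubeSum
    congr 1; ext Q; congr 1; ext hQ
    by_cases hx : x ∈ E Q
    · simp [hx]
    · simp [hx]
  rw [this]
  exact Measurable.biSup F hF fun Q hQ => measurable_const.indicator (hE Q hQ)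

lemma avg_le_hlMaximal {n : ℕ} (f : (Fin n → ℝ) → ℝ) (Q : RCube n) {x : Fin n → ℝ} (hx : x ∈ Q.toSet) :
    (∫⁻ y in Q.toSet, ENNReal.ofReal |f y|) / volume Q.toSet ≤ hlMaximal f x :=
  le_iSup₂_of_le Q hx le_rfl

theorem AInfty_of_bounded {n : ℕ} {p : (Fin n → ℝ) → ℝ} (hp : ∀ x, 1 ≤ p x) (h : MaximalBounded p) :
    AInfty p := by
  obtain ⟨C, hC, H⟩ := h
  refine ⟨1 / 2, ⟨by norm_num, by norm_num⟩, 2 * C, by positivity, ?_⟩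
  intro F hF t ht E hE
  rcases eq_or_ne (vnorm p (cubeSum F t E)) ∞ with htop | htop
  · rw [htop, ENNReal.mul_top (by rw [ne_eq, ENNReal.ofReal_eq_zero, not_le]; positivity)]
    exact le_top
  have hcnt := countable_of_pd hF
  have hEs : ∀ Q ∈ F, E Q ⊆ Q.toSet := fun Q hQ => (hE Q hQ).2.1
  have hfin : ∀ x, cubeSum F t E x ≠ ∞ := by
    intro x
    by_cases hx : ∃ Q ∈ F, x ∈ E Q
    · obtain ⟨Q, hQ, hx⟩ := hx
      rw [cubeSum_eq hF t hEs hQ hx]; exact ENNReal.ofReal_ne_top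
    · push Not at hx
      rw [cubeSum_eq_zero t hx]; exact ENNReal.zero_ne_top
  set f : (Fin n → ℝ) → ℝ := fun x => (cubeSum F t E x).toReal with hf
  have hfm : Measurable f := (measurable_cubeSum hcnt t fun Q hQ => (hE Q hQ).1).ennreal_toReal
  have hof : ofR f = cubeSum F t E := by
    funext x
    rw [ofR, hf, abs_of_nonneg ENNReal.toReal_nonneg, ENNReal.ofReal_toReal (hfin x)]
  have h1 := H f hfm (by rw [hof]; exact lt_top_iff_ne_top.2 htop)
  rw [hof] at h1
  have h2 : ∀ x, cubeSum F t RCube.toSet x ≤ ENNReal.ofReal 2 * hlMaximal f x := by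
    intro x
    by_cases hx : ∃ Q ∈ F, x ∈ Q.toSet
    · obtain ⟨Q, hQ, hx⟩ := hx
      rw [cubeSum_eq hF t (fun Q _ => Subset.rfl) hQ hx]
      have h3 : ENNReal.ofReal (t Q) * (ENNReal.ofReal (1 / 2) * volume Q.toSet) ≤
          ∫⁻ y in Q.toSet, ENNReal.ofReal |f y| := by
        calc _ ≤ ENNReal.ofReal (t Q) * volume (E Q) := by gcongr; exact (hE Q hQ).2.2
          _ = ∫⁻ y in E Q, ENNReal.ofReal (t Q) := by rw [setLIntegral_const]
          _ = ∫⁻ y in E Q, ENNReal.ofReal |f y| := by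
              apply setLIntegral_congr_fun (hE Q hQ).1
              intro y hy
              have := congrFun hof y
              rw [ofR, cubeSum_eq hF t hEs hQ hy] at this
              exact this.symm
          _ ≤ _ := lintegral_mono_set (hEs Q hQ)
      calc ENNReal.ofReal (t Q) = ENNReal.ofReal 2 *
            (ENNReal.ofReal (t Q) * (ENNReal.ofReal (1 / 2) * volume Q.toSet) / volume Q.toSet) := by
            rw [mul_div_assoc, mul_div_assoc, ENNReal.div_self (volume_toSet_ne_zero Q)
              (volume_toSet_ne_top Q), mul_one, mul_comm (ENNReal.ofReal (t Q)), ← mul_assoc,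
              ← ENNReal.ofReal_mul (by norm_num)]
            norm_num
        _ ≤ _ := by
            gcongr
            exact (ENNReal.div_le_div_right h3 _).trans (avg_le_hlMaximal f Q hx)
    · push Not at hx
      rw [cubeSum_eq_zero t hx]; exact zero_le
  calc _ ≤ ENNReal.ofReal 2 * vnorm p (hlMaximal f) :=
        vnorm_le_mul (fun x => zero_le_one.trans (hp x)) (by norm_num) h2
    _ ≤ ENNReal.ofReal 2 * (ENNReal.ofReal C * vnorm p (cubeSum F t E)) := by gcongr
    _ = _ := by rw [← mul_assoc, ← ENNReal.ofReal_mul (by norm_num)]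

/-! ### Necessity of the dual condition -/

lemma dual_core {n : ℕ} {p : (Fin n → ℝ) → ℝ} (hpm : Measurable p) {c : ℝ}
    (hc : 1 < c) (hp : ∀ x, c ≤ p x) {C : ℝ} (hC : 0 < C)
    (H : ∀ f : (Fin n → ℝ) → ℝ, Measurable f → vnorm p (ofR f) < ∞ →
      vnorm p (hlMaximal f) ≤ ENNReal.ofReal C * vnorm p (ofR f))
    (G : Finset (RCube n))
    (hG : ∀ Q ∈ G, ∀ Q' ∈ G, Q ≠ Q' → Disjoint Q.toSet Q'.toSet)
    (s : RCube n → ℝ) (hs : ∀ Q ∈ G, 0 ≤ s Q) (E : RCube n → Set (Fin n → ℝ))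
    (hEm : ∀ Q ∈ G, MeasurableSet (E Q)) (hEs : ∀ Q ∈ G, E Q ⊆ Q.toSet)
    (hEv : ∀ Q ∈ G, ENNReal.ofReal (1 / 2) * volume Q.toSet ≤ volume (E Q))
    (hsum : ∑ Q ∈ G, ∫⁻ x in E Q, ENNReal.ofReal (s Q) ^ (p x / (p x - 1)) ≤ 1) :
    ∑ Q ∈ G, ∫⁻ x in Q.toSet, ENNReal.ofReal (s Q / (16 * C)) ^ (p x / (p x - 1)) ≤ 1 := by
  classical
  by_contra hA
  push Not at hA
  set A := ∑ Q ∈ G, ∫⁻ x in Q.toSet, ENNReal.ofReal (s Q / (16 * C)) ^ (p x / (p x - 1)) with hAdef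
  set u : RCube n → ℝ := fun Q => s Q / (16 * C) with hu
  have hu0 : ∀ Q ∈ G, 0 ≤ u Q := fun Q hQ => div_nonneg (hs Q hQ) (by positivity)
  set q : (Fin n → ℝ) → ℝ := fun x => p x / (p x - 1) with hq
  have hp1 : ∀ x, 1 < p x := fun x => hc.trans_le (hp x)
  have hqm : Measurable q := hpm.div (hpm.sub measurable_const)
  have hq1 : ∀ x, 0 < q x - 1 := by
    intro x
    have : 0 < p x - 1 := by linarith [hp1 x]
    simp only [hq]
    rw [sub_pos, lt_div_iff₀ this]; linarith
  have hqB : ∀ x, q x ≤ c / (c - 1) := by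
    intro x
    simp only [hq]
    rw [div_le_div_iff₀ (by linarith [hp1 x]) (by linarith)]
    nlinarith [hp x]
  have hqp : ∀ x, (q x - 1) * p x = q x := by
    intro x
    have : p x - 1 ≠ 0 := by linarith [hp1 x]
    simp only [hq]
    field_simp
    ring
  have hconj : ∀ x, (q x).HolderConjugate (p x) := by
    intro x
    have h1 := hp1 x
    have h2 := hq1 x
    rw [Real.holderConjugate_iff]
    refine ⟨by linarith, ?_⟩
    have : p x - 1 ≠ 0 := by linarith
    have : p x ≠ 0 := by linarith
    simp only [hq]
    field_simp
    ring
  have hAtop : A ≠ ∞ := by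
    rw [hAdef]
    refine (ENNReal.sum_lt_top.2 fun Q hQ => ?_).ne
    have hb : ∀ x, ENNReal.ofReal (u Q) ^ q x ≤ (max 1 (ENNReal.ofReal (u Q))) ^ (c / (c - 1)) := by
      intro x
      calc _ ≤ (max 1 (ENNReal.ofReal (u Q))) ^ q x :=
            ENNReal.rpow_le_rpow (le_max_right _ _) (by linarith [hq1 x])
        _ ≤ _ := ENNReal.rpow_le_rpow_of_exponent_le (le_max_left _ _) (hqB x)
    refine lt_of_le_of_lt (lintegral_mono hb) ?_
    rw [setLIntegral_const]
    refine ENNReal.mul_lt_top (ENNReal.rpow_lt_top_of_nonneg ?_ ?_)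
      (lt_top_iff_ne_top.2 (volume_toSet_ne_top Q))
    · exact div_nonneg (by linarith) (by linarith)
    · exact (max_lt ENNReal.one_lt_top ENNReal.ofReal_lt_top).ne
  have hA0 : A ≠ 0 := (zero_lt_one.trans hA).ne'
  set φ : (Fin n → ℝ) → ℝ := fun x => ∑ Q ∈ G, Q.toSet.indicator (fun x => u Q ^ (q x - 1)) x with hφ
  have hφm : Measurable φ := by
    refine Finset.measurable_fun_sum _ fun Q _ => ?_
    exact (measurable_const.pow (hqm.sub measurable_const)).indicator (measurableSet_toSet Q)
  have hφQ : ∀ Q ∈ G, ∀ x ∈ Q.toSet, φ x = u Q ^ (q x - 1) := by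
    intro Q hQ x hx
    simp only [hφ]
    rw [Finset.sum_eq_single Q]
    · rw [Set.indicator_of_mem hx]
    · intro Q' hQ' hne
      rw [Set.indicator_of_notMem]
      exact fun hx' => Set.disjoint_left.1 (hG Q' hQ' Q hQ hne) hx' hx
    · exact fun h => (h hQ).elim
  have hofQ : ∀ Q ∈ G, ∀ x ∈ Q.toSet, ofR φ x = ENNReal.ofReal (u Q) ^ (q x - 1) := by
    intro Q hQ x hx
    rw [ofR, hφQ Q hQ x hx, abs_of_nonneg (Real.rpow_nonneg (hu0 Q hQ) _),
      ENNReal.ofReal_rpow_of_nonneg (hu0 Q hQ) (hq1 x).le]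
  have hint : ∫⁻ x, ofR φ x ^ p x = A := by
    have hpt : ∀ x, ofR φ x ^ p x =
        ∑ Q ∈ G, Q.toSet.indicator (fun x => ENNReal.ofReal (u Q) ^ q x) x := by
      intro x
      by_cases hx : ∃ Q ∈ G, x ∈ Q.toSet
      · obtain ⟨Q, hQ, hx⟩ := hx
        rw [hofQ Q hQ x hx, ← ENNReal.rpow_mul, hqp, Finset.sum_eq_single Q]
        · rw [Set.indicator_of_mem hx]
        · intro Q' hQ' hne
          rw [Set.indicator_of_notMem]
          exact fun hx' => Set.disjoint_left.1 (hG Q' hQ' Q hQ hne) hx' hx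
        · exact fun h => (h hQ).elim
      · push Not at hx
        have h0 : φ x = 0 := Finset.sum_eq_zero fun Q hQ => Set.indicator_of_notMem (hx Q hQ) _
        rw [ofR, h0, abs_zero, ENNReal.ofReal_zero, ENNReal.zero_rpow_of_pos (by linarith [hp1 x])]
        exact (Finset.sum_eq_zero fun Q hQ => Set.indicator_of_notMem (hx Q hQ) _).symm
    rw [lintegral_congr hpt, lintegral_finsetSum]
    · rw [hAdef]
      refine Finset.sum_congr rfl fun Q _ => ?_
      rw [lintegral_indicator (measurableSet_toSet Q)]
    · intro Q _
      exact (measurable_const.pow hqm).indicator (measurableSet_toSet Q)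
  have hnorm : vnorm p (ofR φ) ≤ A := by
    refine sInf_le ⟨zero_lt_one.trans hA, ?_⟩
    calc ∫⁻ x, (ofR φ x / A) ^ p x = ∫⁻ x, (A⁻¹ * ofR φ x) ^ p x := by
          congr 1; ext x; rw [div_eq_mul_inv, mul_comm]
      _ ≤ A⁻¹ * ∫⁻ x, ofR φ x ^ p x := modular_div
          (Filter.Eventually.of_forall fun x => (hp1 x).le) _ (ENNReal.inv_le_one.2 hA.le)
          (ENNReal.inv_ne_top.2 hA0)
      _ = 1 := by rw [hint, ENNReal.inv_mul_cancel hA0 hAtop]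
  have hM : vnorm p (hlMaximal φ) < ENNReal.ofReal (2 * C) * A := by
    refine lt_of_le_of_lt ((H φ hφm (hnorm.trans_lt (lt_top_iff_ne_top.2 hAtop))).trans
      (mul_le_mul_right hnorm _)) ?_
    refine (ENNReal.mul_lt_mul_iff_left hA0 hAtop).2 ?_
    rw [ENNReal.ofReal_lt_ofReal_iff (by positivity)]; linarith
  obtain ⟨lam, ⟨hlam0, hlam⟩, hlamlt⟩ := sInf_lt_iff.1 hM
  have hlamtop : lam ≠ ∞ := (hlamlt.trans_le le_top).ne
  set ψ : (Fin n → ℝ) → ℝ≥0∞ := fun x => hlMaximal φ x / lam with hψ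
  have hMψ : ∀ x, hlMaximal φ x = lam * ψ x := by
    intro x
    rw [hψ, ENNReal.mul_div_cancel hlam0.ne' hlamtop]
  have hI : ∀ Q ∈ G, ∫⁻ x in Q.toSet, ENNReal.ofReal (u Q) ^ q x ≤
      ENNReal.ofReal (2 / (16 * C)) * lam *
        ((∫⁻ x in E Q, ENNReal.ofReal (s Q) ^ q x) + ∫⁻ x in E Q, ψ x ^ p x) := by
    intro Q hQ
    have hv0 := volume_toSet_ne_zero Q
    have hvt := volume_toSet_ne_top Q
    set I := ∫⁻ x in Q.toSet, ENNReal.ofReal |φ x| with hIdef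
    have e1 : ∫⁻ x in Q.toSet, ENNReal.ofReal (u Q) ^ q x = ENNReal.ofReal (u Q) * I := by
      rw [hIdef, ← lintegral_const_mul' _ _ ENNReal.ofReal_ne_top]
      refine setLIntegral_congr_fun (measurableSet_toSet Q) fun x hx => ?_
      have := hofQ Q hQ x hx
      rw [ofR] at this
      simp only [this]
      have hh : q x = 1 + (q x - 1) := by ring
      conv_lhs => rw [hh]
      rw [ENNReal.rpow_add_of_nonneg _ _ zero_le_one (hq1 x).le, ENNReal.rpow_one]
    have e2 : I ≤ ENNReal.ofReal 2 * (lam * ∫⁻ x in E Q, ψ x) := by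
      calc I = ENNReal.ofReal 2 * (I / volume Q.toSet * (ENNReal.ofReal (1 / 2) * volume Q.toSet)) := by
            have h2 : ENNReal.ofReal 2 * ENNReal.ofReal (1 / 2) = 1 := by
              rw [← ENNReal.ofReal_mul (by norm_num)]; norm_num
            calc I = (ENNReal.ofReal 2 * ENNReal.ofReal (1 / 2)) * (I / volume Q.toSet * volume Q.toSet) := by
                  rw [h2, one_mul, ENNReal.div_mul_cancel hv0 hvt]
              _ = _ := by ring
        _ ≤ ENNReal.ofReal 2 * (I / volume Q.toSet * volume (E Q)) := by
            gcongr; exact hEv Q hQ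
        _ = ENNReal.ofReal 2 * ∫⁻ x in E Q, I / volume Q.toSet := by rw [setLIntegral_const]
        _ ≤ ENNReal.ofReal 2 * ∫⁻ x in E Q, lam * ψ x := by
            refine mul_le_mul_right ?_ _
            refine setLIntegral_mono' (hEm Q hQ) fun x hx => ?_
            rw [← hMψ]
            exact avg_le_hlMaximal φ Q (hEs Q hQ hx)
        _ = _ := by rw [lintegral_const_mul' _ _ hlamtop]
    have e3 : ENNReal.ofReal (s Q) * ∫⁻ x in E Q, ψ x ≤
        (∫⁻ x in E Q, ENNReal.ofReal (s Q) ^ q x) + ∫⁻ x in E Q, ψ x ^ p x := by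
      rw [← lintegral_const_mul' _ _ ENNReal.ofReal_ne_top,
        ← lintegral_add_left (measurable_const.pow hqm)]
      refine lintegral_mono fun x => ?_
      refine (ENNReal.young_inequality _ _ (hconj x)).trans ?_
      refine add_le_add (ENNReal.div_le_of_le_mul ?_) (ENNReal.div_le_of_le_mul ?_)
      · refine le_mul_of_one_le_right zero_le ?_
        rw [ENNReal.one_le_ofReal]; linarith [hq1 x]
      · refine le_mul_of_one_le_right zero_le ?_
        rw [ENNReal.one_le_ofReal]; exact (hp1 x).le
    rw [e1]
    calc ENNReal.ofReal (u Q) * I ≤ ENNReal.ofReal (u Q) * (ENNReal.ofReal 2 * (lam * ∫⁻ x in E Q, ψ x)) :=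
          mul_le_mul_right e2 _
      _ = ENNReal.ofReal (2 / (16 * C)) * lam * (ENNReal.ofReal (s Q) * ∫⁻ x in E Q, ψ x) := by
          have : ENNReal.ofReal (u Q) * ENNReal.ofReal 2 =
              ENNReal.ofReal (2 / (16 * C)) * ENNReal.ofReal (s Q) := by
            rw [← ENNReal.ofReal_mul (hu0 Q hQ), ← ENNReal.ofReal_mul (by positivity)]
            congr 1
            simp only [hu]; ring
          rw [← mul_assoc, this]; ring
      _ ≤ _ := mul_le_mul_right e3 _
  have hψs : ∑ Q ∈ G, ∫⁻ x in E Q, ψ x ^ p x ≤ 1 := by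
    rw [← lintegral_biUnion_finset]
    · exact (setLIntegral_le_lintegral _ _).trans hlam
    · intro Q hQ Q' hQ' hne
      exact (hG Q hQ Q' hQ' hne).mono (hEs Q hQ) (hEs Q' hQ')
    · exact hEm
  have hfin : A ≤ ENNReal.ofReal (1 / 2) * A := by
    calc A ≤ ∑ Q ∈ G, ENNReal.ofReal (2 / (16 * C)) * lam *
        ((∫⁻ x in E Q, ENNReal.ofReal (s Q) ^ q x) + ∫⁻ x in E Q, ψ x ^ p x) :=
          Finset.sum_le_sum hI
      _ = ENNReal.ofReal (2 / (16 * C)) * lam * ((∑ Q ∈ G, ∫⁻ x in E Q, ENNReal.ofReal (s Q) ^ q x) +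
          ∑ Q ∈ G, ∫⁻ x in E Q, ψ x ^ p x) := by
          rw [← Finset.mul_sum, Finset.sum_add_distrib]
      _ ≤ ENNReal.ofReal (2 / (16 * C)) * (ENNReal.ofReal (2 * C) * A) * ENNReal.ofReal 2 := by
          refine mul_le_mul' (mul_le_mul_right hlamlt.le _) ?_
          refine (add_le_add hsum hψs).trans (le_of_eq ?_)
          rw [← ENNReal.ofReal_one, ← ENNReal.ofReal_add zero_le_one zero_le_one]; norm_num
      _ = (ENNReal.ofReal (2 / (16 * C)) * ENNReal.ofReal (2 * C) * ENNReal.ofReal 2) * A := by ring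
      _ = _ := by
          rw [← ENNReal.ofReal_mul (by positivity), ← ENNReal.ofReal_mul (by positivity)]
          congr 2
          field_simp; norm_num
  have hlt : ENNReal.ofReal (1 / 2) * A < 1 * A := by
    refine (ENNReal.mul_lt_mul_iff_left hA0 hAtop).2 ?_
    rw [ENNReal.ofReal_lt_one]; norm_num
  rw [one_mul] at hlt
  exact absurd hfin (not_le.2 hlt)

theorem AInfty_dual_of_bounded {n : ℕ} {p : (Fin n → ℝ) → ℝ} (hpm : Measurable p) {c : ℝ}
    (hc : 1 < c) (hp : ∀ x, c ≤ p x) (h : MaximalBounded p) :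
    AInfty fun x => p x / (p x - 1) := by
  classical
  obtain ⟨C, hC, H⟩ := h
  refine ⟨1 / 2, ⟨by norm_num, by norm_num⟩, 16 * C, by positivity, ?_⟩
  intro F hF t ht E hE
  have hp1 : ∀ x, 1 < p x := fun x => hc.trans_le (hp x)
  have hqm : Measurable fun x => p x / (p x - 1) := hpm.div (hpm.sub measurable_const)
  have hq0 : ∀ᵐ x, 0 < p x / (p x - 1) :=
    Filter.Eventually.of_forall fun x => div_pos (by linarith [hp1 x]) (by linarith [hp1 x])
  have hK0 : ENNReal.ofReal (16 * C) ≠ 0 := by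
    rw [ne_eq, ENNReal.ofReal_eq_zero, not_le]; positivity
  have : Countable F := (countable_of_pd hF).to_subtype
  have hQ : Pairwise fun i j : F => Disjoint (i : RCube n).toSet (j : RCube n).toSet := by
    intro i j hne
    exact hF i.2 j.2 fun h => hne (Subtype.ext h)
  have e1 := fun mu => cubeSum_range_lintegral _ hqm hq0 (Subtype.val : F → RCube n) hQ t E
    (fun i => (hE i i.2).1) (fun i => (hE i i.2).2.1) mu
  have e2 := fun mu => cubeSum_range_lintegral _ hqm hq0 (Subtype.val : F → RCube n) hQ t
    RCube.toSet (fun i => measurableSet_toSet _) (fun i => le_rfl) mu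
  rw [Subtype.range_coe] at e1 e2
  rw [mul_comm, ← ENNReal.div_le_iff hK0 ENNReal.ofReal_ne_top]
  apply le_sInf
  rintro mu ⟨hmu0, hmu⟩
  rcases eq_or_ne mu ∞ with rfl | hmut
  · exact le_top
  rw [ENNReal.div_le_iff hK0 ENNReal.ofReal_ne_top]
  set m := mu.toReal with hm
  have hm0 : 0 < m := ENNReal.toReal_pos hmu0.ne' hmut
  have hmue : mu = ENNReal.ofReal m := (ENNReal.ofReal_toReal hmut).symm
  refine sInf_le ⟨ENNReal.mul_pos hmu0.ne' hK0, ?_⟩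
  rw [e1] at hmu
  rw [e2, ENNReal.tsum_eq_iSup_sum]
  refine iSup_le fun G0 => ?_
  have hinj : Set.InjOn (Subtype.val : F → RCube n) (G0 : Set F) := Subtype.val_injective.injOn
  have hmem : ∀ Q ∈ G0.image (Subtype.val : F → RCube n), Q ∈ F := by
    intro Q hQ
    obtain ⟨i, _, rfl⟩ := Finset.mem_image.1 hQ
    exact i.2
  have key := dual_core hpm hc hp hC H (G0.image (Subtype.val : F → RCube n))
    (fun Q hQ Q' hQ' hne => hF (hmem Q hQ) (hmem Q' hQ') hne) (fun Q => t Q / m)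
    (fun Q hQ => div_nonneg (ht Q (hmem Q hQ)) hm0.le) E
    (fun Q hQ => (hE Q (hmem Q hQ)).1) (fun Q hQ => (hE Q (hmem Q hQ)).2.1)
    (fun Q hQ => (hE Q (hmem Q hQ)).2.2)
  rw [Finset.sum_image hinj, Finset.sum_image hinj] at key
  refine le_trans (le_of_eq ?_) (key ?_)
  · refine Finset.sum_congr rfl fun Q _ => ?_
    congr 1; ext x; congr 1
    rw [hmue, ← ENNReal.ofReal_mul hm0.le, ← ENNReal.ofReal_div_of_pos (by positivity), div_div]
  · refine le_trans (le_of_eq ?_) ((ENNReal.sum_le_tsum G0).trans hmu)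
    refine Finset.sum_congr rfl fun Q _ => ?_
    congr 1; ext x; congr 1
    rw [hmue, ← ENNReal.ofReal_div_of_pos hm0]

theorem statement0 {n : ℕ} (p : (Fin n → ℝ) → ℝ) (hpm : Measurable p)
    (hp1 : ∀ x, 1 ≤ p x)
    (hlow : ∃ c : ℝ, 1 < c ∧ ∀ᵐ x ∂(volume : Measure (Fin n → ℝ)), c ≤ p x)
    (hup : ∃ B : ℝ, ∀ᵐ x ∂(volume : Measure (Fin n → ℝ)), p x ≤ B) :
    MaximalBounded p ↔ (AInfty p ∧ AInfty fun x => p x / (p x - 1)) := by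
  obtain ⟨c, hc, hlow⟩ := hlow
  obtain ⟨B, hup⟩ := hup
  set p2 : (Fin n → ℝ) → ℝ := fun x => max c (min (p x) (max B c)) with hp2
  have hm2 : Measurable p2 := measurable_const.max (hpm.min measurable_const)
  have hl2 : ∀ x, c ≤ p2 x := fun x => le_max_left _ _
  have hu2 : ∀ x, p2 x ≤ max B c := fun x => max_le (le_max_right _ _) (min_le_right _ _)
  have heq : ∀ᵐ x, p x = p2 x := by
    filter_upwards [hlow, hup] with x h1 h2
    simp only [hp2]
    rw [min_eq_left (h2.trans (le_max_left _ _)), max_eq_right h1]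
  have heq' : ∀ᵐ x, p x / (p x - 1) = p2 x / (p2 x - 1) := by
    filter_upwards [heq] with x h
    rw [h]
  rw [MaximalBounded_congr heq, AInfty_congr heq, AInfty_congr heq']
  exact ⟨fun h => ⟨AInfty_of_bounded (fun x => hc.le.trans (hl2 x)) h,
    AInfty_dual_of_bounded hm2 hc hl2 h⟩, fun h => hard_direction hm2 hc hl2 hu2 h.1 h.2⟩
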